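/- Let K be a number field and G a finite group. Then there exist a finitely generated field extension F of K of transcendence degree 2 over K, a finite Galois field extension E of F whose Galois group is isomorphic to G, and a finite set T of primes of K, such that for every prime v of K not in T and every finite Galois field extension L of the completion K_v whose Galois group is isomorphic to a subgroup of G, the extension L of K_v is a specialization of E/F over K_v. -/

import Mathlib

open scoped TensorProduct
open IsDedekindDomain NumberField

set_option synthInstance.maxHeartbeats 1000000
set_option maxHeartbeats 2000000
/-- `M/Ω` is a specialization of the finite Galois field extension `E/F` over `Ω`:
there are a finitely generated `K`-subalgebra `A` of `F`, integrally closed in `F` with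
fraction field `F`, and a `K`-algebra homomorphism `ψ : A → Ω` such that, with `B` the
integral closure of `A` in `E`, the ring `Ω ⊗[A] B` (via `ψ`) is reduced and has a quotient
by a maximal ideal which is isomorphic to `M` as an `Ω`-algebra. -/
def IsSpecialization (K F E Ω M : Type) [Field K] [Field F] [Field E] [Field Ω] [Field M]
    [Algebra K F] [Algebra F E] [Algebra K Ω] [Algebra Ω M] : Prop :=
  ∃ A : Subalgebra K F, A.FG ∧ (∀ x : F, IsIntegral A x → x ∈ A) ∧ IsFractionRing A F ∧
    ∃ ψ : A →ₐ[K] Ω,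
      letI : Algebra A E := ((algebraMap F E).comp (algebraMap A F)).toAlgebra
      letI : Algebra A Ω := ψ.toRingHom.toAlgebra
      IsReduced (Ω ⊗[A] (integralClosure A E)) ∧
      ∃ m : Ideal (Ω ⊗[A] (integralClosure A E)), m.IsMaximal ∧
        Nonempty (((Ω ⊗[A] (integralClosure A E)) ⧸ m) ≃ₐ[Ω] M)

section

open Polynomial Finset
open scoped NNReal

section Stepanov

variable {F : Type*} [Field F]

/-- `stepanovT M W i r α` is the polynomial `T` with `M ^ r * D ^ r (α * U ^ i) = U ^ i * T`,
where `U` satisfies `M * U' = W * U`. -/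
noncomputable def stepanovT (M W : F[X]) (i : ℕ) : ℕ → F[X] →ₗ[F] F[X]
  | 0 => LinearMap.id
  | r + 1 => (LinearMap.mulLeft F M ∘ₗ derivative +
      LinearMap.mulLeft F ((i : F[X]) * W - (r : F[X]) * derivative M)) ∘ₗ stepanovT M W i r

theorem stepanovT_succ (M W : F[X]) (i r : ℕ) (α : F[X]) :
    stepanovT M W i (r + 1) α = M * derivative (stepanovT M W i r α) +
      ((i : F[X]) * W - (r : F[X]) * derivative M) * stepanovT M W i r α := rfl

theorem natDegree_stepanovT_le {M W : F[X]} {k : ℕ} (hM : M.natDegree ≤ k)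
    (hW : W.natDegree ≤ k) (i r : ℕ) (α : F[X]) :
    (stepanovT M W i r α).natDegree ≤ α.natDegree + r * k := by
  induction r with
  | zero => simp [stepanovT]
  | succ r ih =>
    rw [stepanovT_succ]
    have h1 : (M * derivative (stepanovT M W i r α)).natDegree ≤ α.natDegree + (r + 1) * k := by
      refine natDegree_mul_le.trans ?_
      have := natDegree_derivative_le (stepanovT M W i r α)
      rw [add_mul]
      omega
    have h2 : ((i : F[X]) * W - (r : F[X]) * derivative M).natDegree ≤ k := by
      refine (natDegree_sub_le _ _).trans (max_le ?_ ?_)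
      · refine natDegree_mul_le.trans ?_
        simpa using hW
      · refine natDegree_mul_le.trans ?_
        have := natDegree_derivative_le M
        simp only [natDegree_natCast]
        omega
    refine (natDegree_add_le _ _).trans (max_le h1 (natDegree_mul_le.trans ?_))
    rw [add_mul]
    omega

theorem pow_mul_iterate_derivative_eq {M W U : F[X]} (hU : M * derivative U = W * U)
    (i r : ℕ) (α : F[X]) :
    M ^ r * derivative^[r] (α * U ^ i) = U ^ i * stepanovT M W i r α := by
  induction r with
  | zero => simp [stepanovT, mul_comm]
  | succ r ih =>
    have h := congrArg derivative ih
    rw [derivative_mul, derivative_mul, ← Function.iterate_succ_apply' (⇑derivative)] at h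
    have hM : M * derivative (M ^ r) = (r : F[X]) * M ^ r * derivative M := by
      cases r with
      | zero => simp
      | succ r => rw [derivative_pow]; simp; ring
    have hUi : M * derivative (U ^ i) = (i : F[X]) * U ^ i * W := by
      cases i with
      | zero => simp
      | succ i =>
        rw [derivative_pow]; simp
        linear_combination ((i + 1 : F[X]) * U ^ i) * hU
    rw [stepanovT_succ]
    linear_combination M * h - (derivative^[r] (α * U ^ i)) * hM + stepanovT M W i r α * hUi -
      (r : F[X]) * derivative M * ih

theorem iterate_derivative_pow_mul {q : ℕ} (hq : (q : F) = 0) (l r : ℕ) (P : F[X]) :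
    derivative^[r] (X ^ (q * l) * P) = X ^ (q * l) * derivative^[r] P := by
  induction r with
  | zero => simp
  | succ r ih =>
    rw [Function.iterate_succ_apply', ih, derivative_mul, Function.iterate_succ_apply']
    simp [derivative_X_pow, hq]

/-- The auxiliary polynomial of Stepanov's method. -/
noncomputable def stepanovPhi (U : F[X]) (q : ℕ) {d b a : ℕ} (α : Fin d → Fin b → Fin a → F) :
    F[X] :=
  ∑ i : Fin d, (∑ l : Fin b, X ^ (q * l) * ∑ j : Fin a, C (α i l j) * X ^ (j : ℕ)) * U ^ (i : ℕ)

theorem natDegree_sum_C_mul_X_pow_le {a : ℕ} (β : Fin a → F) :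
    (∑ j : Fin a, C (β j) * X ^ (j : ℕ)).natDegree ≤ a - 1 := by
  refine natDegree_sum_le_of_forall_le _ _ fun j _ => (natDegree_C_mul_X_pow_le _ _).trans ?_
  omega

theorem exists_stepanov {M W U : F[X]} {k q d a b m : ℕ} (hM : M.natDegree ≤ k)
    (hW : W.natDegree ≤ k) (hU : M * derivative U = W * U) (hq : (q : F) = 0) (η δ : F)
    (hdim : m * (a + b + m * k) < d * (b * a)) :
    ∃ α : Fin d → Fin b → Fin a → F, α ≠ 0 ∧ ∀ y : F, U.eval y = η → y ^ q = y + δ →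
      M.eval y ≠ 0 → ∀ r < m, (derivative^[r] (stepanovPhi U q α)).eval y = 0 := by
  classical
  let P : (Fin d → Fin b → Fin a → F) → Fin d → Fin b → F[X] :=
    fun α i l => ∑ j : Fin a, C (α i l j) * X ^ (j : ℕ)
  let G : ℕ → (Fin d → Fin b → Fin a → F) → F[X] := fun r α =>
    ∑ i : Fin d, ∑ l : Fin b, C (η ^ (i : ℕ)) * (X + C δ) ^ (l : ℕ) *
      stepanovT M W i r (P α i l)
  have hPadd : ∀ α β i l, P (α + β) i l = P α i l + P β i l := by
    intro α β i l
    simp [P, add_mul, Finset.sum_add_distrib]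
  have hPsmul : ∀ (c : F) α i l, P (c • α) i l = c • P α i l := by
    intro c α i l
    simp only [P, Pi.smul_apply, smul_eq_mul, C_mul, Finset.smul_sum, smul_eq_C_mul, mul_assoc]
  let Λ : (Fin d → Fin b → Fin a → F) →ₗ[F] (Fin m × Fin (a + b + m * k) → F) :=
    { toFun := fun α x => (G x.1 α).coeff x.2
      map_add' := by
        intro α β
        ext x
        simp only [G, hPadd, map_add, mul_add, Finset.sum_add_distrib, coeff_add, Pi.add_apply]
      map_smul' := by
        intro c α
        ext x
        simp only [G, hPsmul, map_smul, mul_smul_comm, ← Finset.smul_sum, coeff_smul,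
          Pi.smul_apply, RingHom.id_apply] }
  have hker : LinearMap.ker Λ ≠ ⊥ := by
    apply LinearMap.ker_ne_bot_of_finrank_lt
    simpa [Module.finrank_pi_fintype] using hdim
  obtain ⟨α, hα, hα0⟩ := (Submodule.ne_bot_iff _).1 hker
  refine ⟨α, hα0, fun y hy hyq hMy r hr => ?_⟩
  have hG : G r α = 0 := by
    have hdeg : (G r α).natDegree < a + b + m * k := by
      have hle : (G r α).natDegree ≤ (a - 1) + (b - 1) + r * k := by
        refine natDegree_sum_le_of_forall_le _ _ fun i _ => ?_
        refine natDegree_sum_le_of_forall_le _ _ fun l _ => ?_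
        refine natDegree_mul_le.trans ?_
        have h1 := natDegree_stepanovT_le hM hW i r (P α i l)
        have h2 : (P α i l).natDegree ≤ a - 1 := natDegree_sum_C_mul_X_pow_le _
        have h3 : (C (η ^ (i : ℕ)) * (X + C δ) ^ (l : ℕ)).natDegree ≤ b - 1 := by
          refine (natDegree_C_mul_le _ _).trans ?_
          rw [natDegree_pow, natDegree_X_add_C]
          omega
        omega
      have : r * k ≤ m * k := Nat.mul_le_mul_right _ hr.le
      rcases Nat.eq_zero_or_pos (a + b) with h | h
      · exfalso
        have : a = 0 := by omega
        subst this
        simp at hdim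
      · omega
    ext n
    by_cases hn : n < a + b + m * k
    · exact congrFun hα (⟨r, hr⟩, ⟨n, hn⟩)
    · exact coeff_eq_zero_of_natDegree_lt (by omega)
  have hΦ : M ^ r * derivative^[r] (stepanovPhi U q α) =
      ∑ i : Fin d, ∑ l : Fin b, X ^ (q * l) * (U ^ (i : ℕ) * stepanovT M W i r (P α i l)) := by
    have h1 : stepanovPhi U q α = ∑ i : Fin d, ∑ l : Fin b,
        X ^ (q * l) * (P α i l * U ^ (i : ℕ)) := by
      simp only [stepanovPhi, Finset.sum_mul, P, mul_assoc]
    simp only [h1, iterate_derivative_sum, iterate_derivative_pow_mul hq]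
    rw [Finset.mul_sum]
    refine Finset.sum_congr rfl fun i _ => ?_
    rw [Finset.mul_sum]
    refine Finset.sum_congr rfl fun l _ => ?_
    rw [← pow_mul_iterate_derivative_eq hU]
    ring
  have h := congrArg (eval y) hΦ
  have h' : eval y (G r α) = 0 := by rw [hG, eval_zero]
  have h2 : eval y (M ^ r * derivative^[r] (stepanovPhi U q α)) = 0 := by
    rw [h, ← h']
    simp only [G, eval_finsetSum, eval_mul, eval_pow, eval_X, eval_C, eval_add, hy, pow_mul, hyq]
    exact Finset.sum_congr rfl fun i _ => Finset.sum_congr rfl fun l _ => by ring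
  rw [eval_mul, eval_pow] at h2
  exact (mul_eq_zero.1 h2).resolve_left (pow_ne_zero _ hMy)

theorem coeff_stepanov_inner (q : ℕ) {b a : ℕ} (β : Fin b → Fin a → F) (n : ℕ) :
    (∑ l : Fin b, X ^ (q * l) * ∑ j : Fin a, C (β l j) * X ^ (j : ℕ)).coeff n =
      ∑ l : Fin b, ∑ j : Fin a, if n = q * l + j then β l j else 0 := by
  rw [finsetSum_coeff]
  refine Finset.sum_congr rfl fun l _ => ?_
  rw [Finset.mul_sum, finsetSum_coeff]
  refine Finset.sum_congr rfl fun j _ => ?_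
  rw [show (X : F[X]) ^ (q * (l : ℕ)) * (C (β l j) * X ^ (j : ℕ)) =
    C (β l j) * X ^ (q * (l : ℕ) + j) by ring, coeff_C_mul_X_pow]

/-- A sum of polynomials with pairwise distinct trailing degrees does not vanish. -/
theorem sum_ne_zero_of_natTrailingDegree {ι : Type*} [Fintype ι] (f : ι → F[X])
    (hf : ∃ i, f i ≠ 0)
    (h : ∀ i j, i ≠ j → f i ≠ 0 → f j ≠ 0 → (f i).natTrailingDegree ≠ (f j).natTrailingDegree) :
    ∑ i, f i ≠ 0 := by
  classical
  obtain ⟨i₀, hi₀⟩ := hf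
  obtain ⟨i, hi, hmin⟩ := Finset.exists_min_image (Finset.univ.filter fun i => f i ≠ 0)
    (fun i => (f i).natTrailingDegree) ⟨i₀, by simpa using hi₀⟩
  have hi' : f i ≠ 0 := by simpa using hi
  intro hsum
  have hc := congrArg (fun P => coeff P (f i).natTrailingDegree) hsum
  simp only [finsetSum_coeff, coeff_zero] at hc
  rw [Finset.sum_eq_single i] at hc
  · exact hi' (trailingCoeff_eq_zero.1 hc)
  · intro j _ hj
    by_cases hj0 : f j = 0
    · simp [hj0]
    · refine coeff_eq_zero_of_lt_natTrailingDegree (lt_of_le_of_ne (hmin j (by simpa using hj0)) ?_)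
      exact h i j hj.symm hi' hj0
  · simp

theorem stepanovPhi_ne_zero {U : F[X]} {q d b a e ρ : ℕ} (hU : U ≠ 0)
    (hUe : U.natTrailingDegree = e) (he : d * e + 1 = q * ρ) (ha : d * a ≤ q) (had : a ≤ q)
    {α : Fin d → Fin b → Fin a → F} (hα : α ≠ 0) : stepanovPhi U q α ≠ 0 := by
  classical
  set A : Fin d → F[X] := fun i =>
    ∑ l : Fin b, X ^ (q * l) * ∑ j : Fin a, C (α i l j) * X ^ (j : ℕ) with hA
  have htr : ∀ i, A i ≠ 0 → ∃ w u : ℕ, u < a ∧ (A i).natTrailingDegree = q * w + u := by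
    intro i hi
    have h1 : (A i).coeff (A i).natTrailingDegree ≠ 0 := by
      rwa [Ne, ← trailingCoeff, trailingCoeff_eq_zero]
    rw [hA, coeff_stepanov_inner] at h1
    obtain ⟨l, _, hl⟩ := Finset.exists_ne_zero_of_sum_ne_zero h1
    obtain ⟨j, _, hj⟩ := Finset.exists_ne_zero_of_sum_ne_zero hl
    refine ⟨l, j, j.2, ?_⟩
    by_contra hne
    exact hj (if_neg hne)
  have hex : ∃ i, A i ≠ 0 := by
    by_contra! hall
    apply hα
    ext i l j
    have h := congrArg (fun P => coeff P (q * l + j)) (hall i)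
    simp only [hA, coeff_stepanov_inner, coeff_zero] at h
    rw [Finset.sum_eq_single l, Finset.sum_eq_single j] at h
    · simpa using h
    · intro j' _ hj'
      rw [if_neg]
      intro h'
      exact hj' (Fin.ext (by omega))
    · simp
    · intro l' _ hl'
      refine Finset.sum_eq_zero fun j' _ => if_neg fun h' => hl' (Fin.ext ?_)
      have h1 : (q * (l : ℕ) + j) / q = l := by
        rw [Nat.mul_add_div (by omega), Nat.div_eq_of_lt (by omega), add_zero]
      have h2 : (q * (l' : ℕ) + j') / q = l' := by
        rw [Nat.mul_add_div (by omega), Nat.div_eq_of_lt (by omega), add_zero]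
      rw [← h1, h', h2]
    · simp
  refine sum_ne_zero_of_natTrailingDegree (fun i => A i * U ^ (i : ℕ)) ?_ ?_
  · obtain ⟨i, hi⟩ := hex
    exact ⟨i, mul_ne_zero hi (pow_ne_zero _ hU)⟩
  · intro i i' hii' h1 h2 heq
    have hAi : A i ≠ 0 := left_ne_zero_of_mul h1
    have hAi' : A i' ≠ 0 := left_ne_zero_of_mul h2
    have hpow : ∀ n : ℕ, (U ^ n).natTrailingDegree = n * e := by
      intro n
      induction n with
      | zero => simp
      | succ n ih =>
        rw [pow_succ, natTrailingDegree_mul (pow_ne_zero _ hU) hU, ih, hUe]; ring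
    rw [natTrailingDegree_mul hAi (pow_ne_zero _ hU),
      natTrailingDegree_mul hAi' (pow_ne_zero _ hU), hpow, hpow] at heq
    obtain ⟨w, u, hu, hw⟩ := htr i hAi
    obtain ⟨w', u', hu', hw'⟩ := htr i' hAi'
    rw [hw, hw'] at heq
    have hi := i.2
    have hi' := i'.2
    have hne : (i : ℤ) ≠ (i' : ℤ) := by
      intro h; exact hii' (Fin.ext (by exact_mod_cast h))
    have hz : (d : ℤ) * (u - u') - ((i : ℤ) - i') =
        q * (-(ρ * ((i : ℤ) - i')) - d * ((w : ℤ) - w')) := by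
      have he' : (d : ℤ) * e + 1 = q * ρ := by exact_mod_cast he
      have heq' : (q : ℤ) * w + u + i * e = q * w' + u' + i' * e := by exact_mod_cast heq
      linear_combination (d : ℤ) * heq' - ((i : ℤ) - i') * he'
    have hlt : |(d : ℤ) * (u - u') - ((i : ℤ) - i')| < q := by
      have ha' : (d : ℤ) * a ≤ q := by exact_mod_cast ha
      have : (d : ℤ) * u + d ≤ d * a := by
        have : d * (u + 1) ≤ d * a := Nat.mul_le_mul_left _ hu
        exact_mod_cast this
      have : (d : ℤ) * u' + d ≤ d * a := by
        have : d * (u' + 1) ≤ d * a := Nat.mul_le_mul_left _ hu'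
        exact_mod_cast this
      have : (0 : ℤ) ≤ d * u := by positivity
      have : (0 : ℤ) ≤ d * u' := by positivity
      rw [abs_lt, mul_sub]
      constructor <;> omega
    have hzero := Int.eq_zero_of_abs_lt_dvd (Dvd.intro _ hz.symm) hlt
    have hdvd : (d : ℤ) ∣ (i : ℤ) - i' := ⟨u - u', by linarith⟩
    have := Int.eq_zero_of_abs_lt_dvd hdvd (by rw [abs_lt]; constructor <;> omega)
    exact hne (by linarith)

theorem card_mul_le_natDegree_of_iterate_derivative {P : F[X]} (hP : P ≠ 0) {m : ℕ}
    (hm : ((m - 1).factorial : F) ≠ 0) (S : Finset F)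
    (h : ∀ y ∈ S, ∀ r < m, (derivative^[r] P).eval y = 0) : #S * m ≤ P.natDegree := by
  classical
  rcases Nat.eq_zero_or_pos m with rfl | hm0
  · simp
  calc #S * m = ∑ y ∈ S, m := by simp
    _ ≤ ∑ y ∈ S, P.roots.count y := by
      refine Finset.sum_le_sum fun y hy => ?_
      rw [count_roots]
      have := lt_rootMultiplicity_of_isRoot_iterate_derivative_of_mem_nonZeroDivisors
        (p := P) (t := y) (n := m - 1) hP (fun r hr => h y hy r (by omega))
        (mem_nonZeroDivisors_of_ne_zero hm)
      omega
    _ ≤ P.roots.card := by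
      rw [← Multiset.sum_count_eq_card (s := S ∪ P.roots.toFinset)
        (fun y hy => Finset.mem_union_right _ (Multiset.mem_toFinset.2 hy))]
      exact Finset.sum_le_sum_of_subset Finset.subset_union_left
    _ ≤ P.natDegree := card_roots' P

end Stepanov

section StepanovCount

variable {F : Type*} [Field F]

theorem exists_log_derivative {ι : Type*} (s : Finset ι) (c : ι → F) (e : ι → ℕ) :
    ∃ W : F[X], W.natDegree ≤ #s ∧ (∏ i ∈ s, (X + C (c i))) *
      derivative (∏ i ∈ s, (X + C (c i)) ^ e i) = W * ∏ i ∈ s, (X + C (c i)) ^ e i := by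
  classical
  induction s using Finset.induction_on with
  | empty => exact ⟨0, by simp⟩
  | insert j s hj ih =>
    obtain ⟨W, hW, h⟩ := ih
    refine ⟨(e j : F[X]) * (∏ i ∈ s, (X + C (c i))) + (X + C (c j)) * W, ?_, ?_⟩
    · rw [Finset.card_insert_of_notMem hj]
      refine (natDegree_add_le _ _).trans (max_le ?_ ?_)
      · refine natDegree_mul_le.trans ?_
        rw [natDegree_natCast, natDegree_prod_of_monic _ _ fun i _ => monic_X_add_C _]
        simp
      · refine natDegree_mul_le.trans ?_
        rw [natDegree_X_add_C]; omega
    · rw [Finset.prod_insert hj, Finset.prod_insert hj, derivative_mul]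
      have h1 : (X + C (c j)) * derivative ((X + C (c j)) ^ e j) =
          (e j : F[X]) * (X + C (c j)) ^ e j := by
        rcases Nat.eq_zero_or_pos (e j) with h0 | h0
        · simp [h0]
        · obtain ⟨n, hn⟩ := Nat.exists_eq_succ_of_ne_zero h0.ne'
          rw [hn, derivative_pow]; simp; ring
      linear_combination (∏ i ∈ s, (X + C (c i))) * (∏ i ∈ s, (X + C (c i)) ^ e i) * h1 +
        (X + C (c j)) ^ (e j + 1) * h

/-- The base `q` digits of `(q ^ k - 1) / d`. -/
def digitExp (q k d i : ℕ) : ℕ := q * (q ^ (k - 1 - i) % d) / d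

theorem mul_digitExp (q k d i : ℕ) :
    d * digitExp q k d i + q ^ (k - 1 - i + 1) % d = q * (q ^ (k - 1 - i) % d) := by
  rw [pow_succ', ← Nat.mul_mod_mod, digitExp, Nat.div_add_mod]

theorem digitExp_le (q k i : ℕ) {d : ℕ} (hd : 0 < d) : digitExp q k d i ≤ q := by
  refine Nat.div_le_of_le_mul ?_
  rw [mul_comm]
  exact Nat.mul_le_mul_right _ (Nat.mod_lt _ hd).le

theorem mul_sum_digitExp (q d : ℕ) (hd : 2 ≤ d) (k : ℕ) :
    d * ∑ i ∈ range k, digitExp q k d i * q ^ i + q ^ k % d = q ^ k := by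
  have key : ∀ j ≤ k, d * ∑ i ∈ range j, digitExp q k d i * q ^ i + q ^ k % d =
      q ^ j * (q ^ (k - j) % d) := by
    intro j hj
    induction j with
    | zero => simp
    | succ j ih =>
      have h1 := ih (by omega)
      have h2 := mul_digitExp q k d j
      rw [show k - 1 - j + 1 = k - j by omega, show k - 1 - j = k - (j + 1) by omega] at h2
      rw [Finset.sum_range_succ, pow_succ]
      linear_combination h1 + q ^ j * h2
  have := key k le_rfl
  simpa [Nat.mod_eq_of_lt (show 1 < d by omega)] using this

theorem stepanov_card_le {p : ℕ} [Fact p.Prime] [CharP F p] {f d k N : ℕ} (hf : f ≠ 0)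
    (hd : 2 ≤ d) (hk0 : 0 < k) (hkd : k ≤ d) (hN : d * N + 1 = (p ^ f) ^ k) (ζ : F)
    (hζ : ∀ i, 0 < i → i < k → ζ ^ (p ^ f) ^ i ≠ ζ)
    {b : ℕ} (hb : b = 2 * d ^ 3 + 2 * d + 3) (hp : d * b < p)
    (hq : 2 * d * (d * b * (b + d * b * d) + 2) ≤ p ^ f) {η : F} (hη : η ≠ 0) (S : Finset F)
    (hS : ∀ y ∈ S, (y - ζ) ^ p ^ f = y - ζ ∧ y ^ N = η) :
    2 * d ^ 2 * #S ≤ (2 * d + 1) * p ^ f := by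
  set q := p ^ f with hqdef
  have hq0 : (q : F) = 0 := by
    rw [hqdef, Nat.cast_pow, CharP.cast_eq_zero, zero_pow hf]
  have hqpos : 0 < q := pow_pos (Fact.out : p.Prime).pos _
  set c : ℕ → F := fun i => ζ ^ q ^ i - ζ with hc
  set e : ℕ → ℕ := digitExp q k d with he
  have hc0 : c 0 = 0 := by simp [hc]
  obtain ⟨W, hWdeg, hW⟩ := exists_log_derivative (range k) c e
  set M : F[X] := ∏ i ∈ range k, (X + C (c i)) with hM
  set U : F[X] := ∏ i ∈ range k, (X + C (c i)) ^ e i with hU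
  rw [card_range] at hWdeg
  have hMdeg : M.natDegree ≤ k := by
    rw [hM, natDegree_prod_of_monic _ _ fun i _ => monic_X_add_C _]; simp
  have hqk : q ^ k % d = 1 := by
    rw [← hN, Nat.mul_add_mod, Nat.mod_eq_of_lt (by omega)]
  have hNe : ∑ i ∈ range k, e i * q ^ i = N := by
    have h1 := mul_sum_digitExp q d hd k
    rw [hqk, ← hN] at h1
    exact Nat.eq_of_mul_eq_mul_left (by omega) (Nat.add_right_cancel h1)
  have hUm : U.Monic := monic_prod_of_monic _ _ fun i _ => (monic_X_add_C _).pow _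
  have hUdeg : U.natDegree ≤ k * q := by
    rw [hU, natDegree_prod_of_monic _ _ fun i _ => (monic_X_add_C _).pow _]
    calc _ ≤ ∑ i ∈ range k, q := by
          refine Finset.sum_le_sum fun i _ => ?_
          rw [natDegree_pow, natDegree_X_add_C, mul_one]
          exact digitExp_le q k i (by omega)
      _ = k * q := by simp
  have hUtr : U.natTrailingDegree = e 0 := by
    obtain ⟨k', rfl⟩ := Nat.exists_eq_succ_of_ne_zero hk0.ne'
    rw [hU, Finset.prod_range_succ', hc0, C_0, add_zero]
    have hm : (∏ i ∈ range k', (X + C (c (i + 1))) ^ e (i + 1)).Monic :=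
      monic_prod_of_monic _ _ fun i _ => (monic_X_add_C _).pow _
    rw [natTrailingDegree_mul_X_pow hm.ne_zero, natTrailingDegree_eq_zero.2, zero_add]
    right
    rw [coeff_zero_eq_eval_zero, eval_prod, Finset.prod_ne_zero_iff]
    intro i hi
    rw [mem_range] at hi
    simp only [eval_pow, eval_add, eval_X, eval_C, zero_add, hc]
    exact pow_ne_zero _ (sub_ne_zero.2 (hζ _ (by omega) (by omega)))
  have he0 : d * e 0 + 1 = q * (q ^ (k - 1) % d) := by
    have := mul_digitExp q k d 0
    rwa [show k - 1 - 0 + 1 = k by omega, hqk, Nat.sub_zero] at this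
  have hpt : ∀ y ∈ S, ∀ i, y ^ q ^ i = y + c i := by
    intro y hy i
    have h1 : (y - ζ) ^ q ^ i = y - ζ := by
      induction i with
      | zero => simp
      | succ i ih => rw [pow_succ, pow_mul, ih, (hS y hy).1]
    have h2 : (y - ζ) ^ q ^ i = y ^ q ^ i - ζ ^ q ^ i := by
      rw [hqdef, ← pow_mul]; exact sub_pow_char_pow y ζ _
    rw [hc]
    linear_combination h1 - h2
  have hy0 : ∀ y ∈ S, y ≠ 0 := by
    rintro y hy rfl
    have h := (hS 0 hy).2
    have hN0 : N ≠ 0 := by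
      rintro rfl
      have : q ≤ q ^ k := Nat.le_self_pow hk0.ne' q
      have : 2 * d * 2 ≤ q := le_trans (Nat.mul_le_mul_left _ (by omega)) hq
      omega
    rw [zero_pow hN0] at h
    exact hη h.symm
  set a := q / (2 * d) with ha
  set m := d * b - 1 with hm
  have hdb : 0 < d * b := by subst hb; positivity
  have ha1 : 2 * d * a ≤ q := Nat.mul_div_le _ _
  have ha2 : d * b * (b + d * b * d) + 2 ≤ a := (Nat.le_div_iff_mul_le (by omega)).2
    (by rw [mul_comm]; exact hq)
  have hdim : m * (a + b + m * k) < d * (b * a) := by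
    have h1 : m * (a + b + m * k) ≤ m * a + d * b * (b + d * b * d) := by
      rw [add_assoc, mul_add]
      refine Nat.add_le_add_left (Nat.mul_le_mul (by omega) (Nat.add_le_add_left ?_ _)) _
      exact Nat.mul_le_mul (by omega) hkd
    have h2 : d * (b * a) = m * a + a := by
      rw [← mul_assoc, ← Nat.succ_mul]; congr 1; omega
    omega
  obtain ⟨α, hα0, hα⟩ := exists_stepanov hMdeg hWdeg hW hq0 η (c 1) hdim
  have hΦ0 : stepanovPhi U q α ≠ 0 := by
    refine stepanovPhi_ne_zero hUm.ne_zero hUtr he0 ?_ ?_ hα0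
    · calc d * a ≤ 2 * d * a := Nat.mul_le_mul_right _ (by omega)
        _ ≤ q := ha1
    · calc a ≤ 2 * d * a := Nat.le_mul_of_pos_left _ (by omega)
        _ ≤ q := ha1
  have hfac : ((m - 1).factorial : F) ≠ 0 := by
    rw [Ne, CharP.cast_eq_zero_iff F p, (Fact.out : p.Prime).dvd_factorial]
    omega
  have hcard := card_mul_le_natDegree_of_iterate_derivative hΦ0 hfac S (by
    intro y hy r hr
    refine hα y ?_ ?_ ?_ r hr
    · rw [hU, eval_prod, ← (hS y hy).2, ← hNe, ← Finset.prod_pow_eq_pow_sum]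
      refine Finset.prod_congr rfl fun i _ => ?_
      rw [eval_pow, eval_add, eval_X, eval_C, ← hpt y hy, ← pow_mul, mul_comm]
    · simpa using hpt y hy 1
    · rw [hM, eval_prod, Finset.prod_ne_zero_iff]
      intro i _
      rw [eval_add, eval_X, eval_C, ← hpt y hy]
      exact pow_ne_zero _ (hy0 y hy))
  have hΦdeg : (stepanovPhi U q α).natDegree ≤ q + q * b + d * (d * q) := by
    refine natDegree_sum_le_of_forall_le _ _ fun i _ => natDegree_mul_le.trans ?_
    refine Nat.add_le_add ?_ ?_
    · refine natDegree_sum_le_of_forall_le _ _ fun l _ => natDegree_mul_le.trans ?_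
      have h1 := natDegree_sum_C_mul_X_pow_le (α i l)
      have h2 : q * (l : ℕ) ≤ q * b := Nat.mul_le_mul_left _ l.2.le
      rw [natDegree_X_pow]
      have h3 : a ≤ q := Nat.div_le_self _ _
      omega
    · rw [natDegree_pow]
      exact Nat.mul_le_mul i.2.le (hUdeg.trans (Nat.mul_le_mul_right _ hkd))
  have hfin : #S * (d * b - 1) ≤ q * (1 + b + d ^ 2) := by
    refine (hcard.trans hΦdeg).trans (le_of_eq ?_); ring
  have harith : 2 * d ^ 2 * (1 + b + d ^ 2) ≤ (2 * d + 1) * (d * b - 1) := by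
    obtain ⟨m', hm'⟩ : ∃ m', d * b = m' + 1 := ⟨d * b - 1, by omega⟩
    rw [hm', Nat.add_sub_cancel]
    have h1 : (d : ℤ) * b = m' + 1 := by exact_mod_cast hm'
    have h2 : (b : ℤ) = 2 * d ^ 3 + 2 * d + 3 := by exact_mod_cast hb
    have h3 : (m' : ℤ) = d * (2 * d ^ 3 + 2 * d + 3) - 1 := by rw [← h2]; linarith
    have : (2 : ℤ) ≤ d := by exact_mod_cast hd
    zify
    rw [h2, h3]
    nlinarith
  have hpos : 0 < d * b - 1 := by
    have : 2 * 3 ≤ d * b := Nat.mul_le_mul hd (by omega)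
    omega
  refine Nat.le_of_mul_le_mul_right ?_ hpos
  calc 2 * d ^ 2 * #S * (d * b - 1) = 2 * d ^ 2 * (#S * (d * b - 1)) := by ring
    _ ≤ 2 * d ^ 2 * (q * (1 + b + d ^ 2)) := Nat.mul_le_mul_left _ hfin
    _ = q * (2 * d ^ 2 * (1 + b + d ^ 2)) := by ring
    _ ≤ q * ((2 * d + 1) * (d * b - 1)) := Nat.mul_le_mul_left _ harith
    _ = (2 * d + 1) * q * (d * b - 1) := by ring

end StepanovCount

section GoodResidue

/-- A lower bound for the residue characteristics considered below. -/
def residueBound (d R : ℕ) : ℕ :=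
  let b := 2 * d ^ 3 + 2 * d + 3
  2 * d * (d * b * (b + d * b * d) + 2) + 2 * d ^ 2 * (2 + R + R ^ 2 * d ^ 2) + d + R + d * b

theorem card_frobenius_fixed {F : Type*} [Field F] [IsAlgClosed F] {p : ℕ} [Fact p.Prime]
    [CharP F p] {f : ℕ} (hf : f ≠ 0) :
    ∃ T : Finset F, #T = p ^ f ∧ ∀ t, t ∈ T ↔ t ^ p ^ f = t := by
  classical
  have hp1 : 1 < p ^ f := Nat.one_lt_pow hf (Fact.out : p.Prime).one_lt
  have hsep := galois_poly_separable (K := F) p (p ^ f) (dvd_pow_self p hf)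
  have h0 : (X ^ p ^ f - X : F[X]) ≠ 0 := FiniteField.X_pow_card_sub_X_ne_zero F hp1
  refine ⟨(X ^ p ^ f - X : F[X]).roots.toFinset, ?_, fun t => ?_⟩
  · rw [Multiset.toFinset_card_of_nodup (nodup_roots hsep),
      ← (IsAlgClosed.splits (X ^ p ^ f - X : F[X])).natDegree_eq_card_roots,
      FiniteField.X_pow_card_sub_X_natDegree_eq F hp1]
  · rw [Multiset.mem_toFinset, mem_roots h0, IsRoot.def, eval_sub, eval_pow, eval_X, sub_eq_zero]

theorem exists_many_primitive {F : Type*} [Field F] [IsAlgClosed F] {p : ℕ} [Fact p.Prime]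
    [CharP F p] {f d k N R : ℕ} (hf : f ≠ 0)
    (hd : 2 ≤ d) (hp : residueBound d R < p) (hk0 : 0 < k) (hkd : k ≤ d)
    (hN : d * N + 1 = (p ^ f) ^ k) {ζ : F} (hζp : IsPrimitiveRoot ζ d)
    (hζ : ∀ i, 0 < i → i < k → ζ ^ (p ^ f) ^ i ≠ ζ) :
    ∃ S : Finset F, R + R ^ 2 * d ^ 2 < #S ∧
      ∀ t ∈ S, t ^ p ^ f = t ∧ t + ζ ≠ 0 ∧ IsPrimitiveRoot ((t + ζ) ^ N) d := by
  classical
  set q := p ^ f with hq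
  have hpq : p ≤ q := Nat.le_self_pow hf p
  obtain ⟨T, hTcard, hT⟩ := card_frobenius_fixed (F := F) (p := p) hf
  have hζk : ζ ^ q ^ k = ζ := by
    rw [← hN, pow_succ, pow_mul, hζp.pow_eq_one, one_pow, one_mul]
  have htk : ∀ t : F, t ^ q = t → ∀ i : ℕ, t ^ q ^ i = t := by
    intro t ht i
    induction i with
    | zero => simp
    | succ i ih => rw [pow_succ, pow_mul, ih, ht]
  set S := T.filter fun t => t + ζ ≠ 0 ∧ IsPrimitiveRoot ((t + ζ) ^ N) d with hS
  refine ⟨S, ?_, fun t ht => ?_⟩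
  swap
  · rw [hS, mem_filter, hT] at ht
    exact ht
  set H := (nthRootsFinset d (1 : F)).erase ζ with hH
  have hHcard : #H = d - 1 := by
    rw [hH, card_erase_of_mem, hζp.card_nthRootsFinset]
    exact (mem_nthRootsFinset (by omega) _).2 hζp.pow_eq_one
  set S' : F → Finset F := fun η => (T.filter fun t => (t + ζ) ^ N = η) with hS'
  set H' := (nthRootsFinset d (1 : F)).filter fun η => ¬ IsPrimitiveRoot η d with hH'
  have hH'card : #H' ≤ d - 1 := by
    rw [← hHcard]
    refine card_le_card fun η hη => ?_
    rw [hH', mem_filter] at hη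
    rw [hH, mem_erase]
    exact ⟨fun h => hη.2 (h ▸ hζp), hη.1⟩
  have hcover : T ⊆ {-ζ} ∪ (H'.biUnion S' ∪ S) := by
    intro t ht
    rw [mem_union, mem_union, mem_singleton, mem_biUnion]
    by_cases h0 : t + ζ = 0
    · left; exact eq_neg_of_add_eq_zero_left h0
    right
    by_cases hprim : IsPrimitiveRoot ((t + ζ) ^ N) d
    · right
      rw [hS, mem_filter]; exact ⟨ht, h0, hprim⟩
    left
    refine ⟨(t + ζ) ^ N, ?_, ?_⟩
    · rw [hH', mem_filter, mem_nthRootsFinset (by omega)]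
      refine ⟨?_, hprim⟩
      have h1 : (t + ζ) ^ q ^ k = t + ζ := by
        have : (t + ζ) ^ q ^ k = t ^ q ^ k + ζ ^ q ^ k := by
          rw [hq, ← pow_mul]; exact add_pow_char_pow t ζ p _
        rw [this, hζk, htk t ((hT t).1 ht)]
      rw [← hN, pow_succ] at h1
      rw [← pow_mul, mul_comm]
      exact mul_right_cancel₀ h0 (by rw [h1, one_mul])
    · rw [hS', mem_filter]; exact ⟨ht, rfl⟩
  have hS'card : ∀ η ∈ H', 2 * d ^ 2 * #(S' η) ≤ (2 * d + 1) * q := by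
    intro η hη
    have hη0 : η ≠ 0 := by
      rintro rfl
      rw [hH', mem_filter, mem_nthRootsFinset (by omega), zero_pow (by omega)] at hη
      exact zero_ne_one hη.1
    have := stepanov_card_le hf hd hk0 hkd hN ζ hζ rfl
      (by simp only [residueBound] at hp; omega)
      (le_trans (by simp only [residueBound] at hp; omega) hpq) hη0
      ((S' η).map (addRightEmbedding ζ)) (by
        intro y hy
        rw [mem_map] at hy
        obtain ⟨t, ht, rfl⟩ := hy
        rw [hS', mem_filter, hT] at ht
        simp only [addRightEmbedding_apply, add_sub_cancel_right]
        exact ht)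
    rwa [card_map] at this
  have hcount : q ≤ 1 + (∑ η ∈ H', #(S' η) + #S) := by
    refine hTcard.symm.le.trans ?_
    refine (card_le_card hcover).trans ((card_union_le _ _).trans ?_)
    rw [card_singleton]
    exact Nat.add_le_add_left ((card_union_le _ _).trans
      (Nat.add_le_add_right card_biUnion_le _)) _
  have hsum : 2 * d ^ 2 * ∑ η ∈ H', #(S' η) ≤ (d - 1) * ((2 * d + 1) * q) := by
    rw [Finset.mul_sum]
    refine (Finset.sum_le_sum hS'card).trans ?_
    rw [sum_const, smul_eq_mul]
    exact Nat.mul_le_mul_right _ hH'card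
  have hqlarge : 2 * d ^ 2 * (2 + R + R ^ 2 * d ^ 2) < q :=
    lt_of_lt_of_le (by simp only [residueBound] at hp; omega) hpq
  have hmul : 2 * d ^ 2 * q ≤ 2 * d ^ 2 + ((d - 1) * ((2 * d + 1) * q) + 2 * d ^ 2 * #S) := by
    have := Nat.mul_le_mul_left (2 * d ^ 2) hcount
    rw [mul_add, mul_add] at this
    omega
  have hdq : (d - 1) * ((2 * d + 1) * q) + (d + 1) * q = 2 * d ^ 2 * q := by
    obtain ⟨d', rfl⟩ : ∃ d', d = d' + 1 := ⟨d - 1, by omega⟩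
    rw [Nat.add_sub_cancel]; ring
  by_contra! hcon
  have h1 : 2 * d ^ 2 * #S ≤ 2 * d ^ 2 * (R + R ^ 2 * d ^ 2) := Nat.mul_le_mul_left _ hcon
  have h2 : q ≤ (d + 1) * q := Nat.le_mul_of_pos_left _ (by omega)
  rw [show 2 + R + R ^ 2 * d ^ 2 = 2 + (R + R ^ 2 * d ^ 2) by ring, mul_add] at hqlarge
  omega

theorem exists_good_residue {F : Type*} [Field F] [IsAlgClosed F] {p : ℕ} [Fact p.Prime]
    [CharP F p] {f d R : ℕ} (hf : f ≠ 0) (hd : 2 ≤ d) (hp : residueBound d R < p) :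
    ∃ (t a : F) (k : ℕ), t ^ p ^ f = t ∧ k ∣ d.totient ∧ k ≠ 0 ∧ (p ^ f) ^ k ≡ 1 [MOD d] ∧
      a ^ (p ^ f) ^ (k * d) = a ∧ (∀ i, a ^ (p ^ f) ^ i = a → k * d ∣ i) ∧
      IsPrimitiveRoot (a ^ d - t) d ∧ a ≠ 0 ∧ (∀ i < R, a + i ≠ 0) ∧
      ∀ i < R, ∀ j < R, i ≠ j → ¬ IsPrimitiveRoot ((a + i - j) ^ d - t) d := by
  classical
  set q := p ^ f with hq
  have hpp : p.Prime := Fact.out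
  have hpR : R < p := by simp only [residueBound] at hp; omega
  have hdp : d < p := by simp only [residueBound] at hp; omega
  have hcop : Nat.Coprime q d :=
    Nat.Coprime.pow_left _ ((Nat.Prime.coprime_iff_not_dvd hpp).2
      fun h => absurd (Nat.le_of_dvd (by omega) h) (by omega))
  have hdF : ((d : ℕ) : F) ≠ 0 := by
    rw [Ne, CharP.cast_eq_zero_iff F p]
    exact fun h => absurd (Nat.le_of_dvd (by omega) h) (by omega)
  have : NeZero ((d : ℕ) : F) := ⟨hdF⟩
  obtain ⟨ζ, hζ⟩ := IsAlgClosed.exists_root (cyclotomic d F)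
    (by rw [degree_cyclotomic]; exact_mod_cast (Nat.totient_pos.2 (by omega)).ne')
  have hζp : IsPrimitiveRoot ζ d := isRoot_cyclotomic_iff.1 hζ
  set u : (ZMod d)ˣ := ZMod.unitOfCoprime q hcop with hu
  have : NeZero d := ⟨by omega⟩
  set k := orderOf u with hk
  have hk0 : 0 < k := orderOf_pos u
  have hkt : k ∣ d.totient := by
    rw [← ZMod.card_units_eq_totient]; exact orderOf_dvd_card
  have hkd : k ≤ d := (Nat.le_of_dvd (Nat.totient_pos.2 (by omega)) hkt).trans
    (Nat.totient_le d)
  have hup : ∀ i, u ^ i = 1 ↔ q ^ i ≡ 1 [MOD d] := by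
    intro i
    rw [← ZMod.natCast_eq_natCast_iff, ← Units.val_inj]
    simp [hu, ZMod.coe_unitOfCoprime]
  have hζq : ∀ i, ζ ^ q ^ i = ζ ↔ k ∣ i := by
    intro i
    have h1 : 1 ≤ q ^ i := Nat.one_le_pow _ _ (pow_pos hpp.pos _)
    rw [hk, orderOf_dvd_iff_pow_eq_one, hup, Nat.ModEq.comm, Nat.modEq_iff_dvd' h1,
      ← hζp.pow_eq_one_iff_dvd]
    obtain ⟨n, hn⟩ : ∃ n, q ^ i = n + 1 := ⟨q ^ i - 1, by omega⟩
    rw [hn, Nat.add_sub_cancel, pow_succ, mul_eq_right₀ (hζp.ne_zero (by omega))]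
  have hqk : q ^ k ≡ 1 [MOD d] := (hup k).1 (pow_orderOf_eq_one u)
  have hqpos : 0 < q := pow_pos hpp.pos _
  obtain ⟨N, hN⟩ := (Nat.modEq_iff_dvd' (Nat.one_le_pow _ _ hqpos)).1 hqk.symm
  have hN : d * N + 1 = q ^ k := by
    have := Nat.one_le_pow k _ hqpos; omega
  obtain ⟨S, hScard, hS⟩ := exists_many_primitive (R := R) hf hd hp hk0 hkd hN hζp
    fun i h0 hi h => absurd (Nat.le_of_dvd h0 ((hζq i).1 h)) (by omega)
  choose a ha using fun y : F => IsAlgClosed.exists_pow_nat_eq y (show 0 < d by omega)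
  set bad : F[X] := (∏ i ∈ range R, (X + C (i : F))) *
    ∏ x ∈ (range R ×ˢ range R).filter (fun x => x.1 ≠ x.2),
      (cyclotomic d F).comp ((X + C ((x.1 : F) - x.2)) ^ d - X ^ d + C ζ) with hbad
  have hne : ∀ i < R, ∀ j < R, i ≠ j → (i : F) - j ≠ 0 := by
    intro i hi j hj hij h
    exact hij (CharP.natCast_injOn_Iio F p (by simpa using hi.trans hpR)
      (by simpa using hj.trans hpR) (sub_eq_zero.1 h))
  have hbad0 : bad ≠ 0 := by
    refine mul_ne_zero (monic_prod_of_monic _ _ fun i _ => monic_X_add_C _).ne_zero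
      (Finset.prod_ne_zero_iff.2 fun x hx h => ?_)
    rw [mem_filter, mem_product, mem_range, mem_range] at hx
    rcases comp_eq_zero_iff.1 h with h | ⟨-, h⟩
    · exact cyclotomic_ne_zero d F h
    · have h1 := congrArg (fun P => coeff P (d - 1)) h
      simp only [coeff_add, coeff_sub, coeff_X_add_C_pow, coeff_X_pow, coeff_C] at h1
      rw [if_neg (by omega), if_neg (by omega), if_neg (by omega),
        show d - (d - 1) = 1 by omega, show d - 1 = d - 1 from rfl,
        Nat.choose_symm_of_eq_add (show d = (d - 1) + 1 by omega), Nat.choose_one_right] at h1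
      simp only [pow_one, sub_zero, add_zero] at h1
      exact mul_ne_zero (hne _ hx.1.1 _ hx.1.2 hx.2) hdF h1
  have hbaddeg : bad.natDegree ≤ R + R ^ 2 * d ^ 2 := by
    refine natDegree_mul_le.trans (Nat.add_le_add ?_ ?_)
    · rw [natDegree_prod_of_monic _ _ fun i _ => monic_X_add_C _]
      simp only [natDegree_X_add_C, sum_const, card_range, smul_eq_mul, mul_one, le_refl]
    · refine (natDegree_prod_le _ _).trans ?_
      calc _ ≤ ∑ x ∈ (range R ×ˢ range R).filter (fun x => x.1 ≠ x.2), d ^ 2 := by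
            refine Finset.sum_le_sum fun x _ => ?_
            rw [natDegree_comp, natDegree_cyclotomic, pow_two]
            refine Nat.mul_le_mul (Nat.totient_le d) ?_
            refine (natDegree_add_le _ _).trans (max_le ((natDegree_sub_le _ _).trans
              (max_le ?_ ?_)) (by simp))
            · rw [natDegree_pow, natDegree_X_add_C, mul_one]
            · rw [natDegree_X_pow]
        _ ≤ R ^ 2 * d ^ 2 := by
            rw [sum_const, smul_eq_mul]
            refine Nat.mul_le_mul_right _ ((card_filter_le _ _).trans ?_)
            rw [card_product, card_range, pow_two]
  obtain ⟨t, htS, htbad⟩ : ∃ t ∈ S, bad.eval (a (t + ζ)) ≠ 0 := by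
    by_contra! hall
    refine absurd hScard (not_lt.2 ?_)
    calc #S ≤ #bad.roots.toFinset := by
          refine card_le_card_of_injOn (fun t => a (t + ζ)) ?_ ?_
          · intro t ht
            simpa [hbad0] using hall t ht
          · intro t _ t' _ h
            have := congrArg (· ^ d) h
            simpa [ha] using this
      _ ≤ bad.natDegree := (Multiset.toFinset_card_le _).trans (card_roots' _)
      _ ≤ _ := hbaddeg
  obtain ⟨htq, hy0, hprim⟩ := hS t htS
  set α := a (t + ζ) with hα
  have hαd : α ^ d = t + ζ := ha _
  have hα0 : α ≠ 0 := by
    intro h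
    rw [h, zero_pow (by omega)] at hαd
    exact hy0 hαd.symm
  have hαd' : α ^ d - t = ζ := by rw [hαd]; ring
  set η := (t + ζ) ^ N with hη
  have hαk : α ^ q ^ k = η * α := by
    rw [← hN, pow_succ, pow_mul, hαd]
  have hηk : η ^ q ^ k = η := by
    rw [← hN, pow_succ, pow_mul, hprim.pow_eq_one, one_pow, one_mul]
  have hαkj : ∀ j, α ^ (q ^ k) ^ j = η ^ j * α := by
    intro j
    induction j with
    | zero => simp
    | succ j ih =>
      rw [pow_succ (q ^ k), pow_mul, ih, mul_pow, hαk, ← pow_mul, mul_comm j, pow_mul, hηk]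
      ring
  have htk : ∀ i : ℕ, t ^ q ^ i = t := by
    intro i
    induction i with
    | zero => simp
    | succ i ih => rw [pow_succ, pow_mul, ih, htq]
  refine ⟨t, α, k, htq, hkt, hk0.ne', hqk, ?_, ?_, hαd'.symm ▸ hζp, hα0, ?_, ?_⟩
  · rw [pow_mul, hαkj, hprim.pow_eq_one, one_mul]
  · intro i hi
    have h1 : ζ ^ q ^ i = ζ := by
      have h2 : (t + ζ) ^ q ^ i = t ^ q ^ i + ζ ^ q ^ i := by
        rw [hq, ← pow_mul]; exact add_pow_char_pow t ζ p _
      rw [htk, ← hαd, ← pow_mul, mul_comm d, pow_mul, hi, hαd] at h2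
      exact (add_left_cancel h2).symm
    obtain ⟨j, rfl⟩ := (hζq i).1 h1
    rw [pow_mul, hαkj] at hi
    have : η ^ j = 1 := mul_right_cancel₀ hα0 (by rw [hi, one_mul])
    exact Nat.mul_dvd_mul_left _ ((hprim.pow_eq_one_iff_dvd j).1 this)
  · intro i hi h
    apply htbad
    rw [hbad, eval_mul, eval_prod, Finset.prod_eq_zero (mem_range.2 hi), zero_mul]
    simpa using h
  · intro i hi j hj hij h
    apply htbad
    rw [hbad, eval_mul]
    refine mul_eq_zero_of_right _ ?_
    rw [eval_prod]
    refine Finset.prod_eq_zero (i := (i, j)) (by simp [hi, hj, hij]) ?_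
    have h2 := isRoot_cyclotomic_iff.2 h
    rw [IsRoot.def] at h2
    rw [eval_comp]
    simp only [eval_add, eval_sub, eval_pow, eval_X, eval_C]
    rw [hαd, ← h2]
    congr 1
    ring

end GoodResidue

section Residue

variable {C : Type*} [Field C] (v : Valuation C ℝ≥0)

/-- The residue field of a valuation. -/
abbrev resField : Type _ := IsLocalRing.ResidueField v.valuationSubring

open Classical in
/-- The residue class of an element, with the convention that it is `0` on nonintegral elements. -/
noncomputable def res (x : C) : resField v :=
  if h : v x ≤ 1 then IsLocalRing.residue v.valuationSubring ⟨x, h⟩ else 0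

variable {v}

theorem res_of_le {x : C} (h : v x ≤ 1) :
    res v x = IsLocalRing.residue v.valuationSubring ⟨x, h⟩ := dif_pos h

theorem res_add {x y : C} (hx : v x ≤ 1) (hy : v y ≤ 1) : res v (x + y) = res v x + res v y := by
  rw [res_of_le hx, res_of_le hy, res_of_le (v.map_add_le hx hy), ← map_add]
  rfl

theorem res_sub {x y : C} (hx : v x ≤ 1) (hy : v y ≤ 1) : res v (x - y) = res v x - res v y := by
  rw [res_of_le hx, res_of_le hy, res_of_le (v.map_sub_le hx hy), ← map_sub]
  rfl

theorem map_mul_le_one {x y : C} (hx : v x ≤ 1) (hy : v y ≤ 1) : v (x * y) ≤ 1 := by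
  rw [map_mul]; exact mul_le_one' hx hy

theorem res_mul {x y : C} (hx : v x ≤ 1) (hy : v y ≤ 1) : res v (x * y) = res v x * res v y := by
  rw [res_of_le hx, res_of_le hy, res_of_le (map_mul_le_one hx hy), ← map_mul]
  rfl

theorem res_one : res v 1 = 1 := by
  rw [res_of_le (v.map_one.le)]
  exact map_one _

theorem res_zero : res v 0 = 0 := by
  rw [res_of_le (by simp)]
  exact map_zero _

theorem map_pow_le_one {x : C} (hx : v x ≤ 1) (n : ℕ) : v (x ^ n) ≤ 1 := by
  rw [map_pow]; exact pow_le_one' hx n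

theorem res_pow {x : C} (hx : v x ≤ 1) (n : ℕ) : res v (x ^ n) = res v x ^ n := by
  induction n with
  | zero => simp [res_one]
  | succ n ih => rw [pow_succ, pow_succ, res_mul (map_pow_le_one hx n) hx, ih]

theorem map_natCast_le_one (n : ℕ) : v (n : C) ≤ 1 := by
  induction n with
  | zero => simp
  | succ n ih =>
    rw [Nat.cast_succ]
    exact v.map_add_le ih v.map_one.le

theorem res_natCast (n : ℕ) : res v (n : C) = n := by
  induction n with
  | zero => simp [res_zero]
  | succ n ih =>
    rw [Nat.cast_succ, res_add (map_natCast_le_one n) v.map_one.le, ih, res_one, Nat.cast_succ]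

theorem map_sum_le_one {ι : Type*} (s : Finset ι) (f : ι → C) (h : ∀ i ∈ s, v (f i) ≤ 1) :
    v (∑ i ∈ s, f i) ≤ 1 := v.map_sum_le h

theorem res_sum {ι : Type*} (s : Finset ι) (f : ι → C) (h : ∀ i ∈ s, v (f i) ≤ 1) :
    res v (∑ i ∈ s, f i) = ∑ i ∈ s, res v (f i) := by
  classical
  induction s using Finset.induction_on with
  | empty => simp [res_zero]
  | insert i s hi ih =>
    rw [Finset.sum_insert hi, Finset.sum_insert hi, res_add (h i (mem_insert_self i s))
      (map_sum_le_one s f fun j hj => h j (mem_insert_of_mem hj)),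
      ih fun j hj => h j (mem_insert_of_mem hj)]

theorem res_eq_zero {x : C} (hx : v x ≤ 1) : res v x = 0 ↔ v x < 1 := by
  rw [res_of_le hx, IsLocalRing.residue_eq_zero_iff]
  exact (ValuationSubring.valuation_lt_one_iff _ _).trans
    (Valuation.isEquiv_valuation_valuationSubring v).symm.lt_one_iff_lt_one

theorem res_ne_zero {x : C} (hx : v x ≤ 1) : res v x ≠ 0 ↔ v x = 1 := by
  rw [Ne, res_eq_zero hx, not_lt]
  exact ⟨fun h => le_antisymm hx h, fun h => h.ge⟩

theorem res_eq_iff {x y : C} (hx : v x ≤ 1) (hy : v y ≤ 1) :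
    res v x = res v y ↔ v (x - y) < 1 := by
  rw [← sub_eq_zero, ← res_sub hx hy, res_eq_zero (v.map_sub_le hx hy)]

theorem exists_res_eq (c : resField v) : ∃ x, v x ≤ 1 ∧ res v x = c := by
  obtain ⟨⟨x, hx⟩, rfl⟩ := IsLocalRing.residue_surjective c
  exact ⟨x, hx, res_of_le hx⟩

end Residue

section LocalValuation

/-- The valuation `v` on the extension `C` of `k` is invariant under automorphisms, its
restriction to `k` is discrete with uniformizer `s`, and the residue field of `k` has `p ^ f`
elements. -/
structure IsLocalValuation (k : Type*) {C : Type*} [Field k] [Field C] [Algebra k C]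
    (v : Valuation C ℝ≥0) (p f : ℕ) (s : k) : Prop where
  map_algEquiv : ∀ (σ : C ≃ₐ[k] C) (x : C), v (σ x) = v x
  uniformizer_lt : v (algebraMap k C s) < 1
  uniformizer_ne : s ≠ 0
  exists_zpow : ∀ x : k, x ≠ 0 → ∃ n : ℤ, v (algebraMap k C x) = v (algebraMap k C s) ^ n
  pow_card : ∀ x : k, v (algebraMap k C x) ≤ 1 →
    v (algebraMap k C x ^ p ^ f - algebraMap k C x) < 1
  exists_lift : ∀ x : C, v x ≤ 1 → v (x ^ p ^ f - x) < 1 →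
    ∃ t : k, v (x - algebraMap k C t) < 1
  map_natCast : ∀ n : ℕ, ¬ p ∣ n → v (n : C) = 1
  map_prime : v (p : C) < 1
  ne_zero : f ≠ 0

namespace IsLocalValuation

variable {k C : Type*} [Field k] [Field C] [Algebra k C] {v : Valuation C ℝ≥0} {p f : ℕ} {s : k}

theorem charP_res (h : IsLocalValuation k v p f s) : CharP (resField v) p := by
  refine ⟨fun n => ?_⟩
  rw [← res_natCast, res_eq_zero (map_natCast_le_one n)]
  constructor
  · intro hn
    by_contra hpn
    exact absurd (h.map_natCast n hpn) hn.ne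
  · rintro ⟨m, rfl⟩
    rw [Nat.cast_mul, map_mul]
    exact mul_lt_one_of_lt_of_le h.map_prime (map_natCast_le_one m)

theorem eq_of_pow_eq_one (h : IsLocalValuation k v p f s) {N : ℕ} (hN : ¬ p ∣ N) {x y : C}
    (hx : x ^ N = 1) (hy : y ^ N = 1) (hxy : v (x - y) < 1) : x = y := by
  have hN0 : N ≠ 0 := by rintro rfl; exact hN (dvd_zero p)
  have hval : ∀ z : C, z ^ N = 1 → v z = 1 := by
    intro z hz
    have := congrArg v hz
    rw [map_pow, map_one] at this
    exact (pow_eq_one_iff_of_nonneg zero_le hN0).1 this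
  have hy0 : y ≠ 0 := by rintro rfl; simp [hN0] at hy
  set u := x / y with hu
  have huN : u ^ N = 1 := by rw [hu, div_pow, hx, hy, div_one]
  have hu1 : v (u - 1) < 1 := by
    have : u - 1 = (x - y) / y := by rw [hu]; field_simp
    rw [this, map_div₀, hval y hy, div_one]; exact hxy
  have hures : res v u = 1 := by
    rw [← res_one, res_eq_iff (hval u huN).le v.map_one.le]; exact hu1
  by_contra hne
  have hu_ne : u - 1 ≠ 0 := by
    rw [sub_ne_zero]
    intro h1
    exact hne (by rw [hu, div_eq_one_iff_eq hy0] at h1; exact h1)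
  have hgeom : ∑ i ∈ range N, u ^ i = 0 := by
    have := geom_sum_mul u N
    rw [huN, sub_self] at this
    exact (mul_eq_zero.1 this).resolve_right hu_ne
  have hr := res_sum (v := v) (range N) (fun i => u ^ i)
    fun i _ => map_pow_le_one (hval u huN).le i
  rw [hgeom, res_zero] at hr
  simp only [res_pow (hval u huN).le, hures, one_pow, sum_const, card_range, nsmul_eq_mul,
    mul_one] at hr
  rw [← res_natCast] at hr
  exact (res_ne_zero (map_natCast_le_one N)).2 (h.map_natCast N hN) hr.symm

theorem map_sub_le_one (h : IsLocalValuation k v p f s) (σ : C ≃ₐ[k] C) {x : C} (hx : v x ≤ 1) :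
    v (σ x) ≤ 1 := (h.map_algEquiv σ x).trans_le hx

theorem res_pow_eq_iff (h : IsLocalValuation k v p f s) [Fact p.Prime] {x y : C} (hx : v x ≤ 1)
    (hy : v y ≤ 1) (i : ℕ) :
    res v x ^ (p ^ f) ^ i = res v y ^ (p ^ f) ^ i ↔ v (x - y) < 1 := by
  have := h.charP_res
  rw [← res_eq_iff hx hy, ← pow_mul]
  exact (iterateFrobenius_inj (resField v) p (f * i)).eq_iff

/-- The elements acting trivially on residues. -/
def inertia (h : IsLocalValuation k v p f s) : Subgroup (C ≃ₐ[k] C) where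
  carrier := {σ | ∀ x, v x ≤ 1 → v (σ x - x) < 1}
  one_mem' := by intro x _; simp
  mul_mem' := by
    intro σ τ hσ hτ x hx
    have : (σ * τ) x - x = σ (τ x - x) + (σ x - x) := by simp
    rw [this]
    exact v.map_add_lt (by rw [h.map_algEquiv]; exact hτ x hx) (hσ x hx)
  inv_mem' := by
    intro σ hσ x hx
    have : σ⁻¹ x - x = - σ⁻¹ (σ x - x) := by
      rw [map_sub, AlgEquiv.aut_inv, AlgEquiv.symm_apply_apply]; ring
    rw [this, Valuation.map_neg, h.map_algEquiv]
    exact hσ x hx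

theorem mem_inertia (h : IsLocalValuation k v p f s) {σ : C ≃ₐ[k] C} :
    σ ∈ h.inertia ↔ ∀ x, v x ≤ 1 → v (σ x - x) < 1 := Iff.rfl

variable [FiniteDimensional k C] [IsGalois k C]

theorem exists_algebraMap_eq {x : C} (hx : ∀ σ : C ≃ₐ[k] C, σ x = x) :
    ∃ y : k, algebraMap k C y = x := by
  have : x ∈ (⊥ : IntermediateField k C) := by
    rw [IsGalois.mem_bot_iff_fixed]; exact hx
  exact IntermediateField.mem_bot.1 this

theorem exists_uniformizer (h : IsLocalValuation k v p f s) :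
    ∃ ϖ : C, ϖ ≠ 0 ∧ v ϖ < 1 ∧ ∀ x : C, x ≠ 0 → ∃ j : ℤ, v x = v ϖ ^ j := by
  classical
  set r := v (algebraMap k C s) with hr
  have hr0 : r ≠ 0 := by
    rw [hr, Ne, v.zero_iff, map_eq_zero]; exact h.uniformizer_ne
  set n := Fintype.card (C ≃ₐ[k] C) with hn
  have hn0 : n ≠ 0 := Fintype.card_ne_zero
  have key : ∀ x : C, x ≠ 0 → ∃ m : ℤ, v x ^ n = r ^ m := by
    intro x hx
    obtain ⟨y, hy⟩ := exists_algebraMap_eq (k := k) (x := ∏ σ : C ≃ₐ[k] C, σ x) (by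
      intro τ
      rw [map_prod]
      exact Fintype.prod_equiv (Equiv.mulLeft τ) _ _ fun σ => rfl)
    have hy0 : y ≠ 0 := by
      rintro rfl
      rw [map_zero] at hy
      exact (Finset.prod_ne_zero_iff.2 fun σ _ => (_root_.map_ne_zero σ).2 hx) hy.symm
    obtain ⟨m, hm⟩ := h.exists_zpow y hy0
    refine ⟨m, ?_⟩
    rw [← hm, hy, map_prod, Finset.prod_congr rfl fun σ _ => h.map_algEquiv σ x]
    simp [hn]
  have hex : ∃ m : ℕ, 0 < m ∧ ∃ x : C, x ≠ 0 ∧ v x ^ n = r ^ m :=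
    ⟨n, Nat.pos_of_ne_zero hn0, algebraMap k C s,
      (_root_.map_ne_zero _).2 h.uniformizer_ne, rfl⟩
  obtain ⟨hm0, ϖ, hϖ0, hϖ⟩ := Nat.find_spec hex
  set m₀ := Nat.find hex with hm₀
  have hvϖ : v ϖ ≠ 0 := v.ne_zero_iff.2 hϖ0
  refine ⟨ϖ, hϖ0, ?_, fun x hx => ?_⟩
  · have : v ϖ ^ n < 1 := by
      rw [hϖ]; exact pow_lt_one₀ zero_le h.uniformizer_lt hm0.ne'
    exact (pow_lt_one_iff hn0).1 this
  · obtain ⟨m, hm⟩ := key x hx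
    refine ⟨m / m₀, ?_⟩
    have hy : v (x / ϖ ^ (m / m₀ : ℤ)) ^ n = r ^ (m % m₀ : ℤ) := by
      rw [map_div₀, map_zpow₀, div_pow, hm, ← zpow_natCast, ← zpow_mul, mul_comm, zpow_mul,
        zpow_natCast, hϖ, ← zpow_natCast, ← zpow_mul, ← zpow_sub₀ hr0]
      congr 1
      have := Int.emod_add_mul_ediv m m₀
      linarith
    have hmod : 0 ≤ m % (m₀ : ℤ) := Int.emod_nonneg _ (by exact_mod_cast hm0.ne')
    have hlt : m % (m₀ : ℤ) < m₀ := Int.emod_lt_of_pos _ (by exact_mod_cast hm0)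
    obtain ⟨e, he⟩ := Int.eq_ofNat_of_zero_le hmod
    rw [he, zpow_natCast] at hy
    have he0 : e = 0 := by
      by_contra hne
      refine Nat.find_min hex (m := e) (by omega) ⟨Nat.pos_of_ne_zero hne, _, ?_, hy⟩
      exact div_ne_zero hx (zpow_ne_zero _ hϖ0)
    rw [he0, pow_zero, pow_eq_one_iff_of_nonneg zero_le hn0, map_div₀, map_zpow₀,
      div_eq_one_iff_eq (zpow_ne_zero _ hvϖ)] at hy
    exact hy

theorem exists_algEquiv_pow (h : IsLocalValuation k v p f s) [Fact p.Prime] {x : C}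
    (hx : v x ≤ 1) : ∃ σ : C ≃ₐ[k] C, v (σ x - x ^ p ^ f) < 1 := by
  classical
  have := h.charP_res
  let y : (C ≃ₐ[k] C) → v.valuationSubring := fun σ => ⟨σ x, h.map_sub_le_one σ hx⟩
  let P : v.valuationSubring[X] := ∏ σ, (X - Polynomial.C (y σ))
  have hP : ∀ i, ∃ t : k, algebraMap k C t = (P.coeff i : C) := by
    intro i
    apply exists_algebraMap_eq
    intro τ
    have h1 : P.map (algebraMap v.valuationSubring C) = ∏ σ : C ≃ₐ[k] C, (X - Polynomial.C (σ x)) := by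
      rw [Polynomial.map_prod]
      refine Finset.prod_congr rfl fun σ _ => ?_
      rw [Polynomial.map_sub, map_X, map_C]; rfl
    have h2 : (P.map (algebraMap v.valuationSubring C)).map (τ : C →+* C) =
        P.map (algebraMap v.valuationSubring C) := by
      rw [h1, Polynomial.map_prod]
      refine Fintype.prod_equiv (Equiv.mulLeft τ) _ _ fun σ => ?_
      rw [Polynomial.map_sub, map_X, map_C]; rfl
    have h3 := congrArg (fun Q => coeff Q i) h2
    simp only [coeff_map] at h3
    exact h3
  let R := P.map (IsLocalRing.residue v.valuationSubring)
  have hR : R.map (iterateFrobenius (resField v) p f) = R := by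
    ext i
    rw [coeff_map, coeff_map, iterateFrobenius_def]
    obtain ⟨t, ht⟩ := hP i
    have hle : v (P.coeff i : C) ≤ 1 := (P.coeff i).2
    rw [← res_of_le hle, ← res_pow hle, res_eq_iff (map_pow_le_one hle _) hle, ← ht]
    exact h.pow_card t (ht.symm ▸ hle)
  have hRx : R.eval (res v x) = 0 := by
    rw [Polynomial.eval_map, Polynomial.eval₂_finsetProd]
    refine Finset.prod_eq_zero (mem_univ 1) ?_
    rw [eval₂_sub, eval₂_X, eval₂_C, sub_eq_zero, res_of_le hx]
    rfl
  have hRx' : R.eval (res v x ^ p ^ f) = 0 := by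
    rw [← iterateFrobenius_def, ← hR, eval_map, eval₂_at_apply, hRx, map_zero]
  rw [Polynomial.eval_map, Polynomial.eval₂_finsetProd, Finset.prod_eq_zero_iff] at hRx'
  obtain ⟨σ, -, hσ⟩ := hRx'
  refine ⟨σ, ?_⟩
  rw [eval₂_sub, eval₂_X, eval₂_C, sub_eq_zero, ← res_of_le, ← res_pow hx,
    res_eq_iff (map_pow_le_one hx _) (h.map_sub_le_one σ hx)] at hσ
  rw [Valuation.map_sub_swap]; exact hσ

end IsLocalValuation
end LocalValuation

namespace IsLocalValuation

variable {k C : Type*} [Field k] [Field C] [Algebra k C] {v : Valuation C ℝ≥0} {p f : ℕ} {s : k}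

theorem res_map_eq (h : IsLocalValuation k v p f s) (σ : C ≃ₐ[k] C) {x y : C} (hx : v x ≤ 1)
    (hy : v y ≤ 1) (hxy : res v x = res v y) : res v (σ x) = res v (σ y) := by
  rw [res_eq_iff hx hy] at hxy
  rw [res_eq_iff (h.map_sub_le_one σ hx) (h.map_sub_le_one σ hy), ← map_sub, h.map_algEquiv]
  exact hxy

theorem res_map_eq_pow (h : IsLocalValuation k v p f s) {α : C} (hα : v α ≤ 1)
    (hgen : ∀ x, v x ≤ 1 → res v x = 0 ∨ ∃ n : ℕ, res v x = res v (α ^ n)) (σ : C ≃ₐ[k] C)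
    {m : ℕ} (hm : m ≠ 0) (hσ : res v (σ α) = res v α ^ m) {x : C} (hx : v x ≤ 1) :
    res v (σ x) = res v x ^ m := by
  rcases hgen x hx with h0 | ⟨n, hn⟩
  · rw [h0, zero_pow hm, h.res_map_eq σ hx (y := 0) (by simp) (by rw [h0, res_zero]), map_zero,
      res_zero]
  · rw [h.res_map_eq σ hx (map_pow_le_one hα n) hn, map_pow, res_pow (h.map_sub_le_one σ hα), hσ,
      hn, res_pow hα, ← pow_mul, ← pow_mul, mul_comm]

variable [FiniteDimensional k C] [IsGalois k C]

theorem exists_res_pow_eq (h : IsLocalValuation k v p f s) [Fact p.Prime] :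
    ∃ M : ℕ, M ≠ 0 ∧ ∀ c : resField v, c ^ (p ^ f) ^ M = c := by
  classical
  have := h.charP_res
  set n := Fintype.card (C ≃ₐ[k] C) with hn
  refine ⟨n.factorial, n.factorial_ne_zero, fun c => ?_⟩
  obtain ⟨x, hx, rfl⟩ := exists_res_eq c
  have hσ : ∀ i : ℕ, ∃ σ : C ≃ₐ[k] C, res v (σ x) = res v x ^ (p ^ f) ^ i := by
    intro i
    induction i with
    | zero => exact ⟨1, by simp⟩
    | succ i ih =>
      obtain ⟨σ, hσ⟩ := ih
      have hσx := h.map_sub_le_one σ hx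
      obtain ⟨τ, hτ⟩ := h.exists_algEquiv_pow hσx
      rw [← res_eq_iff (h.map_sub_le_one τ hσx) (map_pow_le_one hσx _), res_pow hσx, hσ] at hτ
      exact ⟨τ * σ, by rw [AlgEquiv.mul_apply, hτ, ← pow_mul, ← pow_succ]⟩
  choose σ hσ using hσ
  obtain ⟨i, hi, j, hj, hij, heq⟩ := Finset.exists_ne_map_eq_of_card_lt_of_maps_to
    (s := range (n + 1)) (t := (univ : Finset (C ≃ₐ[k] C))) (f := σ)
    (by rw [card_range, card_univ]; omega) (fun _ _ => mem_coe.2 (mem_univ _))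
  wlog hlt : i < j generalizing i j
  · exact this j hj i hi hij.symm heq.symm (by omega)
  rw [mem_range] at hi hj
  have h1 : res v x ^ (p ^ f) ^ i = res v x ^ (p ^ f) ^ j := by rw [← hσ, ← hσ, heq]
  have h2 : res v x ^ (p ^ f) ^ (j - i) = res v x := by
    have h3 : (res v x ^ (p ^ f) ^ (j - i)) ^ (p ^ f) ^ i = res v x ^ (p ^ f) ^ i := by
      rw [← pow_mul, ← pow_add, Nat.sub_add_cancel hlt.le, h1]
    refine iterateFrobenius_inj (resField v) p (f * i) ?_
    rw [iterateFrobenius_def, iterateFrobenius_def, pow_mul p]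
    exact h3
  obtain ⟨e, he⟩ := Nat.dvd_factorial (show 0 < j - i by omega) (show j - i ≤ n by omega)
  rw [he]
  generalize e = e
  induction e with
  | zero => simp
  | succ e ih => rw [mul_add, mul_one, pow_add, pow_mul, ih, h2]

theorem finite_res (h : IsLocalValuation k v p f s) [Fact p.Prime] : Finite (resField v) := by
  classical
  obtain ⟨M, hM, hc⟩ := h.exists_res_pow_eq
  have h1 : 1 < (p ^ f) ^ M := Nat.one_lt_pow hM (Nat.one_lt_pow h.ne_zero (Fact.out : p.Prime).one_lt)
  have h0 := FiniteField.X_pow_card_sub_X_ne_zero (resField v) h1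
  refine Set.finite_univ_iff.1 ((X ^ (p ^ f) ^ M - X : (resField v)[X]).roots.toFinset.finite_toSet.subset
    fun c _ => ?_)
  rw [mem_coe, Multiset.mem_toFinset, mem_roots h0, IsRoot.def, eval_sub, eval_pow, eval_X, hc,
    sub_self]

theorem exists_generator (h : IsLocalValuation k v p f s) [Fact p.Prime] :
    ∃ α : C, v α ≤ 1 ∧ ∀ x, v x ≤ 1 → res v x = 0 ∨ ∃ n : ℕ, res v x = res v (α ^ n) := by
  have := h.finite_res
  obtain ⟨g, hg⟩ := IsCyclic.exists_generator (α := (resField v)ˣ)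
  obtain ⟨α, hα, hαg⟩ := exists_res_eq (g : resField v)
  refine ⟨α, hα, fun x hx => ?_⟩
  by_cases h0 : res v x = 0
  · exact Or.inl h0
  right
  obtain ⟨n, hn⟩ := (Submonoid.mem_powers_iff _ _).1
    (mem_powers_iff_mem_zpowers.2 (hg (Units.mk0 _ h0)))
  refine ⟨n, ?_⟩
  rw [res_pow hα, hαg, ← Units.val_pow_eq_pow_val, hn, Units.val_mk0]

theorem exists_frobenius (h : IsLocalValuation k v p f s) [Fact p.Prime] :
    ∃ ϕ : C ≃ₐ[k] C, ∀ x, v x ≤ 1 → res v (ϕ x) = res v x ^ p ^ f := by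
  obtain ⟨α, hα, hgen⟩ := h.exists_generator
  obtain ⟨ϕ, hϕ⟩ := h.exists_algEquiv_pow hα
  rw [← res_eq_iff (h.map_sub_le_one ϕ hα) (map_pow_le_one hα _), res_pow hα] at hϕ
  exact ⟨ϕ, fun x hx => h.res_map_eq_pow hα hgen ϕ
    (pow_ne_zero _ (Fact.out : p.Prime).ne_zero) hϕ hx⟩

theorem exists_res_map_eq (h : IsLocalValuation k v p f s) [Fact p.Prime] (σ : C ≃ₐ[k] C) :
    ∃ j : ℕ, ∀ x, v x ≤ 1 → res v (σ x) = res v x ^ (p ^ f) ^ j := by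
  classical
  have := h.charP_res
  obtain ⟨α, hα, hgen⟩ := h.exists_generator
  obtain ⟨M, hM, hMc⟩ := h.exists_res_pow_eq
  let Q : (resField v)[X] := ∏ i ∈ range M, (X - Polynomial.C (res v α ^ (p ^ f) ^ i))
  have hQ : Q.map (iterateFrobenius (resField v) p f) = Q := by
    have h1 : Q.map (iterateFrobenius (resField v) p f) =
        ∏ i ∈ range M, (X - Polynomial.C (res v α ^ (p ^ f) ^ (i + 1))) := by
      rw [Polynomial.map_prod]
      refine Finset.prod_congr rfl fun i _ => ?_
      rw [Polynomial.map_sub, map_X, map_C, iterateFrobenius_def, ← pow_mul, ← pow_succ]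
    rw [h1]
    obtain ⟨M', rfl⟩ := Nat.exists_eq_succ_of_ne_zero hM
    simp only [Q]
    rw [Finset.prod_range_succ, Finset.prod_range_succ', hMc, pow_zero, pow_one]
  have hcoeff : ∀ i, ∃ t : k, v (algebraMap k C t) ≤ 1 ∧ res v (algebraMap k C t) = Q.coeff i := by
    intro i
    obtain ⟨x, hx, hxc⟩ := exists_res_eq (Q.coeff i)
    have h1 : Q.coeff i ^ p ^ f = Q.coeff i := by
      conv_rhs => rw [← hQ, coeff_map, iterateFrobenius_def]
    rw [← hxc, ← res_pow hx, res_eq_iff (map_pow_le_one hx _) hx] at h1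
    obtain ⟨t, ht⟩ := h.exists_lift x hx h1
    have ht1 : v (algebraMap k C t) ≤ 1 := by
      have : algebraMap k C t = x - (x - algebraMap k C t) := by ring
      rw [this]; exact v.map_sub_le hx ht.le
    exact ⟨t, ht1, by rw [← hxc, eq_comm, res_eq_iff hx ht1]; exact ht⟩
  choose t ht1 htc using hcoeff
  have hσα := h.map_sub_le_one σ hα
  have heval : ∀ x, v x ≤ 1 → Q.eval (res v x) =
      res v (∑ i ∈ range (Q.natDegree + 1), algebraMap k C (t i) * x ^ i) ∧
      v (∑ i ∈ range (Q.natDegree + 1), algebraMap k C (t i) * x ^ i) ≤ 1 := by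
    intro x hx
    have hle : ∀ i ∈ range (Q.natDegree + 1), v (algebraMap k C (t i) * x ^ i) ≤ 1 :=
      fun i _ => map_mul_le_one (ht1 i) (map_pow_le_one hx i)
    refine ⟨?_, map_sum_le_one _ _ hle⟩
    rw [res_sum _ _ hle, eval_eq_sum_range]
    refine Finset.sum_congr rfl fun i _ => ?_
    rw [res_mul (ht1 i) (map_pow_le_one hx i), res_pow hx, htc]
  have hzero : Q.eval (res v α) = 0 := by
    rw [eval_prod]
    refine Finset.prod_eq_zero (mem_range.2 (Nat.pos_of_ne_zero hM)) ?_
    simp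
  have hzero' : Q.eval (res v (σ α)) = 0 := by
    obtain ⟨h1, h2⟩ := heval α hα
    rw [hzero] at h1
    have h3 := h.res_map_eq σ h2 (y := 0) (by simp) (by rw [← h1, res_zero])
    rw [map_zero, res_zero] at h3
    rw [(heval _ hσα).1, ← h3, map_sum]
    simp
  rw [eval_prod, Finset.prod_eq_zero_iff] at hzero'
  obtain ⟨j, -, hj⟩ := hzero'
  rw [eval_sub, eval_X, eval_C, sub_eq_zero] at hj
  exact ⟨j, fun x hx => h.res_map_eq_pow hα hgen σ
    (pow_ne_zero _ (pow_ne_zero _ (Fact.out : p.Prime).ne_zero)) hj hx⟩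

/-- An element fixed by inertia has the value of an element of the base field, if the order of
inertia is prime to the residue characteristic. -/
theorem exists_val_eq (h : IsLocalValuation k v p f s) [Fact p.Prime]
    (hI : ¬ p ∣ Nat.card h.inertia) {y : C} (hy : ∀ σ ∈ h.inertia, σ y = y) (hy0 : y ≠ 0) :
    ∃ z : k, v (algebraMap k C z) = v y := by
  classical
  choose j hj using h.exists_res_map_eq
  have hvy : v y ≠ 0 := v.ne_zero_iff.2 hy0
  let F : (C ≃ₐ[k] C) → (resField v →* resField v) := fun σ => powMonoidHom ((p ^ f) ^ j σ)
  have hu : ∀ σ : C ≃ₐ[k] C, v (σ y / y) = 1 := by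
    intro σ
    rw [map_div₀, h.map_algEquiv, div_self hvy]
  have hfiber : ∀ σ τ : C ≃ₐ[k] C, F τ = F σ ↔ σ⁻¹ * τ ∈ h.inertia := by
    intro σ τ
    rw [h.mem_inertia]
    have key : ∀ x, v x ≤ 1 → (v ((σ⁻¹ * τ) x - x) < 1 ↔ F τ (res v x) = F σ (res v x)) := by
      intro x hx
      rw [← h.map_algEquiv σ, map_sub, AlgEquiv.mul_apply, AlgEquiv.aut_inv,
        AlgEquiv.apply_symm_apply, ← res_eq_iff (h.map_sub_le_one τ hx) (h.map_sub_le_one σ hx),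
        hj τ x hx, hj σ x hx]
      rfl
    constructor
    · intro heq x hx
      rw [key x hx, heq]
    · intro hmem
      ext c
      obtain ⟨x, hx, rfl⟩ := exists_res_eq c
      exact (key x hx).1 (hmem x hx)
  by_contra hcon
  push Not at hcon
  have hsum : ∀ c : resField v, ∑ σ : C ≃ₐ[k] C, res v (σ y / y) * F σ c = 0 := by
    intro c
    obtain ⟨x, hx, rfl⟩ := exists_res_eq c
    obtain ⟨z, hz⟩ := exists_algebraMap_eq (k := k) (x := ∑ σ : C ≃ₐ[k] C, σ (x * y)) (by
      intro τ
      rw [map_sum]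
      exact Fintype.sum_equiv (Equiv.mulLeft τ) _ _ fun σ => rfl)
    have hle : ∀ σ ∈ (univ : Finset (C ≃ₐ[k] C)), v (σ y / y * σ x) ≤ 1 :=
      fun σ _ => map_mul_le_one (hu σ).le (h.map_sub_le_one σ hx)
    have heq : ∑ σ : C ≃ₐ[k] C, σ y / y * σ x = algebraMap k C z / y := by
      rw [hz, Finset.sum_div]
      refine Finset.sum_congr rfl fun σ _ => ?_
      rw [map_mul]; field_simp
    have h1 : res v (∑ σ : C ≃ₐ[k] C, σ y / y * σ x) = 0 := by
      by_contra hne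
      rw [← Ne, res_ne_zero (map_sum_le_one _ _ hle), heq, map_div₀,
        div_eq_one_iff_eq hvy] at hne
      exact hcon z hne
    rw [res_sum _ _ hle] at h1
    rw [← h1]
    refine Finset.sum_congr rfl fun σ _ => ?_
    rw [res_mul (hu σ).le (h.map_sub_le_one σ hx), hj σ x hx]
    rfl
  have hli := linearIndependent_monoidHom (resField v) (resField v)
  rw [linearIndependent_iff'] at hli
  have h1 := hli (univ.image F)
    (fun φ => ∑ σ ∈ univ.filter (fun σ => F σ = φ), res v (σ y / y)) (by
      ext c
      rw [Finset.sum_apply, Pi.zero_apply, ← hsum c,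
        ← Finset.sum_fiberwise_of_maps_to (s := univ) (t := univ.image F) (g := F)
          (fun σ _ => mem_image_of_mem F (mem_univ σ))]
      refine Finset.sum_congr rfl fun φ _ => ?_
      rw [Pi.smul_apply, smul_eq_mul, Finset.sum_mul]
      refine Finset.sum_congr rfl fun σ hσ => ?_
      rw [(mem_filter.1 hσ).2]) (F 1) (mem_image_of_mem F (mem_univ 1))
  have h2 : ∀ σ ∈ univ.filter (fun σ => F σ = F 1), res v (σ y / y) = 1 := by
    intro σ hσ
    have := (hfiber 1 σ).1 (mem_filter.1 hσ).2
    rw [inv_one, one_mul] at this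
    rw [hy σ this, div_self hy0, res_one]
  have h3 : #(univ.filter (fun σ => F σ = F 1)) = Nat.card h.inertia := by
    rw [← Nat.card_eq_finsetCard]
    refine Nat.card_congr (Equiv.subtypeEquivRight fun σ => ?_)
    rw [mem_filter_univ, hfiber, inv_one, one_mul]
  rw [Finset.sum_congr rfl h2, sum_const, h3, nsmul_eq_mul, mul_one, ← res_natCast] at h1
  exact (res_ne_zero (map_natCast_le_one _)).2 (h.map_natCast _ hI) h1

end IsLocalValuation

namespace IsLocalValuation

variable {k C : Type*} [Field k] [Field C] [Algebra k C] {v : Valuation C ℝ≥0} {p f : ℕ} {s : k}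

theorem map_eq_of_mem_inertia (h : IsLocalValuation k v p f s) {σ : C ≃ₐ[k] C}
    (hσ : σ ∈ h.inertia) {N : ℕ} (hN : ¬ p ∣ N) {ξ : C} (hξ : ξ ^ N = 1) : σ ξ = ξ := by
  have hN0 : N ≠ 0 := by rintro rfl; exact hN (dvd_zero p)
  have hv : v ξ = 1 := by
    have := congrArg v hξ
    rw [map_pow, map_one] at this
    exact (pow_eq_one_iff_of_nonneg zero_le hN0).1 this
  exact h.eq_of_pow_eq_one hN (by rw [← map_pow, hξ, map_one]) hξ (hσ ξ hv.le)

theorem pow_apply_of_map_eq_mul {σ : C ≃ₐ[k] C} {ω ξ : C} (hω : σ ω = ξ * ω) (hξ : σ ξ = ξ)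
    (i : ℕ) : (σ ^ i) ω = ξ ^ i * ω := by
  induction i with
  | zero => simp
  | succ i ih =>
    rw [pow_succ', AlgEquiv.mul_apply, ih, map_mul, map_pow, hξ, hω, pow_succ, mul_assoc]

theorem res_map_of_mem_inertia (h : IsLocalValuation k v p f s) {σ : C ≃ₐ[k] C}
    (hσ : σ ∈ h.inertia) {x : C} (hx : v x ≤ 1) : res v (σ x) = res v x := by
  rw [res_eq_iff (h.map_sub_le_one σ hx) hx]
  exact hσ x hx

theorem map_sub_lt_of_uniformizer (h : IsLocalValuation k v p f s) {σ : C ≃ₐ[k] C}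
    (hσ : σ ∈ h.inertia) {ϖ : C} (hϖ0 : ϖ ≠ 0) (hϖ : ∀ x : C, x ≠ 0 → ∃ j : ℤ, v x = v ϖ ^ j)
    (hσϖ : v (σ ϖ - ϖ) < v ϖ) {x : C} (hx : x ≠ 0) : v (σ x - x) < v x := by
  have hvx : ∀ x : C, x ≠ 0 → v (σ x / x) = 1 := fun x hx => by
    rw [map_div₀, h.map_algEquiv, div_self (v.ne_zero_iff.2 hx)]
  have hiff : ∀ x : C, x ≠ 0 → (v (σ x - x) < v x ↔ res v (σ x / x) = 1) := by
    intro x hx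
    rw [← res_one, res_eq_iff (hvx x hx).le v.map_one.le, div_sub_one hx, map_div₀,
      div_lt_one₀ (zero_lt_iff.2 (v.ne_zero_iff.2 hx))]
  have hmul : ∀ x y : C, x ≠ 0 → y ≠ 0 →
      res v (σ (x * y) / (x * y)) = res v (σ x / x) * res v (σ y / y) := by
    intro x y hx hy
    rw [map_mul, mul_div_mul_comm, res_mul (hvx x hx).le (hvx y hy).le]
  have hpow : ∀ n : ℕ, res v (σ (ϖ ^ n) / ϖ ^ n) = 1 := by
    intro n
    induction n with
    | zero => simp [res_one]
    | succ n ih =>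
      rw [pow_succ, hmul _ _ (pow_ne_zero _ hϖ0) hϖ0, ih, (hiff ϖ hϖ0).1 hσϖ, one_mul]
  have hunit : ∀ u : C, v u = 1 → res v (σ u / u) = 1 := by
    intro u hu
    have hu0 : u ≠ 0 := v.ne_zero_iff.1 (by rw [hu]; exact one_ne_zero)
    rw [← hiff u hu0, hu]
    exact hσ u hu.le
  rw [hiff x hx]
  obtain ⟨j, hj⟩ := hϖ x hx
  have hvϖ := v.ne_zero_iff.2 hϖ0
  obtain ⟨n, rfl | rfl⟩ := j.eq_nat_or_neg
  · have hu : v (x / ϖ ^ n) = 1 := by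
      rw [map_div₀, hj, map_pow, zpow_natCast, div_self (pow_ne_zero _ hvϖ)]
    have h1 := hmul (x / ϖ ^ n) (ϖ ^ n) (div_ne_zero hx (pow_ne_zero _ hϖ0)) (pow_ne_zero _ hϖ0)
    rwa [div_mul_cancel₀ _ (pow_ne_zero _ hϖ0), hpow, hunit _ hu, one_mul] at h1
  · have hu : v (x * ϖ ^ n) = 1 := by
      rw [map_mul, hj, map_pow, zpow_neg, zpow_natCast, inv_mul_cancel₀ (pow_ne_zero _ hvϖ)]
    have h1 := hmul x (ϖ ^ n) hx (pow_ne_zero _ hϖ0)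
    rw [hpow, hunit _ hu, mul_one] at h1
    exact h1.symm

theorem eq_one_of_uniformizer (h : IsLocalValuation k v p f s) {σ : C ≃ₐ[k] C}
    (hσ : σ ∈ h.inertia) {ϖ : C} (hϖ0 : ϖ ≠ 0) (hϖ : ∀ x : C, x ≠ 0 → ∃ j : ℤ, v x = v ϖ ^ j)
    (hσϖ : v (σ ϖ - ϖ) < v ϖ) {d : ℕ} (hd : ¬ p ∣ d) (hσd : σ ^ d = 1) : σ = 1 := by
  ext x
  rw [AlgEquiv.one_apply]
  by_contra hne
  set y := σ x - x with hy
  have hy0 : y ≠ 0 := sub_ne_zero.2 hne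
  have hlt := h.map_sub_lt_of_uniformizer hσ hϖ0 hϖ hσϖ hy0
  have hi : ∀ i : ℕ, v ((σ ^ i) y - y) < v y := by
    intro i
    induction i with
    | zero => simpa using zero_lt_iff.2 (v.ne_zero_iff.2 hy0)
    | succ i ih =>
      have : (σ ^ (i + 1)) y - y = σ ((σ ^ i) y - y) + (σ y - y) := by
        rw [pow_succ', AlgEquiv.mul_apply, map_sub σ]; abel
      rw [this]
      exact v.map_add_lt (by rw [h.map_algEquiv]; exact ih) hlt
  have hsum : ∀ n : ℕ, ∑ i ∈ range n, (σ ^ i) y = (σ ^ n) x - x := by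
    intro n
    induction n with
    | zero => simp
    | succ n ih =>
      rw [Finset.sum_range_succ, ih, hy, map_sub, pow_succ, AlgEquiv.mul_apply]; ring
  have h1 : ∑ i ∈ range d, ((σ ^ i) y - y) = - ((d : C) * y) := by
    rw [Finset.sum_sub_distrib, hsum, hσd]
    simp
  have h2 : v (∑ i ∈ range d, ((σ ^ i) y - y)) < v y :=
    v.map_sum_lt (v.ne_zero_iff.2 hy0) fun i _ => hi i
  rw [h1, Valuation.map_neg, map_mul, h.map_natCast d hd, one_mul] at h2
  exact lt_irrefl _ h2

theorem res_pow_apply (h : IsLocalValuation k v p f s) {ϕ : C ≃ₐ[k] C}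
    (hϕ : ∀ x, v x ≤ 1 → res v (ϕ x) = res v x ^ p ^ f) (j : ℕ) {x : C} (hx : v x ≤ 1) :
    res v ((ϕ ^ j) x) = res v x ^ (p ^ f) ^ j := by
  induction j with
  | zero => simp
  | succ j ih =>
    rw [pow_succ', AlgEquiv.mul_apply, hϕ _ (h.map_sub_le_one _ hx), ih, ← pow_mul, ← pow_succ]

variable [FiniteDimensional k C] [IsGalois k C]

theorem card_inertia_le (h : IsLocalValuation k v p f s) {d : ℕ} (hd : ¬ p ∣ d)
    (hI : ∀ σ ∈ h.inertia, σ ^ d = 1) : Nat.card h.inertia ≤ d := by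
  classical
  have hd0 : 0 < d := Nat.pos_of_ne_zero (by rintro rfl; exact hd (dvd_zero p))
  obtain ⟨ϖ, hϖ0, -, hϖ⟩ := h.exists_uniformizer
  have hvϖ := v.ne_zero_iff.2 hϖ0
  have hu : ∀ σ : C ≃ₐ[k] C, v (σ ϖ / ϖ) = 1 := fun σ => by
    rw [map_div₀, h.map_algEquiv, div_self hvϖ]
  have hpow : ∀ σ ∈ h.inertia, ∀ i : ℕ, res v ((σ ^ i) ϖ / ϖ) = res v (σ ϖ / ϖ) ^ i := by
    intro σ hσ i
    induction i with
    | zero => simp [div_self hϖ0, res_one]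
    | succ i ih =>
      have h1 : (σ ^ (i + 1)) ϖ / ϖ = σ ((σ ^ i) ϖ / ϖ) * (σ ϖ / ϖ) := by
        have := (_root_.map_ne_zero σ).2 hϖ0
        rw [pow_succ', AlgEquiv.mul_apply, map_div₀]; field_simp
      rw [h1, res_mul (h.map_sub_le_one σ (hu _).le) (hu σ).le,
        h.res_map_of_mem_inertia hσ (hu _).le, ih, pow_succ]
  let Φ : h.inertia → ((nthRoots d (1 : resField v)).toFinset : Set (resField v)) := fun σ =>
    ⟨res v (σ.1 ϖ / ϖ), by
      rw [mem_coe, Multiset.mem_toFinset, mem_nthRoots hd0, ← hpow σ σ.2, hI σ σ.2,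
        AlgEquiv.one_apply, div_self hϖ0, res_one]⟩
  have hinj : Function.Injective Φ := by
    intro σ τ hστ
    have h1 : res v (σ.1 ϖ / ϖ) = res v (τ.1 ϖ / ϖ) := congrArg Subtype.val hστ
    rw [res_eq_iff (hu _).le (hu _).le, ← sub_div, map_div₀,
      div_lt_one₀ (zero_lt_iff.2 hvϖ)] at h1
    have h2 : τ⁻¹ * σ = 1 := by
      apply Subtype.ext
      refine h.eq_one_of_uniformizer (τ⁻¹ * σ).2 hϖ0 hϖ ?_ hd (hI _ (τ⁻¹ * σ).2)
      rw [← h.map_algEquiv τ.1, map_sub]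
      simpa using h1
    exact (inv_mul_eq_one.1 h2).symm
  have h1 := Nat.card_le_card_of_injective Φ hinj
  rw [Nat.card_eq_card_finite_toFinset (Set.toFinite _), Finset.finite_toSet_toFinset] at h1
  exact h1.trans ((Multiset.toFinset_card_le _).trans (card_nthRoots _ _))

theorem inertia_faithful (h : IsLocalValuation k v p f s) [Fact p.Prime] {d : ℕ} (hd0 : d ≠ 0)
    (hdp : d < p) {ω : C} (hω : ω ^ d = algebraMap k C s) (hI : ∀ σ ∈ h.inertia, σ ^ d = 1) :
    Nat.card h.inertia = d ∧ ∀ σ ∈ h.inertia, ∀ τ ∈ h.inertia, σ ω = τ ω → σ = τ := by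
  classical
  have hpd : ¬ p ∣ d := fun hdvd => absurd (Nat.le_of_dvd (Nat.pos_of_ne_zero hd0) hdvd) (by omega)
  have hle := h.card_inertia_le hpd hI
  have hs0 : algebraMap k C s ≠ 0 := (_root_.map_ne_zero _).2 h.uniformizer_ne
  have hω0 : ω ≠ 0 := by
    rintro rfl
    rw [zero_pow hd0] at hω
    exact hs0 hω.symm
  have hroot : ∀ σ : C ≃ₐ[k] C, (σ ω / ω) ^ d = 1 := fun σ => by
    rw [div_pow, ← map_pow, hω, AlgEquiv.commutes, div_self hs0]
  have hne : ∀ σ : C ≃ₐ[k] C, σ ω / ω ≠ 0 := fun σ =>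
    div_ne_zero ((_root_.map_ne_zero σ).2 hω0) hω0
  let χ : h.inertia →* Cˣ :=
    { toFun := fun σ => Units.mk0 (σ.1 ω / ω) (hne σ)
      map_one' := by ext; simp [div_self hω0]
      map_mul' := by
        intro σ τ
        ext
        have h1 := h.map_eq_of_mem_inertia σ.2 hpd (hroot τ)
        rw [map_div₀] at h1
        have := (_root_.map_ne_zero σ.1).2 hω0
        simp only [Units.val_mk0, Units.val_mul, Subgroup.coe_mul, AlgEquiv.mul_apply]
        rw [← h1]; field_simp }
  have hcardpos : Nat.card χ.range ≠ 0 := Nat.card_pos.ne'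
  set j := Nat.card χ.range with hj
  have hfix : ∀ σ ∈ h.inertia, σ (ω ^ j) = ω ^ j := by
    intro σ hσ
    have h1 : (⟨χ ⟨σ, hσ⟩, ⟨_, rfl⟩⟩ : χ.range) ^ j = 1 := pow_card_eq_one'
    have h2 := congrArg (fun z : χ.range => ((z : Cˣ) : C)) h1
    simp only [SubmonoidClass.coe_pow, Units.val_pow_eq_pow_val] at h2
    change (σ ω / ω) ^ j = 1 at h2
    rw [div_pow, div_eq_one_iff_eq (pow_ne_zero _ hω0)] at h2
    rw [map_pow, h2]
  have hIpos : 0 < Nat.card h.inertia := Nat.card_pos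
  obtain ⟨z, hz⟩ := h.exists_val_eq (fun hdvd => absurd (Nat.le_of_dvd hIpos hdvd) (by omega))
    hfix (pow_ne_zero _ hω0)
  have hz0 : z ≠ 0 := by
    rintro rfl
    rw [map_zero, map_zero, eq_comm, v.zero_iff] at hz
    exact pow_ne_zero _ hω0 hz
  obtain ⟨m, hm⟩ := h.exists_zpow z hz0
  have hvω0 : v ω ≠ 0 := v.ne_zero_iff.2 hω0
  have hvω1 : v ω < 1 := by
    have h1 := h.uniformizer_lt
    rw [← hω, map_pow] at h1
    exact (pow_lt_one_iff hd0).1 h1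
  have hdj : d ∣ j := by
    rw [hz, ← hω, map_pow, map_pow, ← zpow_natCast, ← zpow_natCast, ← zpow_mul] at hm
    have := zpow_right_injective₀ (zero_lt_iff.2 hvω0) hvω1.ne hm
    exact_mod_cast Dvd.intro m this.symm
  have hdj' := Nat.le_of_dvd (Nat.pos_of_ne_zero hcardpos) hdj
  have hjI : j ≤ Nat.card h.inertia := Nat.card_le_card_of_surjective χ.rangeRestrict
    χ.rangeRestrict_surjective
  refine ⟨by omega, fun σ hσ τ hτ hστ => ?_⟩
  have hbij : Function.Bijective χ.rangeRestrict :=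
    (Nat.bijective_iff_surjective_and_card _).2 ⟨χ.rangeRestrict_surjective, by omega⟩
  have h1 : χ.rangeRestrict ⟨σ, hσ⟩ = χ.rangeRestrict ⟨τ, hτ⟩ := by
    apply Subtype.ext
    apply Units.ext
    change σ ω / ω = τ ω / ω
    rw [hστ]
  exact congrArg Subtype.val (hbij.1 h1)

theorem tame_galois (h : IsLocalValuation k v p f s) [Fact p.Prime] {d k₀ N : ℕ} (hd0 : d ≠ 0)
    (hdp : d < p) (hk₀ : (p ^ f) ^ k₀ ≡ 1 [MOD d]) {ω a : C} (hω : ω ^ d = algebraMap k C s)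
    (ha : v a ≤ 1) (hao : ∀ i, v (a ^ (p ^ f) ^ i - a) < 1 → k₀ * d ∣ i) (hN : ¬ p ∣ N)
    (L : IntermediateField k C) (hL : ∀ σ : C ≃ₐ[k] C, ∀ x ∈ L, (σ ^ d) x = x)
    (hgen : ∀ σ : C ≃ₐ[k] C, (∀ x ∈ L, σ x = x) → σ ω = ω → (∀ ξ, ξ ^ N = 1 → σ ξ = ξ) →
      σ = 1) :
    (∀ σ : C ≃ₐ[k] C, σ ω = ω → v (σ a - a) < 1 → ∀ x ∈ L, σ x = x) ∧
    (∀ σ : C ≃ₐ[k] C, v (σ a - a) < 1 → ∀ ξ, ξ ^ d = 1 → σ ξ = ξ) ∧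
    ∃ g : Fin (k₀ * d) × Fin d → (C ≃ₐ[k] C), ∀ u u', v (g u a - g u' a) < 1 →
      g u ω = g u' ω → u = u' := by
  classical
  have hpd : ¬ p ∣ d := fun hdvd => absurd (Nat.le_of_dvd (Nat.pos_of_ne_zero hd0) hdvd) (by omega)
  have hs0 : algebraMap k C s ≠ 0 := (_root_.map_ne_zero _).2 h.uniformizer_ne
  have hω0 : ω ≠ 0 := by
    rintro rfl
    rw [zero_pow hd0] at hω
    exact hs0 hω.symm
  have hroot : ∀ σ : C ≃ₐ[k] C, (σ ω / ω) ^ d = 1 := fun σ => by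
    rw [div_pow, ← map_pow, hω, AlgEquiv.commutes, div_self hs0]
  have hdω : ∀ σ : C ≃ₐ[k] C, σ (σ ω / ω) = σ ω / ω → (σ ^ d) ω = ω := by
    intro σ hσ
    rw [pow_apply_of_map_eq_mul (div_mul_cancel₀ _ hω0).symm hσ, hroot, one_mul]
  have hI : ∀ σ ∈ h.inertia, σ ^ d = 1 := by
    intro σ hσ
    refine hgen _ (hL σ) (hdω σ (h.map_eq_of_mem_inertia hσ hpd (hroot σ))) fun ξ hξ => ?_
    exact h.map_eq_of_mem_inertia (Subgroup.pow_mem _ hσ d) hN hξ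
  obtain ⟨hcard, hfaith⟩ := h.inertia_faithful hd0 hdp hω hI
  obtain ⟨ϕ, hϕ⟩ := h.exists_frobenius
  have hvroot : ∀ ξ : C, ξ ^ d = 1 → v ξ ≤ 1 := by
    intro ξ hξ
    have := congrArg v hξ
    rw [map_pow, map_one] at this
    exact ((pow_eq_one_iff_of_nonneg zero_le hd0).1 this).le
  have hmod : ∀ ξ : C, ξ ^ d = 1 → ∀ e, ξ ^ (p ^ f) ^ (k₀ * e) = ξ := by
    intro ξ hξ e
    conv_rhs => rw [← pow_one ξ]
    rw [pow_eq_pow_mod _ hξ, pow_eq_pow_mod 1 hξ]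
    congr 1
    have := hk₀.pow e
    rwa [one_pow, ← pow_mul] at this
  have hϕD : (ϕ ^ (k₀ * d)) ω = ω := by
    rw [pow_mul]
    apply hdω
    set ξ := (ϕ ^ k₀) ω / ω with hξ
    have hξd : ξ ^ d = 1 := hroot (ϕ ^ k₀)
    have hξ1 := hvroot ξ hξd
    have h1 : ξ ^ (p ^ f) ^ k₀ = ξ := by simpa using hmod ξ hξd 1
    refine h.eq_of_pow_eq_one hpd (by rw [← map_pow, hξd, map_one]) hξd ?_
    rw [← res_eq_iff (h.map_sub_le_one _ hξ1) hξ1, h.res_pow_apply hϕ _ hξ1, ← res_pow hξ1, h1]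
  have hfrob : ∀ σ : C ≃ₐ[k] C, v (σ a - a) < 1 →
      ∃ e, ∀ x, v x ≤ 1 → res v (σ x) = res v x ^ (p ^ f) ^ (k₀ * d * e) := by
    intro σ hσa
    obtain ⟨j, hj⟩ := h.exists_res_map_eq σ
    have hDj : k₀ * d ∣ j := by
      apply hao
      rw [← res_eq_iff (map_pow_le_one ha _) ha, res_pow ha, ← hj a ha,
        res_eq_iff (h.map_sub_le_one σ ha) ha]
      exact hσa
    obtain ⟨e, rfl⟩ := hDj
    exact ⟨e, hj⟩
  refine ⟨?_, ?_, ?_⟩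
  · intro σ hσω hσa
    obtain ⟨e, hj⟩ := hfrob σ hσa
    have hϕω : (ϕ ^ (k₀ * d * e)) ω = ω := by
      rw [pow_mul]
      exact Subgroup.pow_mem (MulAction.stabilizer (C ≃ₐ[k] C) ω) hϕD e
    have hmem : (ϕ ^ (k₀ * d * e))⁻¹ * σ ∈ h.inertia := by
      intro x hx
      rw [← h.map_algEquiv (ϕ ^ (k₀ * d * e)), map_sub, ← AlgEquiv.mul_apply,
        mul_inv_cancel_left, ← res_eq_iff (h.map_sub_le_one _ hx) (h.map_sub_le_one _ hx),
        h.res_pow_apply hϕ _ hx, hj x hx]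
    have heq := hfaith _ hmem 1 (Subgroup.one_mem _) (by
      rw [AlgEquiv.mul_apply, hσω, AlgEquiv.one_apply]
      conv_lhs => rw [← hϕω]
      rw [← AlgEquiv.mul_apply, inv_mul_cancel, AlgEquiv.one_apply])
    rw [inv_mul_eq_one] at heq
    intro x hx
    rw [← heq, mul_right_comm, pow_mul]
    exact hL _ x hx
  · intro σ hσa ξ hξ
    obtain ⟨e, hj⟩ := hfrob σ hσa
    have hξ1 := hvroot ξ hξ
    refine h.eq_of_pow_eq_one hpd (by rw [← map_pow, hξ, map_one]) hξ ?_
    rw [← res_eq_iff (h.map_sub_le_one _ hξ1) hξ1, hj ξ hξ1, ← res_pow hξ1, mul_assoc, hmod ξ hξ]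
  · have e := (Finite.equivFinOfCardEq hcard).symm
    refine ⟨fun u => ϕ ^ (u.1 : ℕ) * (e u.2).1, ?_⟩
    have hres : ∀ u : Fin (k₀ * d) × Fin d,
        res v ((ϕ ^ (u.1 : ℕ) * (e u.2).1) a) = res v a ^ (p ^ f) ^ (u.1 : ℕ) := by
      intro u
      rw [AlgEquiv.mul_apply, h.res_pow_apply hϕ _ (h.map_sub_le_one _ ha),
        h.res_map_of_mem_inertia (e u.2).2 ha]
    have hlt : ∀ i j : ℕ, i ≤ j → j < k₀ * d →
        res v a ^ (p ^ f) ^ i = res v a ^ (p ^ f) ^ j → i = j := by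
      intro i j hij hj heq
      have h1 : res v (a ^ (p ^ f) ^ (j - i)) ^ (p ^ f) ^ i = res v a ^ (p ^ f) ^ i := by
        rw [res_pow ha, ← pow_mul, ← pow_add, Nat.sub_add_cancel hij, heq]
      rw [h.res_pow_eq_iff (map_pow_le_one ha _) ha] at h1
      have := Nat.eq_zero_of_dvd_of_lt (hao _ h1) (by omega)
      omega
    rintro ⟨i, m⟩ ⟨i', m'⟩ hva hω'
    rw [← res_eq_iff (h.map_sub_le_one _ ha) (h.map_sub_le_one _ ha), hres, hres] at hva
    have hi : i = i' := by
      apply Fin.ext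
      rcases le_total (i : ℕ) i' with hle | hle
      · exact hlt _ _ hle i'.2 hva
      · exact (hlt _ _ hle i.2 hva.symm).symm
    subst hi
    rw [AlgEquiv.mul_apply, AlgEquiv.mul_apply] at hω'
    have := hfaith _ (e m).2 _ (e m').2 ((ϕ ^ (i : ℕ)).injective hω')
    rw [Subtype.coe_inj] at this
    rw [e.injective this]

end IsLocalValuation

/-- Points whose stabilizers lie in the kernel of `φ : Γ → G` and whose orbits are disjoint and of
the same size give rise to a labelling of the union of their orbits which is compatible with `φ`. -/
theorem exists_equivariant_labelling {Γ G Y : Type*} [Group Γ] [Group G] [Finite G]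
    [MulAction Γ Y] (φ : Γ →* G) {r M : ℕ} (hM : M ≠ 0) (x : G × Fin r → Y)
    (hdisj : ∀ i j, x i ∈ MulAction.orbit Γ (x j) → i = j)
    (hstab : ∀ i, ∀ σ : Γ, σ • x i = x i → φ σ = 1)
    (hcard : ∀ i, Nat.card (MulAction.orbit Γ (x i)) = M) :
    ∃ z : G × Fin (r * M) → Y, Function.Injective z ∧
      (∀ u, ∃ i, ∃ σ : Γ, z u = σ • x i) ∧
      ∀ (σ : Γ) a y, ∃ y', σ • z (a, y) = z (φ σ * a, y') := by
  classical
  have := Fintype.ofFinite G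
  have hfin : ∀ i, Finite (MulAction.orbit Γ (x i)) := fun i =>
    Nat.finite_of_card_ne_zero (by rw [hcard]; exact hM)
  have := fun i => Fintype.ofFinite (MulAction.orbit Γ (x i))
  have hex : ∀ i, ∃ l : MulAction.orbit Γ (x i) → G,
      ∀ σ : Γ, l ⟨σ • x i, MulAction.mem_orbit _ σ⟩ = φ σ := by
    intro i
    choose τ hτ using fun z : MulAction.orbit Γ (x i) => MulAction.mem_orbit_iff.1 z.2
    refine ⟨fun z => φ (τ z), fun σ => ?_⟩
    have h1 := hτ ⟨σ • x i, MulAction.mem_orbit _ σ⟩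
    have h2 := hstab i (σ⁻¹ * τ ⟨σ • x i, MulAction.mem_orbit _ σ⟩) (by
      rw [mul_smul, h1, inv_smul_smul])
    rw [map_mul, map_inv, inv_mul_eq_one] at h2
    exact h2.symm
  choose l hl using hex
  have hl' : ∀ i (σ : Γ) (z : MulAction.orbit Γ (x i)), l i (σ • z) = φ σ * l i z := by
    rintro i σ ⟨-, τ, rfl⟩
    have h1 := hl i (σ * τ)
    rw [map_mul, ← hl i τ] at h1
    rw [← h1]
    congr 1
    exact Subtype.ext (mul_smul σ τ (x i)).symm
  have hfib : ∀ i g, Fintype.card {z // l i z = g} =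
      if g ∈ φ.range then Fintype.card {z // l i z = 1} else 0 := by
    intro i g
    split_ifs with hg
    · obtain ⟨σ, rfl⟩ := hg
      refine Fintype.card_congr ((MulAction.toPerm σ⁻¹ : Equiv.Perm _).subtypeEquiv fun z => ?_)
      rw [MulAction.toPerm_apply, hl', map_inv, inv_mul_eq_one, eq_comm]
    · rw [Fintype.card_eq_zero_iff]
      refine ⟨fun ⟨⟨_, σ, rfl⟩, hz⟩ => hg ⟨σ, ?_⟩⟩
      rw [← hl i σ]; exact hz
  have hM' : ∀ i, Fintype.card φ.range * Fintype.card {z // l i z = 1} = M := by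
    intro i
    have h1 := Fintype.card_congr (Equiv.sigmaFiberEquiv (l i))
    rw [Fintype.card_sigma, ← Nat.card_eq_fintype_card, hcard] at h1
    rw [← h1, Finset.sum_congr rfl fun g _ => hfib i g, ← Finset.sum_filter, sum_const, smul_eq_mul,
      Fintype.card_subtype]
  let l' : (Σ i, MulAction.orbit Γ (x i)) → G := fun w => l w.1 w.2 * w.1.1
  have hcount : ∀ g, Fintype.card {w // l' w = g} = r * M := by
    intro g
    have h1 : Fintype.card {w // l' w = g} =
        ∑ i : G × Fin r, Fintype.card {z // l i z = g * i.1⁻¹} := by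
      rw [← Fintype.card_sigma]
      refine Fintype.card_congr
        { toFun := fun w => ⟨w.1.1, w.1.2, eq_mul_inv_of_mul_eq w.2⟩
          invFun := fun w => ⟨⟨w.1, w.2.1⟩, by simp [l', w.2.2]⟩
          left_inv := fun w => rfl
          right_inv := fun w => rfl }
    rw [h1, Fintype.sum_prod_type, Finset.sum_comm]
    have h2 : ∀ y : Fin r, ∑ c : G, Fintype.card {z // l (c, y) z = g * c⁻¹} = M := by
      intro y
      have h3 : ∀ i, Fintype.card {z // l i z = 1} = M / Fintype.card φ.range := fun i =>
        (Nat.div_eq_of_eq_mul_right Fintype.card_pos (hM' i).symm).symm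
      rw [← Equiv.sum_comp ((Equiv.inv G).trans (Equiv.mulRight g))]
      have h4 : ∀ c : G, Fintype.card {z // l (((Equiv.inv G).trans (Equiv.mulRight g)) c, y) z =
          g * (((Equiv.inv G).trans (Equiv.mulRight g)) c)⁻¹} =
          if c ∈ φ.range then M / Fintype.card φ.range else 0 := by
        intro c
        rw [hfib, h3]
        simp
      rw [Finset.sum_congr rfl fun c _ => h4 c, ← Finset.sum_filter, sum_const, smul_eq_mul,
        ← Fintype.card_subtype, ← hM' (1, y), Nat.mul_div_cancel_left _ Fintype.card_pos]
    simp [h2]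
  have e : ∀ g, Fin (r * M) ≃ {w // l' w = g} := fun g =>
    (Fintype.equivFinOfCardEq (hcount g)).symm
  have hinj : Function.Injective
      fun w : (Σ i, MulAction.orbit Γ (x i)) => (w.2 : Y) := by
    rintro ⟨i, z, σ, hz⟩ ⟨j, w, τ, hw⟩ (rfl : z = w)
    have : i = j := hdisj i j ⟨σ⁻¹ * τ, by
      change (σ⁻¹ * τ) • x j = x i
      rw [mul_smul, inv_smul_eq_iff]
      exact hw.trans hz.symm⟩
    subst this
    rfl
  refine ⟨fun u => (e u.1 u.2).1.2, ?_, ?_, ?_⟩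
  · rintro ⟨a, y⟩ ⟨b, y'⟩ huv
    have h1 := hinj huv
    have hab : a = b := by
      rw [← (e a y).2, ← (e b y').2]
      exact congrArg l' h1
    subst hab
    exact congrArg _ ((e a).injective (Subtype.ext h1))
  · intro u
    obtain ⟨σ, hσ⟩ := (e u.1 u.2).1.2.2
    exact ⟨_, σ, hσ.symm⟩
  · intro σ a y
    have h1 : l' ⟨(e a y).1.1, σ • (e a y).1.2⟩ = φ σ * a := by
      have := (e a y).2
      simp only [l'] at this ⊢
      rw [hl', mul_assoc, this]
    refine ⟨(e (φ σ * a)).symm ⟨_, h1⟩, ?_⟩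
    exact (congrArg (fun w : {w // l' w = φ σ * a} => (w.1.2 : Y))
      ((e (φ σ * a)).apply_symm_apply ⟨_, h1⟩)).symm

namespace IsLocalValuation

variable {k C : Type*} [Field k] [Field C] [Algebra k C] {v : Valuation C ℝ≥0} {p f : ℕ} {s : k}

theorem restrict [Normal k C] (h : IsLocalValuation k v p f s) (M : IntermediateField k C) [Normal k M] :
    IsLocalValuation k (v.comap (algebraMap M C)) p f s where
  map_algEquiv σ x := by
    obtain ⟨τ, rfl⟩ := AlgEquiv.restrictNormalHom_surjective (F := k) (K₁ := M) C σ
    exact (congrArg v (AlgEquiv.restrictNormal_commutes τ M x)).trans (h.map_algEquiv τ _)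
  uniformizer_lt := h.uniformizer_lt
  uniformizer_ne := h.uniformizer_ne
  exists_zpow := h.exists_zpow
  pow_card x hx := by
    have := h.pow_card x hx
    rw [Valuation.comap_apply, map_sub, map_pow]
    exact this
  exists_lift x hx hxq := by
    rw [Valuation.comap_apply, map_sub, map_pow] at hxq
    obtain ⟨t, ht⟩ := h.exists_lift x hx hxq
    refine ⟨t, ?_⟩
    rw [Valuation.comap_apply, map_sub]
    exact ht
  map_natCast n hn := by
    rw [Valuation.comap_apply, _root_.map_natCast]
    exact h.map_natCast n hn
  map_prime := by
    rw [Valuation.comap_apply, _root_.map_natCast]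
    exact h.map_prime
  ne_zero := h.ne_zero

/-- The structure of the tame Galois group, for elements of an algebraic closure. -/
theorem tame_absolute [IsAlgClosure k C] [CharZero k] (h : IsLocalValuation k v p f s)
    [Fact p.Prime] {d k₀ : ℕ} (hd0 : d ≠ 0) (hk0 : k₀ ≠ 0)
    (hdp : d < p) (hk₀ : (p ^ f) ^ k₀ ≡ 1 [MOD d]) {ω a : C} (hω : ω ^ d = algebraMap k C s)
    (ha : a ^ ((p ^ f) ^ (k₀ * d) - 1) = 1)
    (hao : ∀ i, v (a ^ (p ^ f) ^ i - a) < 1 → k₀ * d ∣ i)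
    (L : IntermediateField k C) [FiniteDimensional k L] [Normal k L]
    (hL : ∀ σ : C ≃ₐ[k] C, ∀ x ∈ L, (σ ^ d) x = x) :
    (∀ σ : C ≃ₐ[k] C, σ ω = ω → v (σ a - a) < 1 → ∀ x ∈ L, σ x = x) ∧
    (∀ σ : C ≃ₐ[k] C, v (σ a - a) < 1 → ∀ ξ, ξ ^ d = 1 → σ ξ = ξ) ∧
    (∀ σ : C ≃ₐ[k] C, ∃ j, v (σ a - a ^ (p ^ f) ^ j) < 1) ∧
    ∃ g : Fin (k₀ * d) × Fin d → (C ≃ₐ[k] C), ∀ u u', v (g u a - g u' a) < 1 →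
      g u ω = g u' ω → u = u' := by
  have : Normal k C := IsAlgClosure.normal k C
  have := IsAlgClosure.isAlgClosed k (K := C)
  set q := (p ^ f) ^ (k₀ * d) with hq
  have hpd : ¬ p ∣ d := fun hdvd => absurd (Nat.le_of_dvd (Nat.pos_of_ne_zero hd0) hdvd) (by omega)
  have hpp : p.Prime := Fact.out
  have hpq : p ∣ q := by
    rw [hq, ← pow_mul]
    exact dvd_pow_self p (mul_ne_zero h.ne_zero (mul_ne_zero hk0 hd0))
  have hq0 : 0 < q := pow_pos (pow_pos hpp.pos _) _
  have hq1 : 1 < q := (hpp.one_lt).trans_le (Nat.le_of_dvd hq0 hpq)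
  set N := (q - 1) * d with hN
  have hN0 : N ≠ 0 := mul_ne_zero (by omega) hd0
  have hpN : ¬ p ∣ N := by
    rw [hN, hpp.dvd_mul, not_or]
    refine ⟨fun h1 => ?_, hpd⟩
    have h2 := (Nat.dvd_sub hpq h1)
    rw [Nat.sub_sub_self hq0] at h2
    exact hpp.one_lt.ne' (Nat.dvd_one.1 h2)
  have haN : a ^ N = 1 := by rw [hN, pow_mul, ha, one_pow]
  have hdN : ∀ ξ : C, ξ ^ d = 1 → ξ ^ N = 1 := fun ξ hξ => by
    rw [hN, mul_comm, pow_mul, hξ, one_pow]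
  have hs0 : algebraMap k C s ≠ 0 := (_root_.map_ne_zero _).2 h.uniformizer_ne
  have hω0 : ω ≠ 0 := by
    rintro rfl
    rw [zero_pow hd0] at hω
    exact hs0 hω.symm
  let Q : k[X] := (X ^ d - Polynomial.C s) * (X ^ N - 1)
  have hQ0 : Q ≠ 0 := mul_ne_zero (X_pow_sub_C_ne_zero (Nat.pos_of_ne_zero hd0) s)
    (X_pow_sub_C_ne_zero (Nat.pos_of_ne_zero hN0) (1 : k))
  have hmemQ : ∀ x : C, x ∈ Q.rootSet C ↔ x ^ d = algebraMap k C s ∨ x ^ N = 1 := by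
    intro x
    rw [mem_rootSet_of_ne hQ0]
    simp [Q, sub_eq_zero]
  let M : IntermediateField k C := IntermediateField.adjoin k (L ∪ Q.rootSet C)
  have hMdef : M = L ⊔ IntermediateField.adjoin k (Q.rootSet C) := by
    rw [← IntermediateField.adjoin_self k L, ← IntermediateField.adjoin_union]
  have hsplit : IsSplittingField k (IntermediateField.adjoin k (Q.rootSet C)) Q :=
    IntermediateField.adjoin_rootSet_isSplittingField (IsAlgClosed.splits _)
  have hnormal : Normal k (IntermediateField.adjoin k (Q.rootSet C)) := Normal.of_isSplittingField Q
  have hfd : FiniteDimensional k (IntermediateField.adjoin k (Q.rootSet C)) :=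
    IsSplittingField.finiteDimensional _ Q
  have hMn : Normal k M := by rw [hMdef]; infer_instance
  have hMf : FiniteDimensional k M := by rw [hMdef]; infer_instance
  have hMg : IsGalois k M := ⟨⟩
  have hsub : ∀ x, x ∈ L ∨ x ∈ Q.rootSet C → x ∈ M := fun x hx =>
    IntermediateField.subset_adjoin k _ hx
  have hωM : ω ∈ M := hsub _ (Or.inr ((hmemQ ω).2 (Or.inl hω)))
  have hξM : ∀ ξ : C, ξ ^ N = 1 → ξ ∈ M := fun ξ hξ => hsub _ (Or.inr ((hmemQ ξ).2 (Or.inr hξ)))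
  have hcomm : ∀ (σ : C ≃ₐ[k] C) (x : M), ((AlgEquiv.restrictNormalHom M σ x : M) : C) = σ x :=
    fun σ x => AlgEquiv.restrictNormal_commutes σ M x
  have hv1 : v a = 1 := by
    have := congrArg v haN
    rw [map_pow, map_one] at this
    exact (pow_eq_one_iff_of_nonneg zero_le hN0).1 this
  obtain ⟨h1, h2, g, hg⟩ := (h.restrict M).tame_galois (ω := ⟨ω, hωM⟩) (a := ⟨a, hξM a haN⟩)
    (N := N) hd0 hdp hk₀ (Subtype.ext hω) hv1.le hao hpN (L.comap M.val) (by
      intro σ x hx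
      obtain ⟨τ, rfl⟩ := AlgEquiv.restrictNormalHom_surjective (F := k) (K₁ := M) C σ
      rw [← map_pow]
      exact Subtype.ext ((hcomm _ _).trans (hL τ x hx))) (by
      intro σ hσL hσω hσξ
      have key : ∀ x (hx : x ∈ M), σ ⟨x, hx⟩ = ⟨x, hx⟩ := by
        intro x hx
        induction hx using IntermediateField.adjoin_induction with
        | mem x hx =>
          rcases hx with hx | hx
          · exact hσL ⟨x, hsub x (Or.inl hx)⟩ hx
          rcases (hmemQ x).1 hx with hx' | hx'
          · have hxM := hsub x (Or.inr hx)
            have hxω : (x / ω) ^ N = 1 := hdN _ (by rw [div_pow, hx', hω, div_self hs0])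
            have : (⟨x, hxM⟩ : M) = ⟨x / ω, hξM _ hxω⟩ * ⟨ω, hωM⟩ :=
              Subtype.ext (div_mul_cancel₀ x hω0).symm
            change σ ⟨x, hxM⟩ = ⟨x, hxM⟩
            rw [this, map_mul, hσω, hσξ _ (Subtype.ext hxω)]
          · exact hσξ ⟨x, hξM x hx'⟩ (Subtype.ext hx')
        | algebraMap r => exact σ.commutes r
        | add x y hx hy ihx ihy =>
          exact (map_add σ ⟨x, hx⟩ ⟨y, hy⟩).trans (congrArg₂ (· + ·) ihx ihy)
        | mul x y hx hy ihx ihy =>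
          exact (map_mul σ ⟨x, hx⟩ ⟨y, hy⟩).trans (congrArg₂ (· * ·) ihx ihy)
        | inv x hx ihx => exact (map_inv₀ σ ⟨x, hx⟩).trans (congrArg (·⁻¹) ihx)
      ext x
      exact congrArg Subtype.val (key x.1 x.2))
  refine ⟨fun σ hσω hσa x hx => ?_, fun σ hσa ξ hξ => ?_, fun σ => ?_, ?_⟩
  · have := h1 (AlgEquiv.restrictNormalHom M σ) (Subtype.ext ((hcomm _ _).trans hσω)) (by
      rw [Valuation.comap_apply, map_sub]
      change v (((AlgEquiv.restrictNormalHom M σ _ : M) : C) - a) < 1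
      rw [hcomm]; exact hσa) ⟨x, hsub x (Or.inl hx)⟩ hx
    exact (hcomm σ _).symm.trans (congrArg Subtype.val this)
  · have := h2 (AlgEquiv.restrictNormalHom M σ) (by
      rw [Valuation.comap_apply, map_sub]
      change v (((AlgEquiv.restrictNormalHom M σ _ : M) : C) - a) < 1
      rw [hcomm]; exact hσa) ⟨ξ, hξM ξ (hdN ξ hξ)⟩ (Subtype.ext hξ)
    exact (hcomm σ _).symm.trans (congrArg Subtype.val this)
  · obtain ⟨j, hj⟩ := (h.restrict M).exists_res_map_eq (AlgEquiv.restrictNormalHom M σ)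
    have h3 := hj ⟨a, hξM a haN⟩ hv1.le
    rw [← res_pow (v := v.comap (algebraMap M C)) hv1.le,
      res_eq_iff ((h.restrict M).map_sub_le_one _ hv1.le) (map_pow_le_one hv1.le _),
      Valuation.comap_apply, map_sub] at h3
    change v (((AlgEquiv.restrictNormalHom M σ _ : M) : C) - a ^ (p ^ f) ^ j) < 1 at h3
    rw [hcomm] at h3
    exact ⟨j, h3⟩
  · choose τ hτ using AlgEquiv.restrictNormalHom_surjective (F := k) (K₁ := M) C
    refine ⟨fun u => τ (g u), fun u u' huv huω => hg u u' ?_ (Subtype.ext ?_)⟩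
    · rw [Valuation.comap_apply, map_sub]
      have h3 := fun u => hcomm (τ (g u)) ⟨a, hξM a haN⟩
      simp only [hτ] at h3
      change v (((g u ⟨a, hξM a haN⟩ : M) : C) - ((g u' ⟨a, hξM a haN⟩ : M) : C)) < 1
      rw [h3, h3]
      exact huv
    · have h3 := fun u => hcomm (τ (g u)) ⟨ω, hωM⟩
      simp only [hτ] at h3
      rw [h3, h3]
      exact huω

end IsLocalValuation

section Family

variable {A B : Type*} [CommRing A] [CommRing B]

/-- The product of the polynomials `Φ_d((X - i) ^ d - t)` for `i < R`. -/
noncomputable def cyclotomicShifts (d R : ℕ) (t : A) : A[X] :=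
  ∏ i ∈ range R, (cyclotomic d A).comp ((X - C (i : A)) ^ d - C t)

/-- The cofactor of `s ^ 2` in `genericFamily`. -/
noncomputable def genericCofactor (d R n m : ℕ) (s t : A) : A[X] :=
  (X ^ 2 - C t) * ∏ i ∈ range (n - 2), (X - C ((i : A) + 1)) -
    X ^ m * (cyclotomicShifts d R t ^ d - 1) + C (1 - s)

/-- A two-parameter family of polynomials. Modulo `s ^ 2` it is `X ^ m (P ^ d - s)` with `P` the
polynomial `cyclotomicShifts`, whereas `s = 1` gives `(X ^ 2 - t) (X - 1) ⋯ (X - (n - 2))`. -/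
noncomputable def genericFamily (d R n m : ℕ) (s t : A) : A[X] :=
  X ^ m * (cyclotomicShifts d R t ^ d - C s) + C (s ^ 2) * genericCofactor d R n m s t

theorem cyclotomicShifts_map (d R : ℕ) (t : A) (g : A →+* B) :
    (cyclotomicShifts d R t).map g = cyclotomicShifts d R (g t) := by
  simp [cyclotomicShifts, Polynomial.map_prod, map_comp]

theorem genericCofactor_map (d R n m : ℕ) (s t : A) (g : A →+* B) :
    (genericCofactor d R n m s t).map g = genericCofactor d R n m (g s) (g t) := by
  simp [genericCofactor, Polynomial.map_prod, cyclotomicShifts_map]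

theorem genericFamily_map (d R n m : ℕ) (s t : A) (g : A →+* B) :
    (genericFamily d R n m s t).map g = genericFamily d R n m (g s) (g t) := by
  simp [genericFamily, genericCofactor_map, cyclotomicShifts_map]

theorem monic_shift_pow_sub {d : ℕ} (hd : d ≠ 0) (i t : A) :
    ((X - C i) ^ d - C t).Monic := by
  nontriviality A
  have h1 : ((X - C i) ^ d).natDegree = d := by
    rw [(monic_X_sub_C i).natDegree_pow, natDegree_X_sub_C, mul_one]
  refine ((monic_X_sub_C i).pow d).sub_of_left (degree_C_le.trans_lt ?_)
  rw [degree_eq_natDegree ((monic_X_sub_C i).pow d).ne_zero, h1]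
  exact_mod_cast Nat.pos_of_ne_zero hd

theorem natDegree_shift_pow_sub [Nontrivial A] (d : ℕ) (i t : A) :
    ((X - C i) ^ d - C t).natDegree = d := by
  rw [natDegree_sub_C, (monic_X_sub_C i).natDegree_pow, natDegree_X_sub_C, mul_one]

theorem cyclotomicShifts_monic {d : ℕ} (hd : d ≠ 0) (R : ℕ) (t : A) :
    (cyclotomicShifts d R t).Monic := by
  nontriviality A
  refine monic_prod_of_monic _ _ fun i _ => ?_
  exact (cyclotomic.monic d A).comp (monic_shift_pow_sub hd _ t)
    (by rw [natDegree_shift_pow_sub]; exact hd)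

theorem natDegree_cyclotomicShifts [Nontrivial A] {d : ℕ} (hd : d ≠ 0) (R : ℕ) (t : A) :
    (cyclotomicShifts d R t).natDegree = R * (d.totient * d) := by
  rw [cyclotomicShifts, natDegree_prod_of_monic, Finset.sum_congr rfl fun i _ => ?_, sum_const,
    card_range, smul_eq_mul]
  · rw [natDegree_comp_eq_of_mul_ne_zero, natDegree_cyclotomic, natDegree_shift_pow_sub]
    rw [(cyclotomic.monic d A).leadingCoeff, (monic_shift_pow_sub hd _ t).leadingCoeff]
    simp
  · exact fun i _ => (cyclotomic.monic d A).comp (monic_shift_pow_sub hd _ t)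
      (by rw [natDegree_shift_pow_sub]; exact hd)

theorem genericFamily_main_monic {d : ℕ} (hd : d ≠ 0) (R m : ℕ) (t : A) :
    (X ^ m * cyclotomicShifts d R t ^ d).Monic :=
  (monic_X_pow m).mul ((cyclotomicShifts_monic hd R t).pow d)

theorem natDegree_genericFamily_main [Nontrivial A] {d : ℕ} (hd : d ≠ 0) (R m : ℕ) (t : A) :
    (X ^ m * cyclotomicShifts d R t ^ d).natDegree = m + d * (R * (d.totient * d)) := by
  rw [(monic_X_pow m).natDegree_mul ((cyclotomicShifts_monic hd R t).pow d), natDegree_X_pow,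
    (cyclotomicShifts_monic hd R t).natDegree_pow, natDegree_cyclotomicShifts hd]

theorem prod_X_sub_succ_monic (n : ℕ) : (∏ i ∈ range n, (X - C ((i : A) + 1))).Monic :=
  monic_prod_of_monic _ _ fun _ _ => monic_X_sub_C _

theorem special_monic (n : ℕ) (t : A) :
    ((X ^ 2 - C t) * ∏ i ∈ range n, (X - C ((i : A) + 1))).Monic :=
  (monic_X_pow_sub_C t two_ne_zero).mul (prod_X_sub_succ_monic n)

theorem natDegree_special [Nontrivial A] (n : ℕ) (t : A) :
    ((X ^ 2 - C t) * ∏ i ∈ range n, (X - C ((i : A) + 1))).natDegree = 2 + n := by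
  rw [(monic_X_pow_sub_C t two_ne_zero).natDegree_mul (prod_X_sub_succ_monic n),
    natDegree_X_pow_sub_C, natDegree_prod_of_monic _ _ fun _ _ => monic_X_sub_C _]
  simp only [natDegree_X_sub_C, sum_const, card_range, smul_eq_mul, mul_one]

theorem degree_genericFamily_aux [Nontrivial A] {d R n m : ℕ} (hd : d ≠ 0) (hn : 2 ≤ n)
    (hmn : m < n) (hdeg : m + d * (R * (d.totient * d)) = n) (s t : A) :
    (genericFamily d R n m s t - X ^ m * cyclotomicShifts d R t ^ d).degree < (n : WithBot ℕ) := by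
  have h1 : genericFamily d R n m s t - X ^ m * cyclotomicShifts d R t ^ d =
      - (C s * X ^ m) + C (s ^ 2) * (((X ^ 2 - C t) * ∏ i ∈ range (n - 2), (X - C ((i : A) + 1)) -
        X ^ m * cyclotomicShifts d R t ^ d) + (X ^ m + C (1 - s))) := by
    rw [genericFamily, genericCofactor]; ring
  have h2 := natDegree_genericFamily_main hd R m t
  have h3 := natDegree_special (n - 2) t
  rw [hdeg] at h2
  rw [show 2 + (n - 2) = n by omega] at h3
  have h4 := degree_eq_natDegree (genericFamily_main_monic hd R m t).ne_zero
  have h5 := degree_eq_natDegree (special_monic (n - 2) t).ne_zero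
  rw [h2] at h4
  rw [h3] at h5
  have hX : (X ^ m : A[X]).degree < n := by
    rw [degree_X_pow]; exact_mod_cast hmn
  have hC : ∀ a : A, (C a : A[X]).degree < n := fun a =>
    degree_C_le.trans_lt (by exact_mod_cast (by omega : 0 < n))
  have hmul : ∀ (a : A) {q : A[X]}, q.degree < n → (C a * q).degree < n := by
    intro a q hq
    rw [← smul_eq_C_mul]
    exact (degree_smul_le a q).trans_lt hq
  rw [h1]
  refine (degree_add_le _ _).trans_lt (max_lt ?_ (hmul _ ?_))
  · rw [degree_neg]; exact hmul _ hX
  · refine (degree_add_le _ _).trans_lt (max_lt ?_ ?_)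
    · refine (degree_sub_lt_left (h5.trans h4.symm) (special_monic _ t).ne_zero ?_).trans_eq h5
      rw [(special_monic _ t).leadingCoeff, (genericFamily_main_monic hd R m t).leadingCoeff]
    · exact (degree_add_le _ _).trans_lt (max_lt hX (hC _))

theorem genericFamily_monic {d R n m : ℕ} (hd : d ≠ 0) (hn : 2 ≤ n)
    (hmn : m < n) (hdeg : m + d * (R * (d.totient * d)) = n) (s t : A) :
    (genericFamily d R n m s t).Monic := by
  nontriviality A
  have h := (genericFamily_main_monic hd R m t).add_of_left
    ((degree_genericFamily_aux hd hn hmn hdeg s t).trans_eq (by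
      rw [degree_eq_natDegree (genericFamily_main_monic hd R m t).ne_zero,
        natDegree_genericFamily_main hd, hdeg]))
  rwa [add_sub_cancel] at h

theorem natDegree_genericFamily [Nontrivial A] {d R n m : ℕ} (hd : d ≠ 0) (hn : 2 ≤ n)
    (hmn : m < n) (hdeg : m + d * (R * (d.totient * d)) = n) (s t : A) :
    (genericFamily d R n m s t).natDegree = n := by
  have h := natDegree_add_eq_left_of_degree_lt
    ((degree_genericFamily_aux hd hn hmn hdeg s t).trans_eq (by
      rw [degree_eq_natDegree (genericFamily_main_monic hd R m t).ne_zero,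
        natDegree_genericFamily_main hd, hdeg]))
  rwa [add_sub_cancel, natDegree_genericFamily_main hd, hdeg] at h

end Family

section Multiplicity

variable {F : Type*} [Field F]

theorem rootMultiplicity_pow_eq (P : F[X]) (x : F) (n : ℕ) :
    (P ^ n).rootMultiplicity x = n * P.rootMultiplicity x := by
  classical
  rw [← count_roots, ← count_roots, roots_pow, Multiset.count_nsmul]

theorem rootMultiplicity_cyclotomicShifts {d R : ℕ} {t a : F} (hd : (d : F) ≠ 0)
    (ha : IsPrimitiveRoot (a ^ d - t) d) (ha0 : a ≠ 0)
    (hne : ∀ i < R, ∀ j < R, i ≠ j → ¬ IsPrimitiveRoot ((a + i - j) ^ d - t) d) {c : ℕ}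
    (hc : c < R) : (cyclotomicShifts d R t).rootMultiplicity (a + c) = 1 := by
  have hd0 : d ≠ 0 := by rintro rfl; simp at hd
  have : NeZero ((d : ℕ) : F) := ⟨hd⟩
  set Q : ℕ → F[X] := fun i => (cyclotomic d F).comp ((X - C (i : F)) ^ d - C t) with hQ
  have hQm : ∀ i, (Q i).Monic := fun i =>
    (cyclotomic.monic d F).comp (monic_shift_pow_sub hd0 _ t)
      (by rw [natDegree_shift_pow_sub]; exact hd0)
  have hprod : cyclotomicShifts d R t = Q c * ∏ i ∈ (range R).erase c, Q i :=
    (Finset.mul_prod_erase _ Q (mem_range.2 hc)).symm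
  have hrest : (∏ i ∈ (range R).erase c, Q i).Monic := monic_prod_of_monic _ _ fun i _ => hQm i
  have heval : ∀ i : ℕ, (Q i).eval (a + c) = (cyclotomic d F).eval ((a + c - i) ^ d - t) := by
    intro i; simp [hQ]
  rw [hprod, rootMultiplicity_mul ((hQm c).mul hrest).ne_zero]
  have h1 : (∏ i ∈ (range R).erase c, Q i).rootMultiplicity (a + c) = 0 := by
    rw [rootMultiplicity_eq_zero_iff]
    intro hroot
    rw [IsRoot.def, eval_prod, Finset.prod_eq_zero_iff] at hroot
    obtain ⟨i, hi, h0⟩ := hroot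
    rw [mem_erase, mem_range] at hi
    rw [heval] at h0
    exact absurd (isRoot_cyclotomic_iff.1 h0) (hne c hc i hi.2 hi.1.symm)
  have h0 : (Q c).IsRoot (a + c) := by
    rw [IsRoot.def, heval, add_sub_cancel_right]
    exact isRoot_cyclotomic_iff.2 ha
  have h2 : ¬ 1 < (Q c).rootMultiplicity (a + c) := by
    rw [one_lt_rootMultiplicity_iff_isRoot (hQm c).ne_zero]
    rintro ⟨-, hder⟩
    rw [IsRoot.def, hQ, derivative_comp, eval_mul] at hder
    have h4 : eval (a + c) (derivative ((X - C (c : F)) ^ d - C t)) ≠ 0 := by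
      simp [derivative_pow, hd, ha0]
    have h5 := (mul_eq_zero.1 hder).resolve_left h4
    rw [eval_comp] at h5
    simp only [eval_sub, eval_pow, eval_X, eval_C, add_sub_cancel_right] at h5
    exact (separable_cyclotomic d F).eval₂_derivative_ne_zero (RingHom.id F)
      (isRoot_cyclotomic_iff.2 ha) h5
  have h3 : 0 < (Q c).rootMultiplicity (a + c) := (rootMultiplicity_pos (hQm c).ne_zero).2 h0
  omega

theorem rootMultiplicity_genericFamily_main {d R : ℕ} {t a : F} (hd : (d : F) ≠ 0)
    (ha : IsPrimitiveRoot (a ^ d - t) d) (ha0 : a ≠ 0)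
    (hne : ∀ i < R, ∀ j < R, i ≠ j → ¬ IsPrimitiveRoot ((a + i - j) ^ d - t) d) {c : ℕ}
    (hc : c < R) (hac : a + c ≠ 0) (m : ℕ) :
    (X ^ m * cyclotomicShifts d R t ^ d).rootMultiplicity (a + c) = d := by
  have hd0 : d ≠ 0 := by rintro rfl; simp at hd
  rw [rootMultiplicity_mul (genericFamily_main_monic hd0 R m t).ne_zero,
    rootMultiplicity_pow_eq (cyclotomicShifts d R t),
    rootMultiplicity_cyclotomicShifts hd ha ha0 hne hc, mul_one, rootMultiplicity_eq_zero,
    zero_add]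
  simp [hac]

theorem card_le_rootMultiplicity_map {O : Type*} [CommRing O] [IsDomain O] (g : O →+* F)
    {P : O[X]} (hP : P.map g ≠ 0) (T : Finset O) {ρ : F} (hT : ∀ x ∈ T, P.IsRoot x)
    (hρ : ∀ x ∈ T, g x = ρ) : #T ≤ (P.map g).rootMultiplicity ρ := by
  have hP0 : P ≠ 0 := by rintro rfl; simp at hP
  rw [le_rootMultiplicity_iff hP]
  have h1 : (T.val.map fun x => X - C x).prod ∣ P := by
    rw [Multiset.prod_X_sub_C_dvd_iff_le_roots hP0, Multiset.le_iff_subset T.nodup]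
    intro x hx
    rw [mem_roots hP0]
    exact hT x hx
  have h2 := Polynomial.map_dvd g h1
  rw [← Finset.prod_eq_multiset_prod, Polynomial.map_prod] at h2
  rw [Finset.prod_congr rfl fun x hx => show (X - C x).map g = X - C ρ by
    rw [Polynomial.map_sub, map_X, map_C, hρ x hx], prod_const] at h2
  exact h2

end Multiplicity

section ResidueRoots

variable {C : Type*} [Field C] {v : Valuation C ℝ≥0}

theorem le_one_of_aeval_eq_zero {P : v.valuationSubring[X]} (hP : P.Monic) {x : C}
    (hx : aeval x P = 0) : v x ≤ 1 := by
  obtain ⟨y, hy⟩ := IsIntegrallyClosed.isIntegral_iff.1 (⟨P, hP, hx⟩ : IsIntegral v.valuationSubring x)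
  rw [← hy]
  exact y.2

theorem exists_root_residue_eq [IsAlgClosed C] {P : v.valuationSubring[X]} (hP : P.Monic)
    {ρ : resField v} (hρ : (P.map (IsLocalRing.residue _)).IsRoot ρ) :
    ∃ x : v.valuationSubring, P.IsRoot x ∧ IsLocalRing.residue _ x = ρ := by
  obtain ⟨r, rfl⟩ := IsLocalRing.residue_surjective ρ
  rw [IsRoot.def, eval_map, eval₂_hom, IsLocalRing.residue_eq_zero_iff] at hρ
  have h1 : v (aeval (r : C) P) < 1 := by
    have h2 := (ValuationSubring.valuation_lt_one_iff _ _).1 hρ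
    have h3 := (Valuation.isEquiv_valuation_valuationSubring v).symm.lt_one_iff_lt_one.1 h2
    have h4 : aeval (r : C) P = ((eval r P : v.valuationSubring) : C) :=
      aeval_algebraMap_apply_eq_algebraMap_eval (A := C) r P
    rw [h4]; exact h3
  set Q : C[X] := P.map (algebraMap v.valuationSubring C) with hQ
  have hQm : Q.Monic := hP.map _
  have hQe := (IsAlgClosed.splits Q).eq_prod_roots_of_monic hQm
  have h2 : aeval (r : C) P = (Q.roots.map fun z => (r : C) - z).prod := by
    rw [aeval_def, ← eval_map, ← hQ]
    conv_lhs => rw [hQe]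
    rw [eval_multiset_prod, Multiset.map_map]
    simp
  have h3 : ∃ z ∈ Q.roots, v ((r : C) - z) < 1 := by
    by_contra! hcon
    rw [h2, map_multiset_prod, Multiset.map_map] at h1
    refine absurd h1 (not_lt.2 (Multiset.prod_induction (fun w => 1 ≤ w) _
      (fun a b => one_le_mul_of_one_le_of_one_le) le_rfl ?_))
    intro w hw
    obtain ⟨z, hz, rfl⟩ := Multiset.mem_map.1 hw
    exact hcon z hz
  obtain ⟨z, hz, hzr⟩ := h3
  have hz0 : aeval z P = 0 := by
    rw [aeval_def, ← eval_map]
    exact isRoot_of_mem_roots hz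
  have hz1 := le_one_of_aeval_eq_zero hP hz0
  refine ⟨⟨z, hz1⟩, ?_, ?_⟩
  · have h4 : aeval z P = ((eval ⟨z, hz1⟩ P : v.valuationSubring) : C) :=
      aeval_algebraMap_apply_eq_algebraMap_eval (A := C) (⟨z, hz1⟩ : v.valuationSubring) P
    rw [hz0] at h4
    exact Subtype.ext h4.symm
  · have h5 := (res_eq_iff (x := (r : C)) (y := z) r.2 hz1).2 hzr
    rw [res_of_le r.2, res_of_le hz1] at h5
    exact h5.symm

instance [IsAlgClosed C] : IsAlgClosed (resField v) := by
  refine IsAlgClosed.of_exists_root _ fun P hP hirr => ?_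
  obtain ⟨Q, hQ, hdeg, hQm⟩ := lifts_and_natDegree_eq_and_monic
    (mem_lifts_of_surjective IsLocalRing.residue_surjective P) hP
  have h0 : (Q.map (algebraMap v.valuationSubring C)).degree ≠ 0 := by
    rw [(hQm.degree_map _), degree_eq_natDegree hQm.ne_zero, hdeg]
    exact_mod_cast hirr.natDegree_pos.ne'
  obtain ⟨z, hz⟩ := IsAlgClosed.exists_root _ h0
  rw [IsRoot.def, eval_map, ← aeval_def] at hz
  have hz1 := le_one_of_aeval_eq_zero hQm hz
  have h4 : aeval z Q = ((eval ⟨z, hz1⟩ Q : v.valuationSubring) : C) :=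
    aeval_algebraMap_apply_eq_algebraMap_eval (A := C) (⟨z, hz1⟩ : v.valuationSubring) Q
  rw [hz] at h4
  have h5 : eval ⟨z, hz1⟩ Q = 0 := Subtype.ext h4.symm
  refine ⟨IsLocalRing.residue _ ⟨z, hz1⟩, ?_⟩
  rw [← hQ, eval_map, eval₂_hom, h5, map_zero]

theorem exists_pow_eq_one_val_sub_lt [IsAlgClosed C] {N : ℕ} (hN : N ≠ 0) {u : C} (hu : v u ≤ 1)
    (hu1 : res v u ^ N = 1) : ∃ ζ : C, ζ ^ N = 1 ∧ v (u - ζ) < 1 := by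
  have hP : (X ^ N - 1 : v.valuationSubring[X]).Monic := by
    simpa using monic_X_pow_sub_C (1 : v.valuationSubring) hN
  obtain ⟨x, hx, hxu⟩ := exists_root_residue_eq hP (ρ := res v u) (by simp [hu1])
  refine ⟨x, ?_, ?_⟩
  · have := congrArg (algebraMap v.valuationSubring C) (hx : eval x _ = 0)
    simp only [eval_sub, eval_pow, eval_X, eval_one, map_sub, map_pow, map_one, map_zero] at this
    exact sub_eq_zero.1 this
  · rw [← res_eq_iff hu x.2, res_of_le x.2]
    exact hxu.symm

end ResidueRoots

namespace IsLocalValuation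

variable {k C : Type*} [Field k] [Field C] [Algebra k C] {v : Valuation C ℝ≥0} {p f : ℕ} {s : k}

theorem apply_root_eq [IsAlgClosed C] (h : IsLocalValuation k v p f s) {d : ℕ} (hd0 : d ≠ 0)
    (hdp : d < p) {ω : C} (hω : ω ^ d = algebraMap k C s) {y : C}
    (hy : v (y ^ d - algebraMap k C s) < v (algebraMap k C s)) {σ : C ≃ₐ[k] C} (hσy : σ y = y)
    (hσ : ∀ ξ : C, ξ ^ d = 1 → σ ξ = ξ) : σ ω = ω := by
  have hpd : ¬ p ∣ d := fun hd => absurd (Nat.le_of_dvd (Nat.pos_of_ne_zero hd0) hd) (by omega)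
  have hs0 : algebraMap k C s ≠ 0 := by
    rw [_root_.map_ne_zero]; exact h.uniformizer_ne
  have hω0 : ω ≠ 0 := by
    rintro rfl
    rw [zero_pow hd0] at hω
    exact hs0 hω.symm
  set u := y / ω with hu
  have hud : u ^ d - 1 = (y ^ d - algebraMap k C s) / algebraMap k C s := by
    rw [hu, div_pow, hω]; field_simp
  have hud1 : v (u ^ d - 1) < 1 := by
    rw [hud, map_div₀]
    exact (div_lt_one₀ (pos_of_ne_zero (v.ne_zero_iff.2 hs0))).2 hy
  have hvu : v u = 1 := by
    have h1 : v (u ^ d) = 1 := by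
      have := v.map_add_eq_of_lt_right (x := u ^ d - 1) (y := 1) (by rwa [map_one])
      rwa [sub_add_cancel, map_one] at this
    rw [map_pow] at h1
    exact (pow_eq_one_iff_of_nonneg zero_le hd0).1 h1
  have hru : res v u ^ d = 1 := by
    rw [← res_pow hvu.le, ← res_one, res_eq_iff (map_pow_le_one hvu.le d) v.map_one.le]
    exact hud1
  obtain ⟨ζ, hζ, hζu⟩ := exists_pow_eq_one_val_sub_lt hd0 hvu.le hru
  have hσu : v (u - σ u) < 1 := by
    have h1 : u - σ u = (u - ζ) - σ (u - ζ) := by rw [map_sub, hσ ζ hζ]; ring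
    rw [h1]
    exact (v.map_sub _ _).trans_lt (max_lt hζu (by rwa [h.map_algEquiv]))
  have hvσu : v (σ u) = 1 := by rw [h.map_algEquiv, hvu]
  have hσω : σ ω / ω - 1 = (u - σ u) / σ u := by
    have hσω0 : σ ω ≠ 0 := by rwa [_root_.map_ne_zero]
    have hy0 : y ≠ 0 := by
      rintro h0
      rw [hu, h0, zero_div, map_zero] at hvu
      exact zero_ne_one hvu
    rw [hu, map_div₀, hσy]
    field_simp
  have h1 : σ ω / ω = 1 := by
    refine h.eq_of_pow_eq_one hpd ?_ (one_pow d) ?_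
    · rw [div_pow, ← map_pow, hω, AlgEquiv.commutes, div_self hs0]
    · rw [hσω, map_div₀, hvσu, div_one]; exact hσu
  exact (div_eq_one_iff_eq hω0).1 h1

end IsLocalValuation

namespace IsLocalValuation

variable {k C : Type*} [Field k] [Field C] [Algebra k C] {v : Valuation C ℝ≥0} {p f : ℕ} {s : k}

theorem val_eval_cyclotomicShifts_lt (h : IsLocalValuation k v p f s) {d R n m : ℕ} {t : k}
    (ht : v (algebraMap k C t) ≤ 1) {x : C} (hx : v x = 1)
    (hroot : (genericFamily d R n m (algebraMap k C s) (algebraMap k C t)).IsRoot x) :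
    v (eval x (cyclotomicShifts d R (algebraMap k C t)) ^ d - algebraMap k C s) <
      v (algebraMap k C s) := by
  have hs1 : v (algebraMap k C s) ≤ 1 := h.uniformizer_lt.le
  have hs0 : algebraMap k C s ≠ 0 := by
    rw [_root_.map_ne_zero]; exact h.uniformizer_ne
  set E := eval x (genericCofactor d R n m (algebraMap k C s) (algebraMap k C t)) with hE
  have hE1 : v E ≤ 1 := by
    let s' : v.valuationSubring := ⟨_, hs1⟩
    let t' : v.valuationSubring := ⟨_, ht⟩
    let x' : v.valuationSubring := ⟨x, hx.le⟩
    have h1 := genericCofactor_map d R n m s' t' (algebraMap v.valuationSubring C)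
    have h2 : E = algebraMap v.valuationSubring C (eval x' (genericCofactor d R n m s' t')) := by
      rw [hE, ← eval₂_at_apply, ← eval_map, h1]
      rfl
    rw [h2]
    exact (eval x' (genericCofactor d R n m s' t')).2
  rw [IsRoot.def, genericFamily, eval_add, eval_mul, eval_mul, eval_pow, eval_sub, eval_pow,
    eval_X, eval_C, eval_C, ← hE, add_eq_zero_iff_eq_neg] at hroot
  have h3 := congrArg v hroot
  rw [map_mul, map_pow, hx, one_pow, one_mul, Valuation.map_neg, map_mul, map_pow] at h3
  rw [h3]
  have hpos := pos_of_ne_zero (v.ne_zero_iff.2 hs0)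
  calc v (algebraMap k C s) ^ 2 * v E ≤ v (algebraMap k C s) ^ 2 * 1 := by gcongr
    _ = v (algebraMap k C s) * v (algebraMap k C s) := by ring
    _ < v (algebraMap k C s) * 1 := by
      exact mul_lt_mul_of_pos_left h.uniformizer_lt hpos
    _ = _ := mul_one _

theorem map_eval_cyclotomicShifts {d R : ℕ} {t : k} (σ : C ≃ₐ[k] C) (x : C) :
    σ (eval x (cyclotomicShifts d R (algebraMap k C t))) =
      eval (σ x) (cyclotomicShifts d R (algebraMap k C t)) := by
  rw [← cyclotomicShifts_map, eval_map_algebraMap, eval_map_algebraMap]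
  exact (aeval_algHom_apply σ x _).symm

theorem isRoot_genericFamily_map {d R n m : ℕ} {t : k} (σ : C ≃ₐ[k] C) {x : C}
    (hx : (genericFamily d R n m (algebraMap k C s) (algebraMap k C t)).IsRoot x) :
    (genericFamily d R n m (algebraMap k C s) (algebraMap k C t)).IsRoot (σ x) := by
  rw [← genericFamily_map, IsRoot.def, eval_map_algebraMap] at hx ⊢
  rw [← AlgEquiv.coe_toAlgHom, aeval_algHom_apply, hx, map_zero]

theorem card_le_rootMultiplicity_genericFamily_res {d R n m : ℕ} (hd0 : d ≠ 0)
    (hn : 2 ≤ n) (hmn : m < n) (hdeg : m + d * (R * (d.totient * d)) = n) {a b : C}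
    (ha : v a ≤ 1) (hb : v b ≤ 1) {ρ : resField v} (S : Finset C) (hS1 : ∀ x ∈ S, v x ≤ 1)
    (hS : ∀ x ∈ S, (genericFamily d R n m a b).IsRoot x) (hSr : ∀ x ∈ S, res v x = ρ) :
    #S ≤ (genericFamily d R n m (res v a) (res v b)).rootMultiplicity ρ := by
  classical
  set g := IsLocalRing.residue v.valuationSubring
  have hm1 := genericFamily_map d R n m ⟨a, ha⟩ ⟨b, hb⟩ (algebraMap v.valuationSubring C)
  have hm2 := genericFamily_map d R n m ⟨a, ha⟩ ⟨b, hb⟩ g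
  rw [← res_of_le ha, ← res_of_le hb] at hm2
  have hmon := genericFamily_monic hd0 hn hmn hdeg (⟨a, ha⟩ : v.valuationSubring) ⟨b, hb⟩
  let T : Finset v.valuationSubring := S.attach.image fun x => ⟨x.1, hS1 x.1 x.2⟩
  have hT : #T = #S := by
    rw [card_image_of_injective, card_attach]
    exact fun x y hxy => Subtype.ext (congrArg (fun z : v.valuationSubring => (z : C)) hxy)
  rw [← hT, ← hm2]
  refine card_le_rootMultiplicity_map g (hmon.map g).ne_zero T ?_ ?_
  · intro x hx
    obtain ⟨y, -, rfl⟩ := mem_image.1 hx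
    have h1 := hS y.1 y.2
    have h2 := aeval_algebraMap_apply_eq_algebraMap_eval (A := C)
      (⟨y.1, hS1 y.1 y.2⟩ : v.valuationSubring) (genericFamily d R n m ⟨a, ha⟩ ⟨b, hb⟩)
    rw [← eval_map_algebraMap, hm1] at h2
    exact Subtype.ext (h2.symm.trans h1)
  · intro x hx
    obtain ⟨y, -, rfl⟩ := mem_image.1 hx
    rw [← hSr y.1 y.2, res_of_le (hS1 y.1 y.2)]

section Fiber

variable {d R n m : ℕ} {t : k} {a : C} {c : ℕ}

theorem card_fiber_le (h : IsLocalValuation k v p f s) [Fact p.Prime] (hd0 : d ≠ 0) (hdp : d < p)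
    (hn : 2 ≤ n) (hmn : m < n) (hdeg : m + d * (R * (d.totient * d)) = n)
    (ht : v (algebraMap k C t) ≤ 1)
    (htq : res v (algebraMap k C t) ^ p ^ f = res v (algebraMap k C t))
    (ha : IsPrimitiveRoot (res v a ^ d - res v (algebraMap k C t)) d) (ha0 : res v a ≠ 0)
    (hi0 : ∀ i < R, res v a + i ≠ 0)
    (hne : ∀ i < R, ∀ j < R, i ≠ j →
      ¬ IsPrimitiveRoot ((res v a + i - j) ^ d - res v (algebraMap k C t)) d)
    (hc : c < R) (j : ℕ) (S : Finset C) (hS1 : ∀ x ∈ S, v x ≤ 1)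
    (hS : ∀ x ∈ S, (genericFamily d R n m (algebraMap k C s) (algebraMap k C t)).IsRoot x)
    (hSr : ∀ x ∈ S, res v x = (res v a + c) ^ (p ^ f) ^ j) : #S ≤ d := by
  classical
  have hchar := h.charP_res
  have hdF : (d : resField v) ≠ 0 := by
    rw [Ne, CharP.cast_eq_zero_iff (resField v) p]
    exact fun hd => absurd (Nat.le_of_dvd (Nat.pos_of_ne_zero hd0) hd) (by omega)
  have hmult : (genericFamily d R n m 0 (res v (algebraMap k C t))).rootMultiplicity
      (res v a + c) = d := by
    have : genericFamily d R n m 0 (res v (algebraMap k C t)) =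
        X ^ m * cyclotomicShifts d R (res v (algebraMap k C t)) ^ d := by
      simp [genericFamily]
    rw [this]
    exact rootMultiplicity_genericFamily_main hdF ha ha0 hne hc (hi0 c hc) m
  have hfrob : (genericFamily d R n m 0 (res v (algebraMap k C t))).rootMultiplicity
      ((res v a + c) ^ (p ^ f) ^ j) = d := by
    have htj : ∀ i : ℕ, res v (algebraMap k C t) ^ (p ^ f) ^ i = res v (algebraMap k C t) := by
      intro i
      induction i with
      | zero => simp
      | succ i ih => rw [pow_succ, pow_mul, ih, htq]
    have h1 := eq_rootMultiplicity_map (p := genericFamily d R n m 0 (res v (algebraMap k C t)))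
      (iterateFrobenius_inj (resField v) p (f * j)) (res v a + c)
    rw [hmult, genericFamily_map, map_zero] at h1
    simp only [iterateFrobenius_def, pow_mul p f j, htj] at h1
    exact h1.symm
  have hs : res v (algebraMap k C s) = 0 := (res_eq_zero h.uniformizer_lt.le).2 h.uniformizer_lt
  refine (card_le_rootMultiplicity_genericFamily_res hd0 hn hmn hdeg h.uniformizer_lt.le ht S hS1
    hS hSr).trans_eq ?_
  rw [hs, hfrob]

theorem card_orbit_eq (h : IsLocalValuation k v p f s) [Fact p.Prime]
    (hd0 : d ≠ 0) (hdp : d < p)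
    (hn : 2 ≤ n) (hmn : m < n) (hdeg : m + d * (R * (d.totient * d)) = n)
    (ht : v (algebraMap k C t) ≤ 1)
    (htq : res v (algebraMap k C t) ^ p ^ f = res v (algebraMap k C t)) (hav : v a ≤ 1)
    (ha : IsPrimitiveRoot (res v a ^ d - res v (algebraMap k C t)) d) (ha0 : res v a ≠ 0)
    (hi0 : ∀ i < R, res v a + i ≠ 0)
    (hne : ∀ i < R, ∀ j < R, i ≠ j →
      ¬ IsPrimitiveRoot ((res v a + i - j) ^ d - res v (algebraMap k C t)) d)
    (hc : c < R) {N : ℕ} (hN : N ≠ 0) (haN : res v a ^ (p ^ f) ^ N = res v a) {ω : C}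
    (hσa : ∀ σ : C ≃ₐ[k] C, ∃ j, v (σ a - a ^ (p ^ f) ^ j) < 1)
    {g : Fin N × Fin d → (C ≃ₐ[k] C)}
    (hg : ∀ u u', v (g u a - g u' a) < 1 → g u ω = g u' ω → u = u')
    {x : C} (hxv : v x ≤ 1) (hxa : res v x = res v a + c)
    (hx : (genericFamily d R n m (algebraMap k C s) (algebraMap k C t)).IsRoot x)
    (hfix : ∀ σ : C ≃ₐ[k] C, σ x = x → v (σ a - a) < 1 ∧ σ ω = ω) :
    Nat.card (MulAction.orbit (C ≃ₐ[k] C) x) = N * d := by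
  classical
  have hchar := h.charP_res
  have hmon := genericFamily_monic hd0 hn hmn hdeg (algebraMap k C s) (algebraMap k C t)
  have hroot : ∀ y ∈ MulAction.orbit (C ≃ₐ[k] C) x,
      (genericFamily d R n m (algebraMap k C s) (algebraMap k C t)).IsRoot y := by
    rintro _ ⟨σ, rfl⟩
    exact isRoot_genericFamily_map σ hx
  have hfin : (MulAction.orbit (C ≃ₐ[k] C) x).Finite :=
    ((genericFamily d R n m (algebraMap k C s) (algebraMap k C t)).roots.toFinset.finite_toSet).subset
      fun y hy => by simpa [hmon.ne_zero] using hroot y hy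
  rw [Nat.card_coe_set_eq, Set.ncard_eq_toFinset_card _ hfin]
  refine le_antisymm ?_ ?_
  · have hcov : ∀ y ∈ hfin.toFinset, v y ≤ 1 ∧ ∃ j < N, res v y = (res v a + c) ^ (p ^ f) ^ j := by
      intro y hy
      obtain ⟨σ, rfl⟩ := hfin.mem_toFinset.1 hy
      have hy1 : v (σ x) ≤ 1 := h.map_sub_le_one σ hxv
      refine ⟨hy1, ?_⟩
      obtain ⟨j, hj⟩ := hσa σ
      have hcv : v (c : C) ≤ 1 := map_natCast_le_one c
      have h1 : res v (σ x) = res v (σ (a + c)) := by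
        have h2 : v (x - (a + c)) < 1 := by
          rw [← res_eq_iff hxv (v.map_add_le hav hcv), res_add hav hcv, res_natCast, hxa]
        rw [res_eq_iff hy1 (h.map_sub_le_one σ (v.map_add_le hav hcv)), ← map_sub,
          h.map_algEquiv]
        exact h2
      have h3 : res v (σ (a + c)) = res v a ^ (p ^ f) ^ j + c := by
        rw [map_add, _root_.map_natCast, res_add (h.map_sub_le_one σ hav) hcv, res_natCast,
          (res_eq_iff (h.map_sub_le_one σ hav) (map_pow_le_one hav _)).2 hj, res_pow hav]
      have hiter : ∀ i, res v a ^ (p ^ f) ^ i = (iterateFrobenius (resField v) p f)^[i] (res v a) := by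
        intro i
        rw [← iterateFrobenius_mul_apply, iterateFrobenius_def, pow_mul]
      have hper : Function.IsPeriodicPt (iterateFrobenius (resField v) p f) N (res v a) := by
        rw [Function.IsPeriodicPt, Function.IsFixedPt, ← hiter, haN]
      have hmod : res v a ^ (p ^ f) ^ j = res v a ^ (p ^ f) ^ (j % N) := by
        rw [hiter, hiter, hper.iterate_mod_apply]
      refine ⟨j % N, Nat.mod_lt _ (Nat.pos_of_ne_zero hN), ?_⟩
      have hcj : (c : resField v) ^ (p ^ f) ^ (j % N) = c := by
        rw [← pow_mul, ← iterateFrobenius_def, _root_.map_natCast]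
      change res v (σ x) = _
      rw [h1, h3, hmod, ← pow_mul p f, add_pow_char_pow, pow_mul p f, hcj]
    have himg : hfin.toFinset.image (res v) ⊆
        (range N).image fun j => (res v a + c) ^ (p ^ f) ^ j := by
      intro ρ hρ
      obtain ⟨y, hy, rfl⟩ := mem_image.1 hρ
      obtain ⟨-, j, hj, hyj⟩ := hcov y hy
      exact mem_image.2 ⟨j, mem_range.2 hj, hyj.symm⟩
    have hcard : #(hfin.toFinset.image (res v)) ≤ N :=
      (card_le_card himg).trans (card_image_le.trans_eq (card_range N))
    rw [mul_comm]
    refine (card_le_mul_card_image hfin.toFinset d fun ρ hρ => ?_).trans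
      (Nat.mul_le_mul_left d hcard)
    obtain ⟨j, -, rfl⟩ := mem_image.1 (himg hρ)
    refine h.card_fiber_le hd0 hdp hn hmn hdeg ht htq ha ha0 hi0 hne hc j _ ?_ ?_ ?_
    · exact fun y hy => (hcov y (mem_filter.1 hy).1).1
    · exact fun y hy => hroot y (hfin.mem_toFinset.1 (mem_filter.1 hy).1)
    · exact fun y hy => (mem_filter.1 hy).2
  · have hinj : Function.Injective fun u => g u x := by
      intro u u' huu
      have h1 := hfix ((g u')⁻¹ * g u) (by
        rw [AlgEquiv.mul_apply, show g u x = g u' x from huu]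
        exact (g u').symm_apply_apply x)
      refine hg u u' ?_ ?_
      · rw [← h.map_algEquiv (g u')⁻¹, map_sub]
        have h2 : (g u')⁻¹ (g u' a) = a := (g u').symm_apply_apply a
        rw [h2]
        exact h1.1
      · have h2 := congrArg (g u') h1.2
        rw [AlgEquiv.mul_apply] at h2
        exact ((g u').apply_symm_apply _).symm.trans h2
    have h1 : #(univ.image fun u => g u x) = N * d := by
      rw [card_image_of_injective _ hinj, card_univ, Fintype.card_prod, Fintype.card_fin,
        Fintype.card_fin]
    rw [← h1]
    refine card_le_card fun y hy => ?_
    obtain ⟨u, -, rfl⟩ := mem_image.1 hy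
    exact hfin.mem_toFinset.2 ⟨g u, rfl⟩

end Fiber

theorem exists_labelling [IsAlgClosure k C] [CharZero k] (h : IsLocalValuation k v p f s)
    [Fact p.Prime] {G : Type*} [Group G] [Finite G] {d R n m : ℕ} (hd : 2 ≤ d)
    (hGd : Nat.card G ∣ d) (hGR : Nat.card G * d.totient ≤ R) (hn : 2 ≤ n) (hmn : m < n)
    (hdeg : m + d * (R * (d.totient * d)) = n) (hp : residueBound d R < p) :
    ∃ t₀ : k, v (algebraMap k C t₀) ≤ 1 ∧ ∀ t : k, v (algebraMap k C t - algebraMap k C t₀) < 1 →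
      ∀ (L : IntermediateField k C) [FiniteDimensional k L] [Normal k L] (φ : (C ≃ₐ[k] C) →* G),
      (∀ σ, φ σ = 1 ↔ ∀ x ∈ L, σ x = x) →
      ∃ z : G × Fin (d.totient * d * d) → C, Function.Injective z ∧
        (∀ u, (genericFamily d R n m (algebraMap k C s) (algebraMap k C t)).IsRoot (z u)) ∧
        ∀ (σ : C ≃ₐ[k] C) (g : G) (y), ∃ y', σ (z (g, y)) = z (φ σ * g, y') := by
  classical
  have hCalg : IsAlgClosed C := IsAlgClosure.isAlgClosed k
  have hchar := h.charP_res
  have hd0 : d ≠ 0 := by omega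
  have hdp : d < p := by simp only [residueBound] at hp; omega
  obtain ⟨tb, ab, k₀, htb, hk₀d, hk₀0, hk₀, hab, habmin, hprim, hab0, habi, habij⟩ :=
    exists_good_residue (F := resField v) (p := p) h.ne_zero hd hp
  have hN : k₀ * d ≠ 0 := mul_ne_zero hk₀0 hd0
  have hq1 : 1 < (p ^ f) ^ (k₀ * d) :=
    Nat.one_lt_pow hN (Nat.one_lt_pow h.ne_zero (Fact.out : p.Prime).one_lt)
  obtain ⟨u, hu, hua⟩ := exists_res_eq (v := v) ab
  obtain ⟨a, ha1, hau⟩ := exists_pow_eq_one_val_sub_lt (v := v) (N := (p ^ f) ^ (k₀ * d) - 1)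
    (by omega) hu (by
      rw [hua]
      refine mul_right_cancel₀ hab0 ?_
      rw [← pow_succ, Nat.sub_add_cancel hq1.le, hab, one_mul])
  have hav : v a ≤ 1 := by
    have h1 : v a ^ ((p ^ f) ^ (k₀ * d) - 1) = 1 := by rw [← map_pow, ha1, map_one]
    exact ((pow_eq_one_iff_of_nonneg zero_le (by omega)).1 h1).le
  have hra : res v a = ab := by rw [← hua, ((res_eq_iff hu hav).2 hau)]
  rw [← hra] at hab habmin hprim hab0 habi habij
  obtain ⟨tl, htl, htlb⟩ := exists_res_eq (v := v) tb
  obtain ⟨t₀, ht₀⟩ := h.exists_lift tl htl (by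
    rw [← res_eq_iff (map_pow_le_one htl _) htl, res_pow htl, htlb, htb])
  have ht₀1 : v (algebraMap k C t₀) ≤ 1 := by
    have := v.map_sub_le htl ht₀.le
    rwa [sub_sub_cancel] at this
  have ht₀b : res v (algebraMap k C t₀) = tb := by
    rw [← htlb, (res_eq_iff htl ht₀1).2 ht₀]
  refine ⟨t₀, ht₀1, fun t ht L _ _ φ hφ => ?_⟩
  have ht1 : v (algebraMap k C t) ≤ 1 := by
    have := v.map_add_le ht.le ht₀1
    rwa [sub_add_cancel] at this
  have htr : res v (algebraMap k C t) = tb := by rw [(res_eq_iff ht1 ht₀1).2 ht, ht₀b]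
  rw [← htr] at hprim habij htb
  obtain ⟨ω, hω⟩ := IsAlgClosed.exists_pow_nat_eq (algebraMap k C s) (Nat.pos_of_ne_zero hd0)
  obtain ⟨hfixL, hfixζ, hσa, g, hg⟩ := h.tame_absolute hd0 hk₀0 hdp hk₀ hω ha1
    (fun i hi => habmin i (by
      rw [← res_pow hav, (res_eq_iff (map_pow_le_one hav _) hav).2 hi])) L
    (fun σ => (hφ (σ ^ d)).1 (by
      rw [map_pow]
      obtain ⟨e, he⟩ := hGd
      rw [he, pow_mul, pow_card_eq_one', one_pow]))
  have hroots : ∀ c < R, ∃ x : C, v x ≤ 1 ∧ res v x = res v a + c ∧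
      (genericFamily d R n m (algebraMap k C s) (algebraMap k C t)).IsRoot x := by
    intro c hc
    let s' : v.valuationSubring := ⟨_, h.uniformizer_lt.le⟩
    let t' : v.valuationSubring := ⟨_, ht1⟩
    have hs' : IsLocalRing.residue v.valuationSubring s' = 0 := by
      rw [← res_of_le h.uniformizer_lt.le, res_eq_zero h.uniformizer_lt.le]
      exact h.uniformizer_lt
    have ht' : IsLocalRing.residue v.valuationSubring t' = res v (algebraMap k C t) :=
      (res_of_le ht1).symm
    obtain ⟨x, hx, hxr⟩ := exists_root_residue_eq (genericFamily_monic hd0 hn hmn hdeg s' t')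
      (ρ := res v a + c) (by
        rw [genericFamily_map, hs', ht', IsRoot.def, genericFamily, cyclotomicShifts,
          ← Finset.mul_prod_erase _ _ (mem_range.2 hc)]
        simp only [eval_add, eval_mul, eval_sub, eval_pow, eval_comp, eval_X, eval_C,
          add_sub_cancel_right, (hprim.isRoot_cyclotomic (Nat.pos_of_ne_zero hd0)).eq_zero]
        simp [hd0])
    refine ⟨x, x.2, by rw [res_of_le x.2]; exact hxr, ?_⟩
    have h2 := aeval_algebraMap_apply_eq_algebraMap_eval (A := C) x (genericFamily d R n m s' t')
    rw [← eval_map_algebraMap, genericFamily_map, hx.eq_zero, map_zero] at h2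
    exact h2
  choose! x hxv hxr hxroot using hroots
  have hxfix : ∀ c < R, ∀ σ : C ≃ₐ[k] C, σ (x c) = x c → v (σ a - a) < 1 ∧ σ ω = ω := by
    intro c hc σ hσ
    have hcv : v (c : C) ≤ 1 := map_natCast_le_one c
    have hxac : v (x c - (a + c)) < 1 := by
      rw [← res_eq_iff (hxv c hc) (v.map_add_le hav hcv), res_add hav hcv, res_natCast, hxr c hc]
    have h1 : v (σ a - a) < 1 := by
      have h2 : σ a - a = (x c - (a + c)) - σ (x c - (a + c)) := by
        rw [map_sub, map_add, hσ, _root_.map_natCast]; ring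
      rw [h2]
      exact (v.map_sub _ _).trans_lt (max_lt hxac (by rwa [h.map_algEquiv]))
    have hvx : v (x c) = 1 := by
      rw [← res_ne_zero (hxv c hc), hxr c hc]
      exact habi c hc
    exact ⟨h1, h.apply_root_eq hd0 hdp hω
      (h.val_eval_cyclotomicShifts_lt ht1 hvx (hxroot c hc))
      (by rw [map_eval_cyclotomicShifts, hσ]) (hfixζ σ h1)⟩
  obtain ⟨r, hr⟩ := hk₀d
  obtain ⟨e⟩ : Nonempty (G × Fin r ↪ Fin R) := by
    have := Fintype.ofFinite G
    refine Function.Embedding.nonempty_of_card_le ?_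
    rw [Fintype.card_prod, Fintype.card_fin, Fintype.card_fin, ← Nat.card_eq_fintype_card]
    refine le_trans (Nat.mul_le_mul_left _ ?_) hGR
    rw [hr]
    exact Nat.le_mul_of_pos_left r (Nat.pos_of_ne_zero hk₀0)
  have key := exists_equivariant_labelling φ (r := r) (mul_ne_zero hN hd0)
    (fun i => x (e i)) ?_ ?_ ?_
  · rw [show r * (k₀ * d * d) = d.totient * d * d by rw [hr]; ring] at key
    obtain ⟨z, hz, hzx, hzσ⟩ := key
    refine ⟨z, hz, fun w => ?_, hzσ⟩
    obtain ⟨i, σ, hw⟩ := hzx w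
    rw [hw]
    exact isRoot_genericFamily_map σ (hxroot _ (e i).2)
  · rintro i j ⟨σ, hσ⟩
    by_contra hij
    have hcc : ((e i : Fin R) : ℕ) ≠ e j := fun hc => hij (e.injective (Fin.ext hc))
    set c : ℕ := ((e i : Fin R) : ℕ) with hc
    set c' : ℕ := ((e j : Fin R) : ℕ) with hc'
    have hcR : c < R := (e i).2
    have hcR' : c' < R := (e j).2
    have hcv : v (c : C) ≤ 1 := map_natCast_le_one c
    have hcv' : v (c' : C) ≤ 1 := map_natCast_le_one c'
    obtain ⟨l, hl⟩ := hσa σ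
    have hσav : v (σ a) ≤ 1 := h.map_sub_le_one σ hav
    have hσr : res v (σ a) = res v a ^ (p ^ f) ^ l := by
      rw [(res_eq_iff hσav (map_pow_le_one hav _)).2 hl, res_pow hav]
    have hσa' : res v (σ a) = res v a + c - c' := by
      have h1 : v (a + c' - x c') < 1 := by
        rw [← res_eq_iff (v.map_add_le hav hcv') (hxv c' hcR'), res_add hav hcv', res_natCast,
          hxr c' hcR']
      have h2 : σ a - (x c - c') = σ (a + c' - x c') := by
        rw [map_sub, map_add, _root_.map_natCast, show σ (x c') = x c from hσ]; ring
      rw [← hxr c hcR, ← res_natCast (v := v) c', ← res_sub (hxv c hcR) hcv',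
        res_eq_iff hσav (v.map_sub_le (hxv c hcR) hcv'), h2, h.map_algEquiv]
      exact h1
    refine habij c hcR c' hcR' hcc ?_
    have htl : ∀ i : ℕ, res v (algebraMap k C t) ^ (p ^ f) ^ i = res v (algebraMap k C t) := by
      intro i
      induction i with
      | zero => simp
      | succ i ih => rw [pow_succ, pow_mul, ih, htb]
    have h3 := hprim.map_of_injective (iterateFrobenius_inj (resField v) p (f * l))
    rw [map_sub, map_pow, iterateFrobenius_def, iterateFrobenius_def, pow_mul p f, htl, ← hσr,
      hσa'] at h3
    exact h3
  · intro i σ hσ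
    obtain ⟨h1, h2⟩ := hxfix _ (e i).2 σ hσ
    exact (hφ σ).2 (hfixL σ h2 h1)
  · intro i
    exact h.card_orbit_eq hd0 hdp hn hmn hdeg ht1 htb hav hprim hab0 habi habij (e i).2 hN hab
      hσa hg (hxv _ (e i).2) (hxr _ (e i).2) (hxroot _ (e i).2) (hxfix _ (e i).2)

end IsLocalValuation

section SpectralValuation

variable (k C : Type*) [NontriviallyNormedField k] [IsUltrametricDist k] [CompleteSpace k]
  [Field C] [Algebra k C] [Algebra.IsAlgebraic k C]

/-- The unique extension of the absolute value of `k` to `C`, as a valuation. -/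
noncomputable def spectralValuation : Valuation C ℝ≥0 where
  toFun x := ⟨spectralNorm k C x, spectralNorm_nonneg x⟩
  map_zero' := NNReal.eq spectralNorm_zero
  map_one' := NNReal.eq spectralNorm_one
  map_mul' x y := NNReal.eq (spectralAlgNorm_mul x y)
  map_add_le_max' x y := isNonarchimedean_spectralNorm x y

variable {k C}

theorem spectralValuation_algebraMap (x : k) :
    spectralValuation k C (algebraMap k C x) = ‖x‖₊ := NNReal.eq (spectralNorm_extends x)

theorem isLocalValuation_spectralValuation {p f : ℕ} [Fact p.Prime] (hf : f ≠ 0) {s : k}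
    (hs0 : s ≠ 0) (hs1 : ‖s‖ < 1) (hz : ∀ x : k, x ≠ 0 → ∃ n : ℤ, ‖x‖ = ‖s‖ ^ n)
    (hp : ‖(p : k)‖ < 1) (hpow : ∀ x : k, ‖x‖ ≤ 1 → ‖x ^ p ^ f - x‖ < 1) (S : Finset k)
    (hS : #S = p ^ f) (hS1 : ∀ x ∈ S, ‖x‖ ≤ 1)
    (hSne : ∀ x ∈ S, ∀ y ∈ S, ‖x - y‖ < 1 → x = y) :
    IsLocalValuation k (spectralValuation k C) p f s where
  map_algEquiv σ x := NNReal.eq (spectralNorm_eq_of_equiv σ x).symm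
  uniformizer_lt := by rw [spectralValuation_algebraMap]; exact_mod_cast hs1
  uniformizer_ne := hs0
  exists_zpow x hx := by
    obtain ⟨n, hn⟩ := hz x hx
    refine ⟨n, ?_⟩
    rw [spectralValuation_algebraMap, spectralValuation_algebraMap]
    exact NNReal.eq (by push_cast; exact hn)
  pow_card x hx := by
    rw [spectralValuation_algebraMap] at hx
    rw [← map_pow, ← map_sub, spectralValuation_algebraMap]
    exact_mod_cast hpow x (by exact_mod_cast hx)
  exists_lift x hx hxp := by
    set v := spectralValuation k C
    have hkey : res v x ^ p ^ f = res v x := by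
      rw [← res_pow hx, res_eq_iff (map_pow_le_one hx _) hx]; exact hxp
    have hSv : ∀ y ∈ S, v (algebraMap k C y) ≤ 1 := fun y hy => by
      rw [spectralValuation_algebraMap]
      exact_mod_cast hS1 y hy
    have hinj : Set.InjOn (fun y => res v (algebraMap k C y)) S := by
      intro y hy z hz hyz
      refine hSne y hy z hz ?_
      have h1 := (res_eq_iff (hSv y hy) (hSv z hz)).1 hyz
      rw [← map_sub, spectralValuation_algebraMap] at h1
      exact_mod_cast h1
    have hq : 1 < p ^ f := Nat.one_lt_pow hf (Fact.out : p.Prime).one_lt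
    have hdeg : (X ^ p ^ f - X : (resField v)[X]).natDegree = p ^ f := by
      rw [natDegree_sub_eq_left_of_natDegree_lt] <;> simp [hq]
    have h0 := FiniteField.X_pow_card_sub_X_ne_zero (resField v) hq
    classical
    have hsub : S.image (fun y => res v (algebraMap k C y)) ⊆
        (X ^ p ^ f - X : (resField v)[X]).roots.toFinset := by
      intro ρ hρ
      obtain ⟨y, hy, rfl⟩ := mem_image.1 hρ
      have h1 : res v (algebraMap k C y) ^ p ^ f = res v (algebraMap k C y) := by
        rw [← res_pow (hSv y hy), res_eq_iff (map_pow_le_one (hSv y hy) _) (hSv y hy),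
          ← map_pow, ← map_sub, spectralValuation_algebraMap]
        exact_mod_cast hpow y (hS1 y hy)
      simp [h0, h1]
    have heq := eq_of_subset_of_card_le hsub (by
      rw [card_image_of_injOn hinj, hS]
      exact (Multiset.toFinset_card_le _).trans ((card_roots' _).trans_eq hdeg))
    have hx' : res v x ∈ (X ^ p ^ f - X : (resField v)[X]).roots.toFinset := by simp [h0, hkey]
    rw [← heq] at hx'
    obtain ⟨t, ht, htx⟩ := mem_image.1 hx'
    exact ⟨t, (res_eq_iff hx (hSv t ht)).1 htx.symm⟩
  map_natCast n hn := by
    set v := spectralValuation k C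
    have hpv : v (p : C) < 1 := by
      rw [← map_natCast (algebraMap k C), spectralValuation_algebraMap]
      exact_mod_cast hp
    refine le_antisymm (map_natCast_le_one n) (not_lt.1 fun hlt => ?_)
    have hcop : Nat.Coprime p n := ((Fact.out : p.Prime).coprime_iff_not_dvd).2 hn
    have h1 : res v ((p : C)) = 0 := (res_eq_zero (map_natCast_le_one p)).2 hpv
    have h2 : res v ((n : C)) = 0 := (res_eq_zero (map_natCast_le_one n)).2 hlt
    rw [res_natCast] at h1 h2
    have h3 : IsCoprime (p : resField v) (n : resField v) := hcop.cast
    rw [h1, h2, isCoprime_zero_left] at h3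
    exact not_isUnit_zero h3
  map_prime := by
    rw [← map_natCast (algebraMap k C), spectralValuation_algebraMap]
    exact_mod_cast hp
  ne_zero := hf

end SpectralValuation

section TranscendentalPoints

theorem exists_norm_sub_lt_notMem_of_countable {k : Type*} [NontriviallyNormedField k]
    [CompleteSpace k] {S : Set k} (hS : S.Countable) (x : k) {ε : ℝ} (hε : 0 < ε) :
    ∃ y, ‖y - x‖ < ε ∧ y ∉ S := by
  have h := continuum_le_cardinal_of_isOpen k (Metric.isOpen_ball (x := x) (ε := ε))
    ⟨x, Metric.mem_ball_self hε⟩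
  by_contra! hcon
  have hsub : Metric.ball x ε ⊆ S := fun y hy => hcon y (by rwa [← dist_eq_norm])
  have h1 := Cardinal.le_aleph0_iff_set_countable.2 (hS.mono hsub)
  exact absurd (h.trans h1) (not_le.2 Cardinal.aleph0_lt_continuum)

theorem exists_transcendental_norm_sub_lt (A : Type*) {k : Type*} [NontriviallyNormedField k]
    [CompleteSpace k] [CommRing A] [Countable A] [IsDomain A] [Algebra A k]
    [Module.IsTorsionFree A k] (x : k) {ε : ℝ} (hε : 0 < ε) :
    ∃ y, ‖y - x‖ < ε ∧ Transcendental A y :=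
  exists_norm_sub_lt_notMem_of_countable (Algebraic.countable A k) x hε

theorem exists_algebraicIndependent_norm_sub_lt (A : Type*) {k : Type*}
    [NontriviallyNormedField k] [CompleteSpace k] [Field A] [Countable A] [Algebra A k]
    {s : k} (hs : Transcendental A s) (x : k) {ε : ℝ} (hε : 0 < ε) :
    ∃ y, ‖y - x‖ < ε ∧ AlgebraicIndependent A ![s, y] := by
  have : Countable (Algebra.adjoin A {s}) := by
    have h : Function.Surjective (fun p : A[X] =>
        (⟨aeval s p, aeval_mem_adjoin_singleton A s⟩ : Algebra.adjoin A {s})) := by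
      rintro ⟨z, hz⟩
      rw [Algebra.adjoin_singleton_eq_range_aeval] at hz
      obtain ⟨p, rfl⟩ := hz
      exact ⟨p, rfl⟩
    have : Countable A[X] := Cardinal.mk_le_aleph0_iff.1
      (Polynomial.cardinalMk_le_max.trans (max_le Cardinal.mk_le_aleph0 le_rfl))
    exact h.countable
  obtain ⟨y, hy, hty⟩ := exists_transcendental_norm_sub_lt (Algebra.adjoin A {s}) x hε
  refine ⟨y, hy, ?_⟩
  have h1 : AlgebraicIndependent A (fun _ : Unit => s) := by
    rw [algebraicIndependent_unique_type_iff]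
    exact hs
  have h2 := (h1.option_iff_transcendental y).2 (by
    have hr : Set.range (fun _ : Unit => s) = {s} := by simp
    rw [hr]; exact hty)
  let e : Fin 2 ≃ Option Unit := ⟨fun i => if i = 0 then some () else none,
    fun o => o.elim 1 (fun _ => 0), fun i => by fin_cases i <;> rfl,
    fun o => by rcases o with _ | _ <;> rfl⟩
  exact (algebraicIndependent_equiv' e (by ext i; fin_cases i <;> rfl)).2 h2

end TranscendentalPoints

section AdicCompletion

open IsDedekindDomain NumberField

variable (K : Type*) [Field K] [NumberField K] (v : HeightOneSpectrum (𝓞 K))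

/-- The `v`-adic completion of a number field as a nontrivially normed field. -/
noncomputable abbrev adicNontriviallyNormedField : NontriviallyNormedField (v.adicCompletion K) :=
  Valued.toNontriviallyNormedField _ _

attribute [local instance] adicNontriviallyNormedField

theorem norm_algebraMap_le_one (x : 𝓞 K) :
    ‖algebraMap K (v.adicCompletion K) (algebraMap (𝓞 K) K x)‖ ≤ 1 :=
  FinitePlace.norm_le_one K v x

theorem norm_algebraMap_lt_one_iff (x : 𝓞 K) :
    ‖algebraMap K (v.adicCompletion K) (algebraMap (𝓞 K) K x)‖ < 1 ↔ x ∈ v.asIdeal :=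
  FinitePlace.norm_lt_one_iff_mem K v x

theorem exists_norm_sub_algebraMap_lt_one {x : v.adicCompletion K} (hx : ‖x‖ ≤ 1) :
    ∃ r : 𝓞 K, ‖x - algebraMap K (v.adicCompletion K) (algebraMap (𝓞 K) K r)‖ < 1 := by
  have hd := v.denseRange_algebraMap (K := K)
  obtain ⟨y, hy⟩ := Metric.denseRange_iff.1 hd x 1 one_pos
  rw [dist_eq_norm] at hy
  have hy1 : ‖algebraMap K (v.adicCompletion K) y‖ ≤ 1 := by
    have h := IsUltrametricDist.norm_add_le_max x (algebraMap K (v.adicCompletion K) y - x)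
    rw [add_sub_cancel, norm_sub_rev] at h
    exact h.trans (max_le hx hy.le)
  have hyv : v.valuation K y ≤ 1 := by
    rw [← v.valuedAdicCompletion_eq_valuation']
    exact Valued.toNormedField.norm_le_one_iff.1 hy1
  obtain ⟨r, hr⟩ := v.exists_valuation_sub_lt_of_integer hyv 1
  refine ⟨r, ?_⟩
  have hr1 : ‖algebraMap K (v.adicCompletion K) (algebraMap (𝓞 K) K r - y)‖ < 1 := by
    refine Valued.toNormedField.norm_lt_one_iff.2 ?_
    have := v.valuedAdicCompletion_eq_valuation' (algebraMap (𝓞 K) K r - y)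
    refine (this.trans_lt ?_)
    exact_mod_cast hr
  rw [map_sub, norm_sub_rev] at hr1
  have h := IsUltrametricDist.norm_add_le_max (x - algebraMap K (v.adicCompletion K) y)
    (algebraMap K (v.adicCompletion K) y -
      algebraMap K (v.adicCompletion K) (algebraMap (𝓞 K) K r))
  rw [sub_add_sub_cancel] at h
  exact h.trans_lt (max_lt hy hr1)

variable {K v}

theorem exists_isLocalValuation_adicCompletion {p : ℕ} [Fact p.Prime]
    (hpv : (p : 𝓞 K) ∈ v.asIdeal) :
    ∃ f : ℕ, ∃ s₀ : v.adicCompletion K, s₀ ≠ 0 ∧ ∀ (C : Type*) [Field C]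
      [Algebra (v.adicCompletion K) C] [Algebra.IsAlgebraic (v.adicCompletion K) C]
      (s : v.adicCompletion K), ‖s‖ = ‖s₀‖ →
      IsLocalValuation (v.adicCompletion K) (spectralValuation (v.adicCompletion K) C) p f s := by
  have hfin : Finite (𝓞 K ⧸ v.asIdeal) := v.asIdeal.finiteQuotientOfFreeOfNeBot v.ne_bot
  have hmax : v.asIdeal.IsMaximal := v.isMaximal
  let _ : Field (𝓞 K ⧸ v.asIdeal) := Ideal.Quotient.field _
  have : Fintype (𝓞 K ⧸ v.asIdeal) := Fintype.ofFinite _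
  have hchar : CharP (𝓞 K ⧸ v.asIdeal) p := by
    refine (CharP.charP_iff_prime_eq_zero (Fact.out : p.Prime)).2 ?_
    rw [← map_natCast (Ideal.Quotient.mk v.asIdeal), Ideal.Quotient.eq_zero_iff_mem]
    exact hpv
  obtain ⟨f, -, hf⟩ := FiniteField.card (𝓞 K ⧸ v.asIdeal) p
  obtain ⟨π, hπ⟩ := v.valuation_exists_uniformizer K
  have hπv : Valued.v (algebraMap K (v.adicCompletion K) π) = WithZero.exp (-1 : ℤ) :=
    (v.valuedAdicCompletion_eq_valuation' π).trans hπ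
  have hπ0 : algebraMap K (v.adicCompletion K) π ≠ 0 := by
    rw [← Valuation.ne_zero_iff (Valued.v : Valuation (v.adicCompletion K) _), hπv]
    exact WithZero.exp_ne_zero
  refine ⟨f, algebraMap K (v.adicCompletion K) π, hπ0, fun C _ _ _ s hs => ?_⟩
  have hs0 : s ≠ 0 := by rw [← norm_ne_zero_iff, hs, norm_ne_zero_iff]; exact hπ0
  let lift : 𝓞 K ⧸ v.asIdeal → v.adicCompletion K := fun ρ =>
    algebraMap K (v.adicCompletion K) (algebraMap (𝓞 K) K (Quotient.out ρ))
  have hmk : ∀ ρ : 𝓞 K ⧸ v.asIdeal, Ideal.Quotient.mk v.asIdeal (Quotient.out ρ) = ρ :=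
    fun ρ => Quotient.out_eq ρ
  have hlift : ∀ ρ τ, ‖lift ρ - lift τ‖ < 1 → ρ = τ := by
    intro ρ τ h
    rw [← map_sub, ← map_sub, norm_algebraMap_lt_one_iff, ← Ideal.Quotient.mk_eq_mk_iff_sub_mem,
      hmk, hmk] at h
    exact h
  classical
  refine isLocalValuation_spectralValuation f.ne_zero hs0 ?_ ?_ ?_ ?_ (univ.image lift) ?_ ?_ ?_
  · rw [hs]
    refine Valued.toNormedField.norm_lt_one_iff.2 ?_
    rw [hπv, ← WithZero.exp_zero, WithZero.exp_lt_exp]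
    norm_num
  · intro x hx
    have hx' := (Valuation.ne_zero_iff (Valued.v : Valuation (v.adicCompletion K) _)).2 hx
    refine ⟨-WithZero.log (Valued.v x), ?_⟩
    rw [hs, ← norm_zpow]
    refine le_antisymm (Valued.toNormedField.norm_le_iff.2 ?_) (Valued.toNormedField.norm_le_iff.2 ?_)
    all_goals rw [map_zpow₀, hπv, ← WithZero.exp_zsmul]; simp [WithZero.exp_log hx']
  · have := (norm_algebraMap_lt_one_iff K v (p : 𝓞 K)).2 hpv
    simpa using this
  · intro x hx
    obtain ⟨r, hr⟩ := exists_norm_sub_algebraMap_lt_one K v hx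
    set y := algebraMap K (v.adicCompletion K) (algebraMap (𝓞 K) K r) with hy
    have hy1 : ‖y‖ ≤ 1 := norm_algebraMap_le_one K v r
    have hyq : ‖y ^ p ^ (f : ℕ) - y‖ < 1 := by
      have hrq : r ^ p ^ (f : ℕ) - r ∈ v.asIdeal := by
        rw [← Ideal.Quotient.mk_eq_mk_iff_sub_mem, map_pow, ← hf]
        exact FiniteField.pow_card _
      have := (norm_algebraMap_lt_one_iff K v _).2 hrq
      rwa [map_sub, map_sub, map_pow, map_pow] at this
    let w := spectralValuation (v.adicCompletion K) (v.adicCompletion K)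
    have hw : ∀ z, w z = ‖z‖₊ := fun z => spectralValuation_algebraMap z
    have hwle : ∀ z, ‖z‖ ≤ 1 → w z ≤ 1 := fun z hz => by rw [hw]; exact_mod_cast hz
    have hwlt : ∀ z, ‖z‖ < 1 ↔ w z < 1 := fun z => by rw [hw]; norm_cast
    have hpow : ∀ z : v.adicCompletion K, ‖z‖ ≤ 1 → ‖z ^ p ^ (f : ℕ)‖ ≤ 1 := fun z hz => by
      rw [norm_pow]; exact pow_le_one₀ (norm_nonneg _) hz
    have hxy := (res_eq_iff (hwle x hx) (hwle y hy1)).2 ((hwlt _).1 hr)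
    rw [hwlt, ← res_eq_iff (hwle _ (hpow y hy1)) (hwle y hy1), res_pow (hwle y hy1), ← hxy,
      ← res_pow (hwle x hx), res_eq_iff (hwle _ (hpow x hx)) (hwle x hx)] at hyq
    exact (hwlt _).2 hyq
  · rw [card_image_of_injective _ fun ρ τ h => hlift ρ τ (by rw [h, sub_self, norm_zero]; exact one_pos),
      card_univ, hf]
  · intro x hx
    obtain ⟨ρ, -, rfl⟩ := mem_image.1 hx
    exact norm_algebraMap_le_one K v _
  · intro x hx y hy hxy
    obtain ⟨ρ, -, rfl⟩ := mem_image.1 hx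
    obtain ⟨τ, -, rfl⟩ := mem_image.1 hy
    rw [hlift ρ τ hxy]

end AdicCompletion

section Transposition

theorem genericFamily_one_zero {A : Type*} [CommRing A] (d R n m : ℕ) :
    genericFamily d R n m (1 : A) 0 =
      X ^ 2 * ∏ i ∈ range (n - 2), (X - C ((i : A) + 1)) := by
  simp [genericFamily, genericCofactor]

theorem rootMultiplicity_X_sq_mul_prod {F : Type*} [Field F] {p N : ℕ} [CharP F p] (hN : N < p) :
    (X ^ 2 * ∏ i ∈ range N, (X - C ((i : F) + 1))).rootMultiplicity 0 ≤ 2 ∧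
    ∀ i < N, (X ^ 2 * ∏ i ∈ range N, (X - C ((i : F) + 1))).rootMultiplicity ((i : F) + 1) ≤ 1 := by
  classical
  have hne : (X ^ 2 * ∏ i ∈ range N, (X - C ((i : F) + 1))) ≠ 0 :=
    ((monic_X_pow 2).mul (prod_X_sub_succ_monic N)).ne_zero
  have hcast : ∀ i, 0 < i → i ≤ N → (i : F) ≠ 0 := fun i hi hiN h0 =>
    absurd (Nat.le_of_dvd hi ((CharP.cast_eq_zero_iff F p i).1 h0)) (by omega)
  have hsucc : ∀ i < N, (i : F) + 1 ≠ 0 := fun i hi => by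
    exact_mod_cast hcast (i + 1) (Nat.succ_pos i) hi
  have hroots : (∏ i ∈ range N, (X - C ((i : F) + 1))).roots =
      (range N).val.map fun i : ℕ => (i : F) + 1 := by
    rw [← roots_multiset_prod_X_sub_C ((range N).val.map fun i : ℕ => (i : F) + 1),
      Multiset.map_map]
    rfl
  have hinj : Set.InjOn (fun i : ℕ => (i : F) + 1) (range N) := by
    intro i hi j hj hij
    have hi := mem_range.1 hi
    have hj := mem_range.1 hj
    have hij : (i : F) = j := add_right_cancel hij
    exact CharP.natCast_injOn_Iio F p (Set.mem_Iio.2 (hi.trans hN)) (Set.mem_Iio.2 (hj.trans hN)) hij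
  have hnodup : ((range N).val.map fun i : ℕ => (i : F) + 1).Nodup :=
    (range N).nodup.map_on fun i hi j hj => hinj hi hj
  simp only [← count_roots, roots_mul hne, roots_X_pow, hroots, Multiset.count_add,
    Multiset.count_nsmul, Multiset.count_singleton]
  constructor
  · rw [Multiset.count_eq_zero_of_notMem]
    · simp
    · simp only [Multiset.mem_map, not_exists, not_and]
      exact fun i hi => hsucc i (mem_range.1 hi)
  · intro i hi
    rw [if_neg (hsucc i hi)]
    simpa using Multiset.nodup_iff_count_le_one.1 hnodup _

end Transposition

namespace IsLocalValuation

variable {k C : Type*} [Field k] [Field C] [Algebra k C] {v : Valuation C ℝ≥0} {p f : ℕ} {π : k}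

theorem val_le_one_of_isRoot_genericFamily {d R n m : ℕ} (hd0 : d ≠ 0)
    (hn : 2 ≤ n) (hmn : m < n) (hdeg : m + d * (R * (d.totient * d)) = n) {a b x : C}
    (ha : v a ≤ 1) (hb : v b ≤ 1) (hx : (genericFamily d R n m a b).IsRoot x) : v x ≤ 1 := by
  refine le_one_of_aeval_eq_zero (genericFamily_monic hd0 hn hmn hdeg
    (⟨a, ha⟩ : v.valuationSubring) ⟨b, hb⟩) ?_
  rw [← eval_map_algebraMap, genericFamily_map]
  exact hx

theorem exists_transposition [IsAlgClosure k C] [CharZero k] (h : IsLocalValuation k v p f π)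
    [Fact p.Prime] {d R n m : ℕ} (hd0 : d ≠ 0) (hn : 2 ≤ n) (hm0 : m ≠ 0) (hmn : m < n)
    (hdeg : m + d * (R * (d.totient * d)) = n) (hnp : n < p) {s t : k}
    (hs : v (algebraMap k C s - 1) < v (algebraMap k C π))
    (ht : v (algebraMap k C t) = v (algebraMap k C π))
    (hsep : (genericFamily d R n m (algebraMap k C s) (algebraMap k C t)).Separable) :
    ∃ (σ : C ≃ₐ[k] C) (x y : C), x ≠ y ∧
      (genericFamily d R n m (algebraMap k C s) (algebraMap k C t)).IsRoot x ∧
      (genericFamily d R n m (algebraMap k C s) (algebraMap k C t)).IsRoot y ∧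
      σ x = y ∧ σ y = x ∧
      ∀ z, (genericFamily d R n m (algebraMap k C s) (algebraMap k C t)).IsRoot z →
        z ≠ x → z ≠ y → σ z = z := by
  classical
  have : IsAlgClosed C := IsAlgClosure.isAlgClosed k
  have : Algebra.IsAlgebraic k C := IsAlgClosure.isAlgebraic
  have : IsGalois k C := { }
  have hchar := h.charP_res
  have hπ1 := h.uniformizer_lt
  have hs1 : v (algebraMap k C s) = 1 := by
    have := v.map_add_eq_of_lt_right (x := algebraMap k C s - 1) (y := 1)
      (by rw [map_one]; exact hs.trans hπ1)
    rwa [sub_add_cancel, map_one] at this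
  have ht1 : v (algebraMap k C t) < 1 := ht.trans_lt hπ1
  have hrs : res v (algebraMap k C s) = 1 := by
    rw [← res_one, res_eq_iff hs1.le v.map_one.le]; exact hs.trans hπ1
  have hrt : res v (algebraMap k C t) = 0 := (res_eq_zero ht1.le).2 ht1
  set P := genericFamily d R n m (algebraMap k C s) (algebraMap k C t) with hP
  have hmon : P.Monic := genericFamily_monic hd0 hn hmn hdeg _ _
  have hnat : P.natDegree = n := natDegree_genericFamily hd0 hn hmn hdeg _ _
  have hroots : ∀ x, P.IsRoot x → v x ≤ 1 := fun x hx =>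
    val_le_one_of_isRoot_genericFamily hd0 hn hmn hdeg hs1.le ht1.le hx
  have hfiber : ∀ {ρ : resField v} (S : Finset C), (∀ x ∈ S, P.IsRoot x) → (∀ x ∈ S, res v x = ρ) →
      #S ≤ (X ^ 2 * ∏ i ∈ range (n - 2), (X - Polynomial.C ((i : resField v) + 1))).rootMultiplicity
        ρ := by
    intro ρ S hS hρ
    have := card_le_rootMultiplicity_genericFamily_res hd0 hn hmn hdeg hs1.le ht1.le S
      (fun x hx => hroots x (hS x hx)) hS hρ
    rwa [hrs, hrt, genericFamily_one_zero] at this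
  obtain ⟨hmul0, hmul1⟩ := rootMultiplicity_X_sq_mul_prod (F := resField v) (p := p) (N := n - 2)
    (by omega)
  set S := P.roots.toFinset with hS
  have hmem : ∀ x, x ∈ S ↔ P.IsRoot x := fun x => by
    rw [hS, Multiset.mem_toFinset, mem_roots hmon.ne_zero]
  have hval : S.val = P.roots := Multiset.toFinset_val _ |>.trans
    (nodup_roots hsep).dedup
  have hcardS : #S = n := by
    rw [card_def, hval, ← hnat]
    exact (IsAlgClosed.splits P).natDegree_eq_card_roots.symm
  have hres : ∀ x, P.IsRoot x → res v x = 0 ∨ ∃ i < n - 2, res v x = (i : resField v) + 1 := by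
    intro x hx
    have h1 := hfiber (ρ := res v x) {x} (by simpa using hx) (by simp)
    rw [card_singleton] at h1
    have h2 := (rootMultiplicity_pos'.1 h1).2
    rw [IsRoot.def, eval_mul, eval_prod, mul_eq_zero, prod_eq_zero_iff] at h2
    refine h2.imp (fun h => by simpa using h) ?_
    rintro ⟨i, hi, h⟩
    exact ⟨i, mem_range.1 hi, by simpa [sub_eq_zero] using h⟩
  have hσres0 : ∀ (σ : C ≃ₐ[k] C) x, v x ≤ 1 → ∀ i : ℕ, res v x = i → res v (σ x) = i := by
    intro σ x hx i hi
    rw [← res_natCast, res_eq_iff hx (map_natCast_le_one i)] at hi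
    rw [← res_natCast, res_eq_iff (h.map_sub_le_one σ hx) (map_natCast_le_one i),
      ← _root_.map_natCast σ, ← map_sub, h.map_algEquiv]
    exact hi
  have hσroot : ∀ (σ : C ≃ₐ[k] C) x, P.IsRoot x → P.IsRoot (σ x) :=
    fun σ x hx => isRoot_genericFamily_map σ hx
  have hpair : ∀ {a b : C} {Q : C → Prop}, Q a → Q b → ∀ z ∈ ({a, b} : Finset C), Q z := by
    intro a b Q ha hb z hz
    rcases mem_insert.1 hz with rfl | hz
    · exact ha
    · rwa [mem_singleton.1 hz]
  have hσfix : ∀ (σ : C ≃ₐ[k] C) x, P.IsRoot x → res v x ≠ 0 → σ x = x := by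
    intro σ x hx hx0
    obtain ⟨i, hi, hxi⟩ := (hres x hx).resolve_left hx0
    have hσx := hσres0 σ x (hroots x hx) (i + 1) (by exact_mod_cast hxi)
    by_contra hne
    have := hfiber (ρ := (i : resField v) + 1) {σ x, x}
      (hpair (hσroot σ x hx) hx) (hpair (by exact_mod_cast hσx) hxi)
    rw [card_pair hne] at this
    exact absurd (this.trans (hmul1 i hi)) (by norm_num)
  set S0 := S.filter fun x => res v x = 0 with hS0
  have hcard0 : #S0 = 2 := by
    refine le_antisymm ((hfiber S0 (fun x hx => (hmem x).1 (mem_filter.1 hx).1)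
      fun x hx => (mem_filter.1 hx).2).trans hmul0) ?_
    have h1 : #(S.filter fun x => ¬ res v x = 0) ≤ n - 2 := by
      have hsub : (S.filter fun x => ¬ res v x = 0).image (res v) ⊆
          (range (n - 2)).image fun i : ℕ => (i : resField v) + 1 := by
        intro ρ hρ
        obtain ⟨x, hx, rfl⟩ := mem_image.1 hρ
        obtain ⟨hxS, hx0⟩ := mem_filter.1 hx
        obtain ⟨i, hi, hxi⟩ := (hres x ((hmem x).1 hxS)).resolve_left hx0
        exact mem_image.2 ⟨i, mem_range.2 hi, hxi.symm⟩
      rw [← card_image_of_injOn (f := res v) (s := S.filter fun x => ¬ res v x = 0)]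
      · exact (card_le_card hsub).trans (card_image_le.trans_eq (card_range _))
      · intro x hx y hy hxy
        obtain ⟨hxS, hx0⟩ := mem_filter.1 hx
        obtain ⟨hyS, hy0⟩ := mem_filter.1 hy
        obtain ⟨i, hi, hxi⟩ := (hres x ((hmem x).1 hxS)).resolve_left hx0
        by_contra hne
        have hxy : res v x = res v y := hxy
        have := hfiber (ρ := (i : resField v) + 1) {x, y}
          (hpair ((hmem x).1 hxS) ((hmem y).1 hyS)) (hpair hxi (hxy ▸ hxi))
        rw [card_pair hne] at this
        exact absurd (this.trans (hmul1 i hi)) (by norm_num)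
    have h2 : #S0 + #(S.filter fun x => ¬ res v x = 0) = #S := by
      rw [hS0]; convert card_filter_add_card_filter_not (s := S) (fun x => res v x = 0)
    omega
  obtain ⟨x, y, hxy, hS0xy⟩ := card_eq_two.1 hcard0
  have hmem0 : ∀ z, P.IsRoot z → (res v z = 0 ↔ z = x ∨ z = y) := by
    intro z hz
    have : z ∈ S0 ↔ z = x ∨ z = y := by
      rw [hS0xy, mem_insert, mem_singleton]
    rw [← this, hS0, mem_filter, hmem]
    exact (and_iff_right hz).symm
  have hx : P.IsRoot x := (hmem x).1 (mem_filter.1 (hS0xy ▸ mem_insert_self x {y} : x ∈ S0)).1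
  have hy : P.IsRoot y := (hmem y).1 (mem_filter.1 (hS0xy ▸ by simp : y ∈ S0)).1
  have hx0 := (hmem0 x hx).2 (Or.inl rfl)
  have hy0 := (hmem0 y hy).2 (Or.inr rfl)
  have hσxy : ∀ (σ : C ≃ₐ[k] C) z, P.IsRoot z → res v z = 0 → σ z = x ∨ σ z = y := fun σ z hz hz0 =>
    (hmem0 _ (hσroot σ z hz)).1 (by
      simpa using hσres0 σ z (hroots z hz) 0 (by simpa using hz0))
  have hprod : v x * v y = v (algebraMap k C π) := by
    have h1 : P.eval 0 = ∏ r ∈ S, (0 - r) := by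
      have h2 := (IsAlgClosed.splits P).eq_prod_roots_of_monic hmon
      rw [← hval] at h2
      conv_lhs => rw [h2]
      rw [← Finset.prod, eval_prod]
      simp
    have h3 : v (P.eval 0) = ∏ r ∈ S, v r := by
      rw [h1, map_prod]
      exact prod_congr rfl fun r _ => by rw [zero_sub, Valuation.map_neg]
    have h4 : ∏ r ∈ S, v r = ∏ r ∈ S0, v r := by
      refine (prod_subset (filter_subset _ _) fun r hr hr0 => ?_).symm
      have hr0 : res v r ≠ 0 := fun h0 => hr0 (mem_filter.2 ⟨hr, h0⟩)
      exact (res_ne_zero (hroots r ((hmem r).1 hr))).1 hr0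
    rw [← prod_pair hxy, ← hS0xy, ← h4, ← h3]
    have h5 : P.eval 0 = algebraMap k C s ^ 2 *
        (-algebraMap k C t * ∏ i ∈ range (n - 2), (-((i : C) + 1)) + (1 - algebraMap k C s)) := by
      rw [hP, genericFamily, genericCofactor]
      simp [eval_prod, hm0]
    have h6 : v (-algebraMap k C t * ∏ i ∈ range (n - 2), (-((i : C) + 1))) =
        v (algebraMap k C π) := by
      rw [map_mul, Valuation.map_neg, ht, map_prod, prod_eq_one, mul_one]
      intro i hi
      have hi := mem_range.1 hi
      rw [Valuation.map_neg]
      exact_mod_cast h.map_natCast (i + 1) fun hd =>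
        absurd (Nat.le_of_dvd (Nat.succ_pos i) hd) (by omega)
    rw [h5, map_mul, map_pow, hs1, one_pow, one_mul, v.map_add_eq_of_lt_left, h6]
    rw [h6, Valuation.map_sub_swap]
    exact hs
  have hmove : ∃ σ : C ≃ₐ[k] C, σ x ≠ x := by
    by_contra! hfix
    have hfixy : ∀ σ : C ≃ₐ[k] C, σ y = y := fun σ =>
      (hσxy σ y hy hy0).resolve_left fun h1 => hxy (σ.injective (h1.trans (hfix σ).symm)).symm
    obtain ⟨a, ha⟩ := (InfiniteGalois.mem_range_algebraMap_iff_fixed (k := k) x).2 hfix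
    obtain ⟨b, hb⟩ := (InfiniteGalois.mem_range_algebraMap_iff_fixed (k := k) y).2 hfixy
    have hvx := (res_eq_zero (hroots x hx)).1 hx0
    have hvy := (res_eq_zero (hroots y hy)).1 hy0
    have hvπ : 0 < v (algebraMap k C π) := by
      rw [zero_lt_iff, Ne, map_eq_zero, _root_.map_eq_zero]
      exact h.uniformizer_ne
    have hpos : v x ≠ 0 ∧ v y ≠ 0 := mul_ne_zero_iff.1 (hprod ▸ hvπ.ne')
    rw [← ha] at hvx hpos
    rw [← hb] at hvy hpos
    rw [← ha, ← hb] at hprod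
    obtain ⟨i, hi⟩ := h.exists_zpow a (by rintro rfl; simp at hpos)
    obtain ⟨j, hj⟩ := h.exists_zpow b (by rintro rfl; simp at hpos)
    rw [hi, zpow_lt_one_iff_right_of_lt_one₀ hvπ hπ1] at hvx
    rw [hj, zpow_lt_one_iff_right_of_lt_one₀ hvπ hπ1] at hvy
    rw [hi, hj, ← zpow_add₀ hvπ.ne'] at hprod
    have := zpow_right_injective₀ hvπ hπ1.ne (hprod.trans (zpow_one _).symm)
    omega
  obtain ⟨σ, hσ⟩ := hmove
  have hσx : σ x = y := (hσxy σ x hx hx0).resolve_left hσ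
  have hσy : σ y = x := (hσxy σ y hy hy0).resolve_right fun h1 =>
    hxy (σ.injective (hσx.trans h1.symm))
  refine ⟨σ, x, y, hxy, hx, hy, hσx, hσy, fun z hz hzx hzy => hσfix σ z hz fun hz0 => ?_⟩
  exact ((hmem0 z hz).1 hz0).elim hzx hzy

end IsLocalValuation

section GenericIrreducible

theorem genericFamily_neg_one {A : Type*} [CommRing A] (d R n m : ℕ) (t : A) :
    genericFamily d R n m (-1) t =
      (X ^ 2 - C t) * ∏ i ∈ range (n - 2), (X - C ((i : A) + 1)) + 2 * X ^ m + 2 := by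
  have h2 : (C (1 - -1) : A[X]) = 2 := by
    rw [sub_neg_eq_add, one_add_one_eq_two]; rfl
  rw [genericFamily, genericCofactor, h2]
  simp only [even_two, Even.neg_pow, one_pow, map_one, map_neg]
  ring

theorem irreducible_genericFamily_neg_one {K : Type*} [Field K] [CharZero K] (d R n m : ℕ) :
    Irreducible (genericFamily d R n m (-1) (X : K[X])) := by
  set Q : K[X] := ∏ i ∈ range (n - 2), (X - C ((i : K) + 1)) with hQ
  have hQ0 : Q ≠ 0 := (prod_X_sub_succ_monic (n - 2)).ne_zero
  have hcop : IsCoprime Q (2 * X ^ m + 2 : K[X]) := by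
    refine IsCoprime.prod_left fun i _ => ?_
    rw [(irreducible_X_sub_C _).coprime_iff_not_dvd, dvd_iff_isRoot, IsRoot.def]
    have h : ((2 * (i + 1) ^ m + 2 : ℕ) : K) ≠ 0 := Nat.cast_ne_zero.2 (by omega)
    simpa using h
  have hsw : Bivariate.swap (genericFamily d R n m (-1) (X : K[X])) =
      C (-Q) * X + C (X ^ 2 * Q + 2 * X ^ m + 2) := by
    rw [genericFamily_neg_one]
    have hterm : ∀ i : ℕ, Bivariate.swap (X - C ((i : K[X]) + 1) : K[X][X]) =
        C (X - C ((i : K) + 1)) := fun i => by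
      have : ((i : K[X]) + 1) = C ((i : K) + 1) := by simp
      rw [map_sub, this, Bivariate.swap_Y, Bivariate.swap_C_C]
      simp
    have hprod : Bivariate.swap (∏ i ∈ range (n - 2), (X - C ((i : K[X]) + 1)) : K[X][X]) = C Q := by
      rw [map_prod, hQ, map_prod]
      exact prod_congr rfl fun i _ => hterm i
    rw [map_add, map_add, map_mul, hprod]
    simp only [map_add, map_mul, map_sub, map_pow, Bivariate.swap_X, Bivariate.swap_Y, map_ofNat,
      map_neg]
    ring
  rw [← MulEquiv.irreducible_iff (Bivariate.swap (R := K)), hsw]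
  refine irreducible_C_mul_X_add_C (neg_ne_zero.2 hQ0) ?_
  have h1 : IsCoprime Q (X ^ 2 * Q + 2 * X ^ m + 2) := by
    have h := hcop.add_mul_left_right (X ^ 2)
    rwa [show 2 * X ^ m + 2 + Q * X ^ 2 = X ^ 2 * Q + 2 * X ^ m + 2 by ring] at h
  exact h1.neg_left.isRelPrime

variable {d R n m : ℕ}

theorem irreducible_genericFamily {K : Type*} [Field K] [CharZero K] (hd0 : d ≠ 0) (hn : 2 ≤ n)
    (hmn : m < n) (hdeg : m + d * (R * (d.totient * d)) = n) :
    Irreducible (genericFamily d R n m (MvPolynomial.X 0 : MvPolynomial (Fin 2) K)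
      (MvPolynomial.X 1)) := by
  let g : MvPolynomial (Fin 2) K →+* K[X] :=
    (MvPolynomial.aeval (R := K) ![(-1 : K[X]), X]).toRingHom
  refine Monic.irreducible_of_irreducible_map g _ (genericFamily_monic hd0 hn hmn hdeg _ _) ?_
  have h0 : g (MvPolynomial.X 0) = -1 := by simp [g]
  have h1 : g (MvPolynomial.X 1) = X := by simp [g]
  rw [genericFamily_map, h0, h1]
  exact irreducible_genericFamily_neg_one d R n m

end GenericIrreducible

section Points

theorem norm_eq_of_norm_sub_lt {k : Type*} [NormedField k] [IsUltrametricDist k] {x y : k}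
    (h : ‖x - y‖ < ‖y‖) : ‖x‖ = ‖y‖ := by
  have h1 := IsUltrametricDist.norm_add_eq_max_of_norm_ne_norm h.ne
  rwa [sub_add_cancel, max_eq_right h.le] at h1

theorem spectralValuation_algebraMap_lt {k C : Type*} [NontriviallyNormedField k]
    [CompleteSpace k] [IsUltrametricDist k] [Field C] [Algebra k C] [Algebra.IsAlgebraic k C] {x y : k} :
    spectralValuation k C (algebraMap k C x) < spectralValuation k C (algebraMap k C y) ↔
      ‖x‖ < ‖y‖ := by
  rw [spectralValuation_algebraMap, spectralValuation_algebraMap]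
  norm_cast

variable {k C : Type*} [NontriviallyNormedField k] [CompleteSpace k]
  [IsUltrametricDist k] [CharZero k] [Field C] [Algebra k C] [IsAlgClosure k C]
  [Algebra.IsAlgebraic k C] {p f : ℕ} [Fact p.Prime] {s₀ : k}

theorem exists_algebraicIndependent_labelling (K : Type*) [Field K] [Countable K] [Algebra K k]
    (hs₀ : s₀ ≠ 0)
    (hloc : ∀ s : k, ‖s‖ = ‖s₀‖ → IsLocalValuation k (spectralValuation k C) p f s)
    {G : Type*} [Group G] [Finite G] {d R n m : ℕ} (hd : 2 ≤ d) (hGd : Nat.card G ∣ d)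
    (hGR : Nat.card G * d.totient ≤ R) (hn : 2 ≤ n) (hmn : m < n)
    (hdeg : m + d * (R * (d.totient * d)) = n) (hp : residueBound d R < p) :
    ∃ s t : k, AlgebraicIndependent K ![s, t] ∧
      ∀ (L : IntermediateField k C) [FiniteDimensional k L] [Normal k L] (φ : (C ≃ₐ[k] C) →* G),
        (∀ σ, φ σ = 1 ↔ ∀ x ∈ L, σ x = x) →
        ∃ z : G × Fin (d.totient * d * d) → C, Function.Injective z ∧
          (∀ u, (genericFamily d R n m (algebraMap k C s) (algebraMap k C t)).IsRoot (z u)) ∧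
          ∀ σ g y, ∃ y', σ (z (g, y)) = z (φ σ * g, y') := by
  obtain ⟨s, hs, hst⟩ := exists_transcendental_norm_sub_lt K s₀ (norm_pos_iff.2 hs₀)
  obtain ⟨t₀, ht₀, ht⟩ := (hloc s (norm_eq_of_norm_sub_lt hs)).exists_labelling (G := G) hd hGd hGR
    hn hmn hdeg hp
  obtain ⟨t, htt, hind⟩ := exists_algebraicIndependent_norm_sub_lt K hst t₀ one_pos
  refine ⟨s, t, hind, ht t ?_⟩
  rw [← map_sub, spectralValuation_algebraMap]
  exact_mod_cast htt

theorem exists_algebraicIndependent_transposition (K : Type*) [Field K] [Countable K]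
    [Algebra K k] (hs₀ : s₀ ≠ 0)
    (hloc : ∀ s : k, ‖s‖ = ‖s₀‖ → IsLocalValuation k (spectralValuation k C) p f s)
    {d R n m : ℕ} (hd0 : d ≠ 0) (hn : 2 ≤ n) (hm0 : m ≠ 0) (hmn : m < n)
    (hdeg : m + d * (R * (d.totient * d)) = n) (hnp : n < p) :
    ∃ s t : k, AlgebraicIndependent K ![s, t] ∧
      ((genericFamily d R n m (algebraMap k C s) (algebraMap k C t)).Separable →
        ∃ (σ : C ≃ₐ[k] C) (x y : C), x ≠ y ∧
          (genericFamily d R n m (algebraMap k C s) (algebraMap k C t)).IsRoot x ∧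
          (genericFamily d R n m (algebraMap k C s) (algebraMap k C t)).IsRoot y ∧
          σ x = y ∧ σ y = x ∧
          ∀ z, (genericFamily d R n m (algebraMap k C s) (algebraMap k C t)).IsRoot z →
            z ≠ x → z ≠ y → σ z = z) := by
  obtain ⟨s, hs, hst⟩ := exists_transcendental_norm_sub_lt K (1 : k) (norm_pos_iff.2 hs₀)
  obtain ⟨t, ht, hind⟩ := exists_algebraicIndependent_norm_sub_lt K hst s₀ (norm_pos_iff.2 hs₀)
  refine ⟨s, t, hind, fun hsep => ?_⟩
  refine (hloc s₀ rfl).exists_transposition hd0 hn hm0 hmn hdeg hnp ?_ ?_ hsep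
  · rw [← map_one (algebraMap k C), ← map_sub]
    exact spectralValuation_algebraMap_lt.2 hs
  · rw [spectralValuation_algebraMap, spectralValuation_algebraMap]
    exact NNReal.eq (norm_eq_of_norm_sub_lt ht)

end Points

section FullGaloisGroup

variable {K₀ C : Type*} [Field K₀] [CharZero K₀] [Field C] [Algebra K₀ C] [IsAlgClosed C]

/-- An irreducible polynomial of prime degree such that some automorphism acts on its roots as a
transposition has the full symmetric group as Galois group. -/
theorem exists_gal_of_transposition {P : K₀[X]} (hirr : Irreducible P) (hdeg : P.natDegree.Prime)
    (σ : C ≃ₐ[K₀] C) {x y : C} (hxy : x ≠ y) (hx : x ∈ P.rootSet C) (hy : y ∈ P.rootSet C)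
    (hσx : σ x = y) (hσy : σ y = x) (hσ : ∀ z ∈ P.rootSet C, z ≠ x → z ≠ y → σ z = z)
    (π : Equiv.Perm (P.rootSet P.SplittingField)) :
    ∃ γ : P.SplittingField ≃ₐ[K₀] P.SplittingField,
      ∀ z : P.rootSet P.SplittingField, γ z = π z := by
  have : Fact ((P.map (algebraMap K₀ C)).Splits) := ⟨IsAlgClosed.splits _⟩
  classical
  have h1 : Fintype.card (P.rootSet C) = P.natDegree := by
    simp_rw [rootSet_def, Finset.coe_sort_coe, Fintype.card_coe]
    rw [Multiset.toFinset_card_of_nodup, ← Splits.natDegree_eq_card_roots, natDegree_map]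
    · exact IsAlgClosed.splits _
    · exact nodup_roots ((separable_map (algebraMap K₀ C)).mpr hirr.separable)
  have hsurj : Function.Surjective (Gal.galActionHom P C) := by
    rw [← MonoidHom.range_eq_top]
    have hswap : Gal.galActionHom P C (Gal.restrict P C σ) = Equiv.swap ⟨x, hx⟩ ⟨y, hy⟩ := by
      ext z
      rw [Gal.galActionHom_restrict]
      by_cases hzx : z = ⟨x, hx⟩
      · rw [hzx, Equiv.swap_apply_left, hσx]
      by_cases hzy : z = ⟨y, hy⟩
      · rw [hzy, Equiv.swap_apply_right, hσy]
      rw [Equiv.swap_apply_of_ne_of_ne hzx hzy]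
      exact hσ z z.2 (fun h => hzx (Subtype.ext h)) fun h => hzy (Subtype.ext h)
    refine Equiv.Perm.subgroup_eq_top_of_swap_mem ?_ ?_ (τ := Equiv.swap ⟨x, hx⟩ ⟨y, hy⟩)
      ⟨_, hswap⟩ ⟨_, _, fun h => hxy (Subtype.ext_iff.1 h), rfl⟩
    · rwa [h1]
    · rw [h1]
      simpa only [Fintype.card_eq_nat_card,
        Nat.card_congr (MonoidHom.ofInjective (Gal.galActionHom_injective P C)).toEquiv.symm]
        using Gal.prime_degree_dvd_card hirr hdeg
  let r := Gal.rootsEquivRoots P C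
  obtain ⟨γ, hγ⟩ := hsurj ((r.symm.trans π).trans r)
  refine ⟨γ, fun z => ?_⟩
  have h2 : γ • r z = r (π z) := by
    have := congrArg (fun τ => τ (r z)) hγ
    simpa [Gal.galActionHom] using this
  rw [Gal.smul_def, Equiv.symm_apply_apply] at h2
  exact congrArg Subtype.val (r.injective h2)

end FullGaloisGroup

section Descent

variable {K₀ E₀ G Y : Type*} [Field K₀] [Field E₀] [Algebra K₀ E₀] [Group G]

theorem exists_intermediateField_labelling [Nonempty Y] [FiniteDimensional K₀ E₀] {lab : G × Y → E₀}
    (hlab : Function.Injective lab)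
    (hfull : ∀ g : G, ∃ ρ : E₀ ≃ₐ[K₀] E₀, ∀ a y, ρ (lab (a, y)) = lab (g * a, y)) :
    ∃ (F : IntermediateField K₀ E₀) (Φ : (E₀ ≃ₐ[F] E₀) →* G), Function.Surjective Φ ∧
      ∀ (ρ : E₀ ≃ₐ[K₀] E₀) (g : G), (∀ a y, ∃ y', ρ (lab (a, y)) = lab (g * a, y')) →
        ∃ τ : E₀ ≃ₐ[F] E₀, (∀ x, τ x = ρ x) ∧ Φ τ = g := by
  obtain ⟨y₀⟩ := ‹Nonempty Y›
  let Δ' : Submonoid (E₀ ≃ₐ[K₀] E₀) :=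
    { carrier := {ρ | ∃ g : G, ∀ a y, ∃ y', ρ (lab (a, y)) = lab (g * a, y')}
      mul_mem' := by
        rintro ρ τ ⟨g, hg⟩ ⟨h, hh⟩
        refine ⟨g * h, fun a y => ?_⟩
        obtain ⟨y', hy'⟩ := hh a y
        obtain ⟨y'', hy''⟩ := hg (h * a) y'
        exact ⟨y'', by rw [AlgEquiv.mul_apply, hy', hy'', mul_assoc]⟩
      one_mem' := ⟨1, fun a y => ⟨y, by simp⟩⟩ }
  let Δ : Subgroup (E₀ ≃ₐ[K₀] E₀) :=
    { Δ' with
      inv_mem' := fun {ρ} hρ => by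
        have h : ρ⁻¹ ∈ Submonoid.powers ρ := mem_powers_iff_mem_zpowers.2
          (inv_mem (Subgroup.mem_zpowers ρ))
        exact (Submonoid.powers_le (P := Δ')).2 hρ h }
  have huniq : ∀ (ρ : E₀ ≃ₐ[K₀] E₀) (g h : G), (∀ a y, ∃ y', ρ (lab (a, y)) = lab (g * a, y')) →
      (∀ a y, ∃ y', ρ (lab (a, y)) = lab (h * a, y')) → g = h := by
    intro ρ g h hg hh
    obtain ⟨y', hy'⟩ := hg 1 y₀
    obtain ⟨y'', hy''⟩ := hh 1 y₀
    simpa using congrArg Prod.fst (hlab (hy'.symm.trans hy''))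
  let Ψ : Δ →* G :=
    { toFun := fun ρ => ρ.2.choose
      map_one' := huniq 1 _ _ (1 : Δ).2.choose_spec fun a y => ⟨y, by simp⟩
      map_mul' := by
        intro ρ τ
        refine huniq (ρ * τ) _ _ (ρ * τ : Δ).2.choose_spec fun a y => ?_
        obtain ⟨y', hy'⟩ := τ.2.choose_spec a y
        obtain ⟨y'', hy''⟩ := ρ.2.choose_spec (τ.2.choose * a) y'
        exact ⟨y'', by rw [AlgEquiv.mul_apply, hy', hy'', mul_assoc]⟩ }
  have hΨ : ∀ (ρ : Δ) (g : G), (∀ a y, ∃ y', (ρ : E₀ ≃ₐ[K₀] E₀) (lab (a, y)) = lab (g * a, y')) →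
      Ψ ρ = g := fun ρ g hg => huniq ρ _ _ ρ.2.choose_spec hg
  let ε := IntermediateField.subgroupEquivAlgEquiv Δ
  refine ⟨IntermediateField.fixedField Δ, Ψ.comp ε.symm.toMonoidHom, fun g => ?_,
    fun ρ g hg => ⟨ε ⟨ρ, g, hg⟩, fun x => rfl, ?_⟩⟩
  · obtain ⟨ρ, hρ⟩ := hfull g
    have hρ' : ∀ a y, ∃ y', ρ (lab (a, y)) = lab (g * a, y') := fun a y => ⟨y, hρ a y⟩
    refine ⟨ε ⟨ρ, g, hρ'⟩, ?_⟩
    simpa using hΨ ⟨ρ, g, hρ'⟩ g hρ'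
  · simpa using hΨ ⟨ρ, g, hg⟩ g hg

/-- The Galois group of the fixed field of the kernel of a surjection `Gal(E₀/F) → G`. -/
theorem nonempty_gal_fixedField_ker_mulEquiv {F : Type*} [Field F] [Algebra F E₀]
    [FiniteDimensional F E₀] [IsGalois F E₀] (Φ : (E₀ ≃ₐ[F] E₀) →* G)
    (hΦ : Function.Surjective Φ) :
    Nonempty ((IntermediateField.fixedField Φ.ker ≃ₐ[F] IntermediateField.fixedField Φ.ker) ≃* G) :=
  ⟨(IsGalois.normalAutEquivQuotient Φ.ker).symm.trans
    (QuotientGroup.quotientKerEquivOfSurjective Φ hΦ)⟩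

variable {k C : Type*} [Field k] [CharZero k] [Field C] [Algebra k C] [IsAlgClosure k C]
  [Algebra K₀ k] [Algebra K₀ C] [IsScalarTower K₀ k C]

theorem exists_algHom_of_labelling [Normal K₀ E₀] {lab : G × Y → E₀}
    {F : IntermediateField K₀ E₀} [FiniteDimensional F E₀] {Φ : (E₀ ≃ₐ[F] E₀) →* G}
    (hΦ : ∀ (ρ : E₀ ≃ₐ[K₀] E₀) (g : G), (∀ a y, ∃ y', ρ (lab (a, y)) = lab (g * a, y')) →
        ∃ τ : E₀ ≃ₐ[F] E₀, (∀ x, τ x = ρ x) ∧ Φ τ = g)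
    (ι : E₀ →ₐ[K₀] C) (L : IntermediateField k C) (φ : (C ≃ₐ[k] C) →* G)
    (hφ : ∀ σ, φ σ = 1 ↔ ∀ x ∈ L, σ x = x)
    (hι : ∀ σ a y, ∃ y', σ (ι (lab (a, y))) = ι (lab (φ σ * a, y'))) :
    ∃ j : F →ₐ[K₀] k, (∀ x : F, algebraMap k C (j x) = ι x) ∧
      ∃ e : IntermediateField.fixedField Φ.ker →+* L, (∀ x, (e x : C) = ι x) ∧
        Algebra.adjoin k (Set.range e) = ⊤ := by
  have : IsAlgClosed C := IsAlgClosure.isAlgClosed k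
  have : Algebra.IsAlgebraic k C := IsAlgClosure.isAlgebraic
  have : IsGalois k C := IsAlgClosure.isGalois k C
  have key : ∀ σ : C ≃ₐ[k] C, ∃ τ : E₀ ≃ₐ[F] E₀, (∀ x, ι (τ x) = σ (ι x)) ∧ Φ τ = φ σ := by
    intro σ
    let _ : Algebra E₀ C := ι.toRingHom.toAlgebra
    have : IsScalarTower K₀ E₀ C := .of_algebraMap_eq fun x => (ι.commutes x).symm
    let ρ := (σ.restrictScalars K₀).restrictNormal E₀
    have hρ : ∀ x, ι (ρ x) = σ (ι x) := fun x =>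
      (σ.restrictScalars K₀).restrictNormal_commutes E₀ x
    obtain ⟨τ, hτ, hτφ⟩ := hΦ ρ (φ σ) fun a y => by
      obtain ⟨y', hy'⟩ := hι σ a y
      exact ⟨y', ι.injective ((hρ _).trans hy')⟩
    exact ⟨τ, fun x => by rw [hτ, hρ], hτφ⟩
  have hF : ∀ x : F, ∃ a : k, algebraMap k C a = ι x := fun x => by
    refine (InfiniteGalois.mem_range_algebraMap_iff_fixed _).2 fun σ => ?_
    obtain ⟨τ, hτ, -⟩ := key σ
    rw [← hτ]
    exact congrArg ι (τ.commutes x)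
  choose j hj using hF
  have hinj := (algebraMap k C).injective
  let j' : F →ₐ[K₀] k :=
    { toFun := j
      map_one' := hinj (by simp [hj])
      map_mul' := fun x y => hinj (by simp [hj])
      map_zero' := hinj (by simp [hj])
      map_add' := fun x y => hinj (by simp [hj])
      commutes' := fun x => hinj (by
        rw [hj, ← IsScalarTower.algebraMap_apply K₀ k C]
        exact ι.commutes x) }
  have hE : ∀ x : IntermediateField.fixedField Φ.ker, ι x ∈ L := fun x => by
    rw [← InfiniteGalois.fixedField_fixingSubgroup L]
    rintro ⟨σ, hσ⟩
    obtain ⟨τ, hτ, hτφ⟩ := key σ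
    have h1 : φ σ = 1 := (hφ σ).2 fun x hx => hσ ⟨x, hx⟩
    change σ (ι x) = ι x
    rw [← hτ]
    exact congrArg ι (x.2 ⟨τ, by rw [MonoidHom.mem_ker, hτφ, h1]⟩)
  let e : IntermediateField.fixedField Φ.ker →+* L :=
    (ι.toRingHom.comp (algebraMap (IntermediateField.fixedField Φ.ker) E₀)).codRestrict
      L.toSubring hE
  have he : ∀ x, (e x : C) = ι x := fun x => rfl
  refine ⟨j', hj, e, he, ?_⟩
  have hle : L ≤ IntermediateField.adjoin k (Set.range fun x => (e x : C)) := by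
    rw [← InfiniteGalois.fixedField_fixingSubgroup (IntermediateField.adjoin k _)]
    rintro x hx ⟨σ, hσ⟩
    refine (hφ σ).1 ?_ x hx
    obtain ⟨τ, hτ, hτφ⟩ := key σ
    have hmem : τ ∈ (IntermediateField.fixedField Φ.ker).fixingSubgroup := by
      rw [IntermediateField.mem_fixingSubgroup_iff]
      intro x hx
      refine ι.injective ((hτ x).trans ?_)
      exact (IntermediateField.mem_fixingSubgroup_iff _ _).1 hσ _
        (IntermediateField.subset_adjoin k _ ⟨⟨x, hx⟩, rfl⟩)
    rw [IntermediateField.fixingSubgroup_fixedField, MonoidHom.mem_ker, hτφ] at hmem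
    exact hmem
  rw [eq_top_iff]
  rintro ⟨x, hx⟩ -
  have h1 := hle hx
  rw [← IntermediateField.mem_toSubalgebra,
    IntermediateField.adjoin_toSubalgebra_of_isAlgebraic (fun x _ => Algebra.IsAlgebraic.isAlgebraic x)] at h1
  have h2 : Algebra.adjoin k (Set.range fun x => (e x : C)) =
      (Algebra.adjoin k (Set.range e)).map L.val := by
    rw [AlgHom.map_adjoin, ← Set.range_comp]
    rfl
  rw [h2] at h1
  obtain ⟨y, hy, hyx⟩ := h1
  rwa [show (⟨x, hx⟩ : L) = y from Subtype.ext hyx.symm]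

end Descent

end

section SpecializationCore

variable {A F E Ω M : Type*} [CommRing A] [Field F] [Field E] [Field Ω] [Field M] [Algebra A F]
  [IsFractionRing A F] [Algebra F E] [Algebra A E] [IsScalarTower A F E] [Algebra A Ω]
  [Algebra F Ω] [IsScalarTower A F Ω] [Algebra.IsAlgebraic F E]

variable (A F E Ω) in
/-- Base change of the integral closure of `A` in `E` along a map `A → Ω` that extends to the
fraction field `F` of `A`. -/
noncomputable def tensorIntegralClosureEquiv : Ω ⊗[A] (integralClosure A E) ≃ₐ[Ω] Ω ⊗[F] E :=
  have : IsDomain A := (FaithfulSMul.algebraMap_injective A F).isDomain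
  have : IsLocalization (Algebra.algebraMapSubmonoid (integralClosure A E) (nonZeroDivisors A)) E :=
    IsIntegralClosure.isLocalization A F E (integralClosure A E)
  have : Algebra.IsPushout A F (integralClosure A E) E :=
    (Algebra.isPushout_of_isLocalization (nonZeroDivisors A) F (integralClosure A E) E).symm
  (Algebra.TensorProduct.cancelBaseChange A F Ω Ω (integralClosure A E)).symm.trans
    (Algebra.TensorProduct.congr AlgEquiv.refl (Algebra.IsPushout.equiv A F (integralClosure A E) E))

variable (A) in
theorem exists_maximal_quotient_tensor_integralClosure [Algebra Ω M] [Algebra F M]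
    [IsScalarTower F Ω M] (e : E →ₐ[F] M) (he : Algebra.adjoin Ω (Set.range e) = ⊤) :
    ∃ m : Ideal (Ω ⊗[A] (integralClosure A E)), m.IsMaximal ∧
      Nonempty (((Ω ⊗[A] (integralClosure A E)) ⧸ m) ≃ₐ[Ω] M) := by
  let g : Ω ⊗[F] E →ₐ[Ω] M := Algebra.TensorProduct.lift (Algebra.ofId Ω M) e
    fun _ _ => Commute.all _ _
  have hg : Function.Surjective g := by
    rw [← AlgHom.range_eq_top, eq_top_iff, ← he]
    refine Algebra.adjoin_le ?_
    rintro _ ⟨x, rfl⟩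
    exact ⟨1 ⊗ₜ x, by simp [g]⟩
  let h := g.comp (tensorIntegralClosureEquiv A F E Ω).toAlgHom
  have hh : Function.Surjective h := hg.comp (tensorIntegralClosureEquiv A F E Ω).surjective
  exact ⟨RingHom.ker h, RingHom.ker_isMaximal_of_surjective h.toRingHom hh,
    ⟨Ideal.quotientKerAlgEquivOfSurjective hh⟩⟩

theorem isReduced_tensor_integralClosure (A F E Ω : Type*) [CommRing A] [Field F] [Field E]
    [Field Ω] [Algebra A F] [IsFractionRing A F] [Algebra F E] [Algebra A E] [IsScalarTower A F E]
    [Algebra A Ω] [Algebra F Ω] [IsScalarTower A F Ω] [FiniteDimensional F E]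
    [Algebra.IsSeparable F E] : IsReduced (Ω ⊗[A] (integralClosure A E)) := by
  have := Algebra.FormallyUnramified.of_isSeparable F E
  have : IsReduced (Ω ⊗[F] E) := Algebra.FormallyUnramified.isReduced_of_field Ω (Ω ⊗[F] E)
  exact isReduced_of_injective (tensorIntegralClosureEquiv A F E Ω)
    (tensorIntegralClosureEquiv A F E Ω).injective

theorem isSpecialization_of_algHom {K F E Ω M : Type} [Field K] [Field F] [Field E] [Field Ω]
    [Field M] [Algebra K F] [Algebra F E] [Algebra K Ω] [Algebra Ω M] [FiniteDimensional F E]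
    [Algebra.IsSeparable F E] (A : Subalgebra K F) (hfg : A.FG)
    (hcl : ∀ x : F, IsIntegral A x → x ∈ A) [hA : IsFractionRing A F] (j : F →ₐ[K] Ω) (e : E →+* M)
    (he : ∀ x, e (algebraMap F E x) = algebraMap Ω M (j x))
    (hgen : Algebra.adjoin Ω (Set.range e) = ⊤) : IsSpecialization K F E Ω M := by
  refine ⟨A, hfg, hcl, hA, j.comp A.val, ?_⟩
  let iE : Algebra A E := ((algebraMap F E).comp (algebraMap A F)).toAlgebra
  let iΩ : Algebra A Ω := (j.comp A.val).toRingHom.toAlgebra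
  let _ : Algebra F Ω := j.toRingHom.toAlgebra
  let _ : Algebra F M := ((algebraMap Ω M).comp j.toRingHom).toAlgebra
  have : @IsScalarTower A F E Algebra.toSMul Algebra.toSMul iE.toSMul := .of_algebraMap_eq fun _ => rfl
  have : @IsScalarTower A F Ω Algebra.toSMul Algebra.toSMul iΩ.toSMul := .of_algebraMap_eq fun _ => rfl
  have : IsScalarTower F Ω M := .of_algebraMap_eq fun _ => rfl
  let e' : E →ₐ[F] M := { e with commutes' := he }
  exact ⟨isReduced_tensor_integralClosure A F E Ω,
    exists_maximal_quotient_tensor_integralClosure A e' hgen⟩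

theorem exists_normal_subalgebra (K A₀ K₀ F : Type*) [Field K] [CommRing A₀] [IsDomain A₀]
    [IsIntegrallyClosed A₀] [Algebra K A₀] [Algebra.FiniteType K A₀] [Field K₀] [CharZero K₀]
    [Algebra A₀ K₀] [IsFractionRing A₀ K₀] [Field F] [Algebra K₀ F] [Algebra A₀ F] [Algebra K F]
    [IsScalarTower A₀ K₀ F] [IsScalarTower K A₀ F] [FiniteDimensional K₀ F] :
    ∃ A : Subalgebra K F, A.FG ∧ (∀ x : F, IsIntegral A x → x ∈ A) ∧ IsFractionRing A F := by
  have : IsNoetherianRing A₀ := Algebra.FiniteType.isNoetherianRing K A₀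
  have hfin : Module.Finite A₀ (integralClosure A₀ F) :=
    IsIntegralClosure.finite A₀ K₀ F (integralClosure A₀ F)
  refine ⟨(integralClosure A₀ F).restrictScalars K, ?_, fun x hx => ?_, ?_⟩
  · have : IsScalarTower K A₀ (integralClosure A₀ F) :=
      .of_algebraMap_eq fun x => Subtype.ext (IsScalarTower.algebraMap_apply K A₀ F x)
    rw [Subalgebra.fg_iff_finiteType]
    have h : Algebra.FiniteType K (integralClosure A₀ F) :=
      Algebra.FiniteType.trans (S := A₀) inferInstance inferInstance
    exact h
  · have hx' : IsIntegral (integralClosure A₀ F) x := hx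
    exact isIntegral_trans x hx'
  · exact integralClosure.isFractionRing_of_finite_extension K₀ F

end SpecializationCore

section

open Polynomial Finset

section Labels

variable {K₀ C U : Type*} [Field K₀] [Field C] [Algebra K₀ C]

theorem exists_aut_of_perm_labels {P : K₀[X]} {E₀ : Type*} [Field E₀] [Algebra K₀ E₀]
    (hfull : ∀ π : Equiv.Perm (P.rootSet E₀), ∃ γ : E₀ ≃ₐ[K₀] E₀, ∀ z : P.rootSet E₀, γ z = π z)
    (lab : U ↪ P.rootSet E₀) (π : Equiv.Perm U) :
    ∃ γ : E₀ ≃ₐ[K₀] E₀, ∀ u, γ (lab u) = lab (π u) := by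
  obtain ⟨γ, hγ⟩ := hfull (π.viaEmbedding lab)
  exact ⟨γ, fun u => by rw [hγ, Equiv.Perm.viaEmbedding_apply]⟩

theorem exists_algHom_labels [Finite U] {P : K₀[X]} {E₀ : Type*} [Field E₀] [Algebra K₀ E₀]
    [P.IsSplittingField K₀ E₀]
    (hfull : ∀ π : Equiv.Perm (P.rootSet E₀), ∃ γ : E₀ ≃ₐ[K₀] E₀, ∀ z : P.rootSet E₀, γ z = π z)
    (lab : U ↪ P.rootSet E₀) (ι₀ : E₀ →ₐ[K₀] C) {z : U → C} (hz : Function.Injective z)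
    (hzP : ∀ u, z u ∈ P.rootSet C) : ∃ ι : E₀ →ₐ[K₀] C, ∀ u, ι (lab u) = z u := by
  have h1 : ∀ u, ∃ w : P.rootSet E₀, ι₀ w = z u := by
    intro u
    have h := (IsSplittingField.splits E₀ P).image_rootSet ι₀
    have hu := hzP u
    rw [← h] at hu
    obtain ⟨w, hw, hwu⟩ := hu
    exact ⟨⟨w, hw⟩, hwu⟩
  choose w hw using h1
  have hwinj : Function.Injective w := fun u u' h => hz (by rw [← hw, ← hw, h])
  classical
  let e : {x // x ∈ Set.range lab} ≃ {x // x ∈ Set.range w} :=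
    (Equiv.ofInjective lab lab.injective).symm.trans (Equiv.ofInjective w hwinj)
  obtain ⟨γ, hγ⟩ := hfull e.extendSubtype
  refine ⟨ι₀.comp γ.toAlgHom, fun u => ?_⟩
  have h2 : e.extendSubtype (lab u) = w u := by
    rw [Equiv.extendSubtype_apply_of_mem _ _ ⟨u, rfl⟩]
    change (Equiv.ofInjective w hwinj ((Equiv.ofInjective lab lab.injective).symm
      (Equiv.ofInjective lab lab.injective u)) : P.rootSet E₀) = w u
    rw [Equiv.symm_apply_apply]
    rfl
  rw [← hw, ← h2, ← hγ]
  rfl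

end Labels

section FunctionField

theorem algebraicIndependent_isAlgebraic_of_isFractionRing (K K₀ F : Type*) [Field K] [Field K₀]
    [Algebra (MvPolynomial (Fin 2) K) K₀] [IsFractionRing (MvPolynomial (Fin 2) K) K₀]
    [Algebra K K₀] [IsScalarTower K (MvPolynomial (Fin 2) K) K₀] [Field F] [Algebra K₀ F]
    [Algebra K F] [IsScalarTower K K₀ F] [FiniteDimensional K₀ F] :
    (⊤ : IntermediateField K F).FG ∧ ∃ x y : F, AlgebraicIndependent K ![x, y] ∧
      Algebra.IsAlgebraic (IntermediateField.adjoin K {x, y}) F := by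
  constructor
  · rw [IntermediateField.fg_top_iff]
    have h1 : Algebra.EssFiniteType (MvPolynomial (Fin 2) K) K₀ :=
      Algebra.EssFiniteType.of_isLocalization _ (nonZeroDivisors (MvPolynomial (Fin 2) K))
    have h2 : Algebra.EssFiniteType K K₀ := Algebra.EssFiniteType.comp K (MvPolynomial (Fin 2) K) K₀
    exact Algebra.EssFiniteType.comp K K₀ F
  · let g : MvPolynomial (Fin 2) K →ₐ[K] F :=
      (IsScalarTower.toAlgHom K K₀ F).comp (IsScalarTower.toAlgHom K (MvPolynomial (Fin 2) K) K₀)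
    have hg : Function.Injective g := (algebraMap K₀ F).injective.comp
      (IsFractionRing.injective (MvPolynomial (Fin 2) K) K₀)
    have hg' : g = MvPolynomial.aeval ![g (MvPolynomial.X 0), g (MvPolynomial.X 1)] := by
      ext i; fin_cases i <;> simp
    refine ⟨g (MvPolynomial.X 0), g (MvPolynomial.X 1), ?_, ?_⟩
    · rw [AlgebraicIndependent, ← hg']
      exact hg
    · set M := IntermediateField.adjoin K {g (MvPolynomial.X 0), g (MvPolynomial.X 1)}
      have hM : ∀ a, g a ∈ M := by
        intro a
        induction a using MvPolynomial.induction_on with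
        | C c => rw [← MvPolynomial.algebraMap_eq, g.commutes]; exact M.algebraMap_mem c
        | add a b ha hb => rw [map_add]; exact M.add_mem ha hb
        | mul_X a i ha =>
          rw [map_mul]
          refine M.mul_mem ha (IntermediateField.subset_adjoin K _ ?_)
          fin_cases i <;> simp
      have hK₀ : ∀ q : K₀, algebraMap K₀ F q ∈ M := by
        intro q
        obtain ⟨a, b, -, rfl⟩ := IsFractionRing.div_surjective (A := MvPolynomial (Fin 2) K) q
        rw [map_div₀]
        exact M.div_mem (hM a) (hM b)
      let _ : Algebra K₀ M := ((algebraMap K₀ F).codRestrict M.toSubring hK₀).toAlgebra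
      have : IsScalarTower K₀ M F := .of_algebraMap_eq fun _ => rfl
      exact Algebra.IsAlgebraic.tower_top (K := K₀) M

end FunctionField

section GenericPolynomial

/-- The polynomial `genericFamily` with independent variables as parameters. -/
noncomputable def genericPolynomial (K K₀ : Type*) [Field K] [Field K₀]
    [Algebra (MvPolynomial (Fin 2) K) K₀] (d R n m : ℕ) : K₀[X] :=
  genericFamily d R n m (algebraMap (MvPolynomial (Fin 2) K) K₀ (MvPolynomial.X 0))
    (algebraMap (MvPolynomial (Fin 2) K) K₀ (MvPolynomial.X 1))

variable {K K₀ : Type*} [Field K] [Field K₀] [Algebra (MvPolynomial (Fin 2) K) K₀]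
  [IsFractionRing (MvPolynomial (Fin 2) K) K₀]

theorem exists_algHom_of_algebraicIndependent (K₀ : Type*) [Field K₀]
    [Algebra (MvPolynomial (Fin 2) K) K₀] [IsFractionRing (MvPolynomial (Fin 2) K) K₀]
    [Algebra K K₀] [IsScalarTower K (MvPolynomial (Fin 2) K) K₀] {k : Type*} [Field k] [Algebra K k]
    {s t : k} (h : AlgebraicIndependent K ![s, t]) :
    ∃ g : K₀ →ₐ[K] k,
      g (algebraMap (MvPolynomial (Fin 2) K) K₀ (MvPolynomial.X 0)) = s ∧
      g (algebraMap (MvPolynomial (Fin 2) K) K₀ (MvPolynomial.X 1)) = t := by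
  have hinj : Function.Injective (MvPolynomial.aeval ![s, t] : MvPolynomial (Fin 2) K →ₐ[K] k) := h
  have hg : ∀ x, IsFractionRing.liftAlgHom (K := K₀) hinj
      (algebraMap (MvPolynomial (Fin 2) K) K₀ x) = MvPolynomial.aeval ![s, t] x :=
    fun x => IsFractionRing.lift_algebraMap (K := K₀) (A := MvPolynomial (Fin 2) K)
      (g := (MvPolynomial.aeval ![s, t] : MvPolynomial (Fin 2) K →ₐ[K] k).toRingHom) hinj x
  exact ⟨IsFractionRing.liftAlgHom hinj, (hg _).trans (by simp), (hg _).trans (by simp)⟩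

variable {d R n m : ℕ}

theorem irreducible_genericPolynomial [CharZero K] (hd0 : d ≠ 0)
    (hn : 2 ≤ n) (hmn : m < n) (hdeg : m + d * (R * (d.totient * d)) = n) :
    Irreducible (genericPolynomial K K₀ d R n m) := by
  have h := irreducible_genericFamily (K := K) hd0 hn hmn hdeg
  rw [(genericFamily_monic hd0 hn hmn hdeg _ _).irreducible_iff_irreducible_map_fraction_map
    (K := K₀), genericFamily_map] at h
  exact h

theorem exists_gal_genericPolynomial [CharZero K] [CharZero K₀] [Countable K]
    [Algebra K K₀] [IsScalarTower K (MvPolynomial (Fin 2) K) K₀]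
    {k C : Type*} [NontriviallyNormedField k] [CompleteSpace k] [IsUltrametricDist k] [CharZero k] [Field C]
    [Algebra k C] [IsAlgClosure k C] [Algebra.IsAlgebraic k C] [Algebra K k] {p f : ℕ}
    [Fact p.Prime] {s₀ : k} (hs₀ : s₀ ≠ 0)
    (hloc : ∀ s : k, ‖s‖ = ‖s₀‖ → IsLocalValuation k (spectralValuation k C) p f s)
    (hd0 : d ≠ 0) (hn : n.Prime) (hm0 : m ≠ 0) (hmn : m < n)
    (hdeg : m + d * (R * (d.totient * d)) = n) (hnp : n < p)
    (π : Equiv.Perm ((genericPolynomial K K₀ d R n m).rootSet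
      (genericPolynomial K K₀ d R n m).SplittingField)) :
    ∃ γ : (genericPolynomial K K₀ d R n m).SplittingField ≃ₐ[K₀]
      (genericPolynomial K K₀ d R n m).SplittingField, ∀ z : (genericPolynomial K K₀ d R n m).rootSet
        (genericPolynomial K K₀ d R n m).SplittingField, γ z = π z := by
  obtain ⟨s, t, hind, h⟩ := exists_algebraicIndependent_transposition K hs₀ hloc hd0 hn.two_le hm0
    hmn hdeg hnp
  obtain ⟨g, hgs, hgt⟩ := exists_algHom_of_algebraicIndependent K₀ hind
  have : IsAlgClosed C := IsAlgClosure.isAlgClosed k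
  let _ : Algebra K₀ k := g.toRingHom.toAlgebra
  let _ : Algebra K₀ C :=
    ((algebraMap k C).comp g.toRingHom).toAlgebra
  have : IsScalarTower K₀ k C := .of_algebraMap_eq fun _ => rfl
  have hirr := irreducible_genericPolynomial (K := K) (K₀ := K₀) hd0 hn.two_le hmn hdeg
  have hmap : (genericPolynomial K K₀ d R n m).map
      (algebraMap K₀ C) =
      genericFamily d R n m (algebraMap k C s) (algebraMap k C t) := by
    rw [genericPolynomial, genericFamily_map, ← hgs, ← hgt]
    rfl
  rw [← hmap] at h
  have hroot : ∀ x : C, ((genericPolynomial K K₀ d R n m).map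
      (algebraMap K₀ C)).IsRoot x ↔
      x ∈ (genericPolynomial K K₀ d R n m).rootSet C := fun x => by
    rw [mem_rootSet_of_ne hirr.ne_zero, IsRoot.def, eval_map_algebraMap]
  simp only [hroot] at h
  obtain ⟨σ, x, y, hxy, hx, hy, hσx, hσy, hσ⟩ := h hirr.separable.map
  refine exists_gal_of_transposition hirr ?_
    (σ.restrictScalars K₀) hxy hx hy hσx hσy hσ π
  rw [genericPolynomial, natDegree_genericFamily hd0 hn.two_le hmn hdeg]
  exact hn

end GenericPolynomial

end

section

open Polynomial

section LocalSpecialization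

theorem exists_restrictNormalHom_fieldRange {k L C G : Type*} [Field k] [Field L] [Field C]
    [Algebra k L] [Algebra k C] [Normal k L] [Normal k C] [Group G] (emb : L →ₐ[k] C)
    {f : (L ≃ₐ[k] L) →* G} (hf : Function.Injective f) :
    ∃ φ : (C ≃ₐ[k] C) →* G, ∀ σ, φ σ = 1 ↔ ∀ x ∈ emb.fieldRange, σ x = x := by
  let _ : Algebra L C := emb.toRingHom.toAlgebra
  have : IsScalarTower k L C := .of_algebraMap_eq fun x => (emb.commutes x).symm
  refine ⟨f.comp (AlgEquiv.restrictNormalHom L), fun σ => ?_⟩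
  have h : ∀ x, emb (AlgEquiv.restrictNormalHom L σ x) = σ (emb x) :=
    fun x => AlgEquiv.restrictNormal_commutes σ L x
  rw [MonoidHom.comp_apply, map_eq_one_iff f hf]
  constructor
  · rintro hσ _ ⟨x, rfl⟩
    exact (h x).symm.trans (by rw [hσ]; rfl)
  · intro hσ
    ext x
    exact emb.injective ((h x).trans (hσ _ ⟨x, rfl⟩))

theorem isSpecialization_fixedField {K K₀ k G L : Type} [Field K] [Field K₀]
    [CharZero K] [CharZero K₀] [Countable K] [Group G] [Finite G]
    [Algebra (MvPolynomial (Fin 2) K) K₀] [IsFractionRing (MvPolynomial (Fin 2) K) K₀]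
    [Algebra K K₀] [IsScalarTower K (MvPolynomial (Fin 2) K) K₀]
    {d R n m : ℕ} (hd : 2 ≤ d) (hGd : Nat.card G ∣ d)
    (hGR : Nat.card G * d.totient ≤ R) (hn : 2 ≤ n) (hmn : m < n)
    (hdeg : m + d * (R * (d.totient * d)) = n)
    {E₀ : Type} [Field E₀] [Algebra K₀ E₀]
    [(genericPolynomial K K₀ d R n m).IsSplittingField K₀ E₀]
    (hfull : ∀ π : Equiv.Perm ((genericPolynomial K K₀ d R n m).rootSet E₀),
      ∃ γ : E₀ ≃ₐ[K₀] E₀, ∀ z : (genericPolynomial K K₀ d R n m).rootSet E₀, γ z = π z)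
    (lab : G × Fin (d.totient * d * d) ↪ (genericPolynomial K K₀ d R n m).rootSet E₀)
    {F : IntermediateField K₀ E₀} {Φ : (E₀ ≃ₐ[F] E₀) →* G}
    (hΦ : ∀ (ρ : E₀ ≃ₐ[K₀] E₀) (g : G),
      (∀ a y, ∃ y', ρ (lab (a, y)) = lab (g * a, y')) →
        ∃ τ : E₀ ≃ₐ[F] E₀, (∀ x, τ x = ρ x) ∧ Φ τ = g)
    [Algebra K F] [IsScalarTower K K₀ F]
    [NontriviallyNormedField k] [CompleteSpace k] [IsUltrametricDist k] [CharZero k]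
    [Algebra K k] {p f : ℕ} [Fact p.Prime] {s₀ : k} (hs₀ : s₀ ≠ 0)
    (hloc : ∀ s : k, ‖s‖ = ‖s₀‖ →
      IsLocalValuation k (spectralValuation k (AlgebraicClosure k)) p f s)
    (hp : residueBound d R < p) [Field L] [Algebra k L] [FiniteDimensional k L] [IsGalois k L]
    {ψ : (L ≃ₐ[k] L) →* G} (hψ : Function.Injective ψ) :
    IsSpecialization K F (IntermediateField.fixedField Φ.ker) k L := by
  have : FiniteDimensional K₀ E₀ :=
    IsSplittingField.finiteDimensional E₀ (genericPolynomial K K₀ d R n m)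
  have : Normal K₀ E₀ := .of_isSplittingField (genericPolynomial K K₀ d R n m)
  let emb : L →ₐ[k] AlgebraicClosure k := IsAlgClosed.lift
  have : FiniteDimensional k emb.fieldRange :=
    (AlgEquiv.ofInjectiveField emb).toLinearEquiv.finiteDimensional
  have : Normal k emb.fieldRange := Normal.of_algEquiv (AlgEquiv.ofInjectiveField emb)
  obtain ⟨φ, hφ⟩ := exists_restrictNormalHom_fieldRange emb hψ
  obtain ⟨s, t, hind, h⟩ := exists_algebraicIndependent_labelling (G := G) K hs₀ hloc hd hGd hGR hn
    hmn hdeg hp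
  obtain ⟨z, hz, hzP, hσz⟩ := h emb.fieldRange φ hφ
  obtain ⟨g, hgs, hgt⟩ := exists_algHom_of_algebraicIndependent K₀ hind
  let _ : Algebra K₀ k := g.toRingHom.toAlgebra
  have hirr := irreducible_genericPolynomial (K := K) (K₀ := K₀) (by omega) hn hmn hdeg
  have hmap : (genericPolynomial K K₀ d R n m).map (algebraMap K₀ (AlgebraicClosure k)) =
      genericFamily d R n m (algebraMap k _ s) (algebraMap k _ t) := by
    rw [genericPolynomial, genericFamily_map, IsScalarTower.algebraMap_apply K₀ k,
      IsScalarTower.algebraMap_apply K₀ k, ← hgs, ← hgt]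
    rfl
  have hzP' : ∀ u, z u ∈ (genericPolynomial K K₀ d R n m).rootSet (AlgebraicClosure k) := by
    intro u
    rw [mem_rootSet_of_ne hirr.ne_zero, ← eval_map_algebraMap, hmap]
    exact hzP u
  obtain ⟨ι, hι⟩ := exists_algHom_labels hfull lab IsAlgClosed.lift hz hzP'
  obtain ⟨j, hj, e, he, hgen⟩ := exists_algHom_of_labelling (lab := fun u => (lab u : E₀)) hΦ ι
    emb.fieldRange φ hφ fun σ a y => by
      obtain ⟨y', hy'⟩ := hσz σ a y
      exact ⟨y', by rw [hι, hι, hy']⟩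
  let _ : Algebra (MvPolynomial (Fin 2) K) F :=
    ((algebraMap K₀ F).comp (algebraMap (MvPolynomial (Fin 2) K) K₀)).toAlgebra
  have : IsScalarTower (MvPolynomial (Fin 2) K) K₀ F := .of_algebraMap_eq fun _ => rfl
  have : IsScalarTower K (MvPolynomial (Fin 2) K) F := .of_algebraMap_eq fun x => by
    rw [IsScalarTower.algebraMap_apply K K₀ F, IsScalarTower.algebraMap_apply K (MvPolynomial (Fin 2) K) K₀]
    rfl
  obtain ⟨A, hA, hcl, hfrac⟩ := exists_normal_subalgebra K (MvPolynomial (Fin 2) K) K₀ F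
  let ε : emb.fieldRange ≃ₐ[k] L := (AlgEquiv.ofInjectiveField emb).symm
  let j' : F →ₐ[K] k := { j.toRingHom with
    commutes' := fun x => by
      rw [IsScalarTower.algebraMap_apply K K₀ F]
      exact (j.commutes _).trans (g.commutes x) }
  refine isSpecialization_of_algHom A hA hcl j' (ε.toRingEquiv.toRingHom.comp e) (fun x => ?_) ?_
  · have h1 : e (algebraMap F _ x) = algebraMap k emb.fieldRange (j x) :=
      Subtype.ext ((he _).trans (hj x).symm)
    change ε (e (algebraMap F _ x)) = _
    rw [h1, ε.commutes]
    rfl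
  · have h2 := congrArg (Subalgebra.map ε.toAlgHom) hgen
    rw [AlgHom.map_adjoin, ← Set.range_comp] at h2
    refine h2.trans ?_
    rw [Algebra.map_top, AlgHom.range_eq_top]
    exact ε.surjective

end LocalSpecialization

section Primes

open IsDedekindDomain NumberField

variable {K : Type*} [Field K] [NumberField K]

theorem exists_prime_mem_asIdeal {v : HeightOneSpectrum (𝓞 K)} {N : ℕ}
    (hv : (N.factorial : 𝓞 K) ∉ v.asIdeal) : ∃ p : ℕ, p.Prime ∧ N < p ∧ (p : 𝓞 K) ∈ v.asIdeal := by
  have hfin : Finite (𝓞 K ⧸ v.asIdeal) := v.asIdeal.finiteQuotientOfFreeOfNeBot v.ne_bot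
  have : IsDomain (𝓞 K ⧸ v.asIdeal) := Ideal.Quotient.isDomain _
  obtain ⟨p, hp⟩ := CharP.exists (𝓞 K ⧸ v.asIdeal)
  have hpv : (p : 𝓞 K) ∈ v.asIdeal := by
    rw [← Ideal.Quotient.eq_zero_iff_mem, map_natCast, CharP.cast_eq_zero]
  have hpp : p.Prime := CharP.char_is_prime (𝓞 K ⧸ v.asIdeal) p
  refine ⟨p, hpp, lt_of_not_ge fun hpN => hv ?_, hpv⟩
  obtain ⟨c, hc⟩ := hpp.dvd_factorial.2 hpN
  rw [hc, Nat.cast_mul]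
  exact v.asIdeal.mul_mem_right _ hpv

variable (K)

theorem exists_finset_mem_asIdeal {N : ℕ} (hN : N ≠ 0) :
    ∃ T : Finset (HeightOneSpectrum (𝓞 K)), ∀ v ∉ T, (N : 𝓞 K) ∉ v.asIdeal := by
  have hI : Ideal.span {(N : 𝓞 K)} ≠ 0 := by
    simpa using hN
  refine ⟨(Ideal.finite_factors hI).toFinset, fun v hv hvN => hv ?_⟩
  rw [Set.Finite.mem_toFinset]
  exact Ideal.dvd_iff_le.2 (by simpa [Ideal.span_le] using hvN)

theorem exists_heightOneSpectrum_mem {p : ℕ} (hp : p.Prime) :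
    ∃ v : HeightOneSpectrum (𝓞 K), (p : 𝓞 K) ∈ v.asIdeal := by
  have hspan : Ideal.span {(p : 𝓞 K)} ≠ ⊤ := by
    rw [Ne, Ideal.span_singleton_eq_top]
    intro h
    have h1 := h.map (Algebra.norm ℤ)
    rw [← map_natCast (algebraMap ℤ (𝓞 K)), Algebra.norm_algebraMap, isUnit_pow_iff
      Module.finrank_pos.ne'] at h1
    simp only [Int.isUnit_iff] at h1
    have := hp.two_le
    omega
  obtain ⟨M, hM, hle⟩ := Ideal.exists_le_maximal _ hspan
  have hpM : (p : 𝓞 K) ∈ M := hle (Ideal.mem_span_singleton_self _)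
  refine ⟨⟨M, hM.isPrime, ?_⟩, hpM⟩
  rintro rfl
  exact hp.ne_zero (by simpa using hpM)

theorem NumberField.countable : Countable K := by
  have h := Algebraic.countable ℚ K
  rw [show {x : K | IsAlgebraic ℚ x} = Set.univ from
    Set.eq_univ_of_forall fun x => Algebra.IsAlgebraic.isAlgebraic x] at h
  exact Set.countable_univ_iff.1 h

end Primes

section Parameters

theorem exists_parameters (g : ℕ) (hg : 0 < g) : ∃ d R n m : ℕ, 2 ≤ d ∧ g ∣ d ∧ g * d.totient ≤ R ∧
    n.Prime ∧ 0 < m ∧ m < n ∧ m + d * (R * (d.totient * d)) = n ∧ g * (d.totient * d * d) ≤ n := by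
  have hd : 0 < 2 * g := by omega
  have hφ : 0 < (2 * g).totient := Nat.totient_pos.2 hd
  have hN : 0 < 2 * g * (g * (2 * g).totient * ((2 * g).totient * (2 * g))) := by positivity
  obtain ⟨n, hn, hnp⟩ := Nat.exists_infinite_primes
    (2 * g * (g * (2 * g).totient * ((2 * g).totient * (2 * g))) + 1 +
      g * ((2 * g).totient * (2 * g) * (2 * g)))
  exact ⟨2 * g, g * (2 * g).totient, n,
    n - 2 * g * (g * (2 * g).totient * ((2 * g).totient * (2 * g))), by omega, ⟨2, mul_comm _ _⟩,
    le_rfl, hnp, by omega, by omega, by omega, by omega⟩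

end Parameters

end

section Generic

open Polynomial

attribute [local instance] adicNontriviallyNormedField

/-- The generic polynomial over a number field has the full symmetric group as Galois group. -/
theorem exists_gal_genericPolynomial_of_numberField (K : Type*) [Field K] [NumberField K]
    (K₀ : Type*) [Field K₀] [Algebra (MvPolynomial (Fin 2) K) K₀]
    [IsFractionRing (MvPolynomial (Fin 2) K) K₀] [CharZero K₀] [Algebra K K₀]
    [IsScalarTower K (MvPolynomial (Fin 2) K) K₀] {d R n m : ℕ} (hd0 : d ≠ 0) (hn : n.Prime)
    (hm0 : m ≠ 0) (hmn : m < n) (hdeg : m + d * (R * (d.totient * d)) = n)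
    (π : Equiv.Perm ((genericPolynomial K K₀ d R n m).rootSet
      (genericPolynomial K K₀ d R n m).SplittingField)) :
    ∃ γ : (genericPolynomial K K₀ d R n m).SplittingField ≃ₐ[K₀]
      (genericPolynomial K K₀ d R n m).SplittingField, ∀ z : (genericPolynomial K K₀ d R n m).rootSet
        (genericPolynomial K K₀ d R n m).SplittingField, γ z = π z := by
  obtain ⟨p, hnp, hp⟩ := Nat.exists_infinite_primes (n + 1)
  obtain ⟨v, hpv⟩ := exists_heightOneSpectrum_mem K hp
  have : Fact p.Prime := ⟨hp⟩
  have : Countable K := NumberField.countable K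
  have : CharZero (v.adicCompletion K) := charZero_of_injective_algebraMap
    (algebraMap K (v.adicCompletion K)).injective
  obtain ⟨f, s₀, hs₀, hloc⟩ := exists_isLocalValuation_adicCompletion hpv
  exact exists_gal_genericPolynomial hs₀ (hloc (AlgebraicClosure (v.adicCompletion K))) hd0 hn hm0
    hmn hdeg hnp π

end Generic

/-- Part (1) of the Main Theorem: the local dimension of a finite group `G` over a number
field `K` is at most `2`.  There is a finite Galois extension `E/F`, with `F` a finitely
generated extension of `K` of transcendence degree `2` and `Gal(E/F) ≅ G`, and a finite set
`T` of primes of `K`, such that for every prime `v ∉ T` and every finite Galois extension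
`L` of the completion `K_v` with Galois group isomorphic to a subgroup of `G`, the extension
`L/K_v` is a specialization of `E/F` over `K_v`. -/
theorem local_dimension_le_two (K : Type) [Field K] [NumberField K]
    (G : Type) [Group G] [Finite G] :
    ∃ (F : Type) (_ : Field F) (_ : Algebra K F),
      (⊤ : IntermediateField K F).FG ∧
      (∃ x y : F, AlgebraicIndependent K ![x, y] ∧
        Algebra.IsAlgebraic (IntermediateField.adjoin K {x, y}) F) ∧
      ∃ (E : Type) (_ : Field E) (_ : Algebra F E),
        FiniteDimensional F E ∧ IsGalois F E ∧ Nonempty ((E ≃ₐ[F] E) ≃* G) ∧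
        ∃ T : Finset (HeightOneSpectrum (𝓞 K)),
          ∀ v : HeightOneSpectrum (𝓞 K), v ∉ T →
            ∀ (L : Type) (_ : Field L) (_ : Algebra (v.adicCompletion K) L),
              FiniteDimensional (v.adicCompletion K) L →
              IsGalois (v.adicCompletion K) L →
              (∃ f : (L ≃ₐ[v.adicCompletion K] L) →* G, Function.Injective f) →
              IsSpecialization K F E (v.adicCompletion K) L := by
  obtain ⟨d, R, n, m, hd, hGd, hGR, hn, hm, hmn, hdeg, hle⟩ := exists_parameters (Nat.card G)
    Nat.card_pos
  have : Countable K := NumberField.countable K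
  let K₀ := FractionRing (MvPolynomial (Fin 2) K)
  have : CharZero K₀ := charZero_of_injective_algebraMap (algebraMap K K₀).injective
  let P := genericPolynomial K K₀ d R n m
  have hirr : Irreducible P := irreducible_genericPolynomial (by omega) hn.two_le hmn hdeg
  let E₀ := P.SplittingField
  have : IsGalois K₀ E₀ := .of_separable_splitting_field (p := P) hirr.separable
  have hfull : ∀ π : Equiv.Perm (P.rootSet E₀), ∃ γ : E₀ ≃ₐ[K₀] E₀, ∀ z : P.rootSet E₀,
      γ z = π z :=
    exists_gal_genericPolynomial_of_numberField K K₀ (by omega) hn hm.ne' hmn hdeg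
  have hcard : Nat.card (G × Fin (d.totient * d * d)) ≤ Nat.card (P.rootSet E₀) := by
    rw [Nat.card_eq_fintype_card (α := P.rootSet E₀), Polynomial.card_rootSet_eq_natDegree
      hirr.separable (Polynomial.SplittingField.splits P)]
    change _ ≤ (genericPolynomial K K₀ d R n m).natDegree
    rw [genericPolynomial, natDegree_genericFamily (by omega) hn.two_le hmn hdeg, Nat.card_prod,
      Nat.card_fin]
    exact hle
  obtain ⟨lab⟩ : Nonempty (G × Fin (d.totient * d * d) ↪ P.rootSet E₀) := by
    have := Fintype.ofFinite (G × Fin (d.totient * d * d))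
    rw [Nat.card_eq_fintype_card, Nat.card_eq_fintype_card] at hcard
    exact Function.Embedding.nonempty_of_card_le hcard
  have : Nonempty (Fin (d.totient * d * d)) := by
    have := Nat.totient_pos.2 (show 0 < d by omega)
    exact ⟨⟨0, by positivity⟩⟩
  obtain ⟨F, Φ, hΦs, hΦ⟩ := exists_intermediateField_labelling
    (lab := fun u => (lab u : E₀)) (Subtype.val_injective.comp lab.injective) fun g => by
      obtain ⟨ρ, hρ⟩ := exists_aut_of_perm_labels hfull lab
        ((Equiv.mulLeft g).prodCongr (Equiv.refl _))
      exact ⟨ρ, fun a y => hρ (a, y)⟩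
  let _ : Algebra K F := ((algebraMap K₀ F).comp (algebraMap K K₀)).toAlgebra
  have : IsScalarTower K K₀ F := .of_algebraMap_eq fun _ => rfl
  obtain ⟨hFG, hdim⟩ := algebraicIndependent_isAlgebraic_of_isFractionRing K K₀ F
  obtain ⟨T, hT⟩ := exists_finset_mem_asIdeal K (residueBound d R).factorial_ne_zero
  refine ⟨F, inferInstance, inferInstance, hFG, hdim, IntermediateField.fixedField Φ.ker,
    inferInstance, inferInstance, inferInstance, .of_fixedField_normal_subgroup Φ.ker,
    nonempty_gal_fixedField_ker_mulEquiv Φ hΦs, T, fun v hv L _ _ _ _ ⟨ψ, hψ⟩ => ?_⟩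
  obtain ⟨p, hp, hNp, hpv⟩ := exists_prime_mem_asIdeal (hT v hv)
  have : Fact p.Prime := ⟨hp⟩
  have : CharZero (v.adicCompletion K) := charZero_of_injective_algebraMap
    (algebraMap K (v.adicCompletion K)).injective
  obtain ⟨f, s₀, hs₀, hloc⟩ := exists_isLocalValuation_adicCompletion hpv
  let _ := adicNontriviallyNormedField K v
  exact isSpecialization_fixedField hd hGd hGR hn.two_le hmn hdeg hfull lab hΦ hs₀
    (hloc (AlgebraicClosure (v.adicCompletion K))) hNp hψ
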